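/- Let Γ ⊂ ℝ³ be an analytic Jordan curve such that every plane in ℝ³ has at most four common points with Γ counting multiplicities, and every plane parallel to the z-axis has at most two common points with Γ counting multiplicities. Then there exists ε > 0 such that for every t with |t| < ε there are a Jordan domain Ω ⊂ ℝ² with analytic boundary and a function f real analytic in the closed domain Ω̄ satisfying the isotropic CRPC equation f_xx + f_yy = t·√(f_xy² − f_xx·f_yy) on Ω, whose graph z = f(x,y) over Ω̄ has boundary exactly Γ. -/

import Mathlib

open Set Filter
open scoped BigOperators Topology

noncomputable section

/-- Partial derivative in the first variable. -/
def pdx (f : ℝ × ℝ → ℝ) (p : ℝ × ℝ) : ℝ := deriv (fun s : ℝ => f (s, p.2)) p.1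

/-- Partial derivative in the second variable. -/
def pdy (f : ℝ × ℝ → ℝ) (p : ℝ × ℝ) : ℝ := deriv (fun s : ℝ => f (p.1, s)) p.2

/-- Second partial derivatives. -/
def fxx (f : ℝ × ℝ → ℝ) : ℝ × ℝ → ℝ := pdx (pdx f)
def fxy (f : ℝ × ℝ → ℝ) : ℝ × ℝ → ℝ := pdy (pdx f)
def fyy (f : ℝ × ℝ → ℝ) : ℝ × ℝ → ℝ := pdy (pdy f)

/-- An analytic Jordan curve: image of a periodic injective real analytic map with
nowhere vanishing derivative. -/
def IsAnalyticJordanCurve {E : Type*} [NormedAddCommGroup E] [NormedSpace ℝ E]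
    (Γ : Set E) : Prop :=
  ∃ (γ : ℝ → E) (T : ℝ), 0 < T ∧
    AnalyticOnNhd ℝ γ univ ∧
    (∀ s, γ (s + T) = γ s) ∧
    InjOn γ (Ico 0 T) ∧
    (∀ s, deriv γ s ≠ 0) ∧
    Γ = range γ

/-- A Jordan domain with analytic boundary. -/
def IsAnalyticJordanDomain (Ω : Set (ℝ × ℝ)) : Prop :=
  IsOpen Ω ∧ Bornology.IsBounded Ω ∧ IsConnected Ω ∧ IsAnalyticJordanCurve (frontier Ω)

/-- `f` is real analytic in the closed set `s` : it agrees on `s` with a function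
analytic on an open neighborhood of `s`. -/
def AnalyticOnClosed {E : Type*} [NormedAddCommGroup E] [NormedSpace ℝ E]
    (f : E → ℝ) (s : Set E) : Prop :=
  ∃ (U : Set E) (g : E → ℝ), IsOpen U ∧ s ⊆ U ∧ AnalyticOnNhd ℝ g U ∧ EqOn f g s

/-- The isotropic CRPC equation with parameter `t` at a point. -/
def IsotropicCRPCAt (t : ℝ) (f : ℝ × ℝ → ℝ) (p : ℝ × ℝ) : Prop :=
  fxx f p + fyy f p = t * Real.sqrt ((fxy f p) ^ 2 - fxx f p * fyy f p)

/-- The Euclidean CRPC equation with parameter `t` at a point. -/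
def EuclideanCRPCAt (t : ℝ) (f : ℝ × ℝ → ℝ) (p : ℝ × ℝ) : Prop :=
  (1 + (pdy f p) ^ 2) * fxx f p - 2 * pdx f p * pdy f p * fxy f p
      + (1 + (pdx f p) ^ 2) * fyy f p
    = t * Real.sqrt ((1 + (pdx f p) ^ 2 + (pdy f p) ^ 2)
        * ((fxy f p) ^ 2 - fxx f p * fyy f p))

/-- Hölder condition with exponent 1/2 on a set. -/
def HolderHalfOn (g : ℝ × ℝ → ℝ) (s : Set (ℝ × ℝ)) : Prop :=
  ∃ C : ℝ, ∀ u ∈ s, ∀ v ∈ s, |g u - g v| ≤ C * ‖u - v‖ ^ ((1 : ℝ) / 2)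

def C0norm (g : ℝ × ℝ → ℝ) (s : Set (ℝ × ℝ)) : ℝ := sSup ((fun p => |g p|) '' s)

def holderSemi (g : ℝ × ℝ → ℝ) (s : Set (ℝ × ℝ)) : ℝ :=
  sSup {r : ℝ | ∃ u ∈ s, ∃ v ∈ s, u ≠ v ∧ r = |g u - g v| / ‖u - v‖ ^ ((1 : ℝ) / 2)}

/-- The `C^{1/2}` Hölder norm. -/
def ChalfNorm (g : ℝ × ℝ → ℝ) (s : Set (ℝ × ℝ)) : ℝ := C0norm g s + holderSemi g s

/-- The `C²` norm. -/
def C2norm (f : ℝ × ℝ → ℝ) (s : Set (ℝ × ℝ)) : ℝ :=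
  C0norm f s + max (C0norm (pdx f) s) (C0norm (pdy f) s)
    + max (C0norm (fxx f) s) (max (C0norm (fxy f) s) (C0norm (fyy f) s))

/-- The `C^{2+1/2}` Hölder norm. -/
def C2halfNorm (f : ℝ × ℝ → ℝ) (s : Set (ℝ × ℝ)) : ℝ :=
  C2norm f s + max (holderSemi (fxx f) s) (max (holderSemi (fxy f) s) (holderSemi (fyy f) s))

/-- Membership in the class `C^{1/2}` on `Ω̄`. -/
def IsCHalf (g : ℝ × ℝ → ℝ) (Ω : Set (ℝ × ℝ)) : Prop :=
  ContinuousOn g (closure Ω) ∧ HolderHalfOn g Ω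

/-- Membership in the class `C^{2+1/2}` on `Ω̄`. -/
def IsC2Half (f : ℝ × ℝ → ℝ) (Ω : Set (ℝ × ℝ)) : Prop :=
  ContDiffOn ℝ 2 f Ω ∧
  ContinuousOn f (closure Ω) ∧ ContinuousOn (pdx f) (closure Ω) ∧
  ContinuousOn (pdy f) (closure Ω) ∧ ContinuousOn (fxx f) (closure Ω) ∧
  ContinuousOn (fxy f) (closure Ω) ∧ ContinuousOn (fyy f) (closure Ω) ∧
  HolderHalfOn (fxx f) Ω ∧ HolderHalfOn (fxy f) Ω ∧ HolderHalfOn (fyy f) Ω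

/-- `C^∞` up to the boundary. -/
def IsCInftyClosed (f : ℝ × ℝ → ℝ) (Ω : Set (ℝ × ℝ)) : Prop :=
  ContDiffOn ℝ (⊤ : ℕ∞) f Ω ∧ ∀ i j : ℕ, ContinuousOn (pdx^[i] (pdy^[j] f)) (closure Ω)

/-- Right-hand side of the recursive Poisson equation (isotropic case). -/
def poissonRHS (f : ℕ → ℝ × ℝ → ℝ) (m : ℕ) (p : ℝ × ℝ) : ℝ :=
  ((m : ℝ) * ∑ r ∈ Finset.range m, ((m - 1).choose r : ℝ) *
      (fxy (f r) p * fxy (f (m - r - 1)) p - fxx (f r) p * fyy (f (m - r - 1)) p)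
    - (1 / ((m : ℝ) + 1)) * ∑ r ∈ Finset.Icc 2 (m - 1), ((m + 1).choose r : ℝ) *
      (fxx (f r) p + fyy (f r) p) * (fxx (f (m - r + 1)) p + fyy (f (m - r + 1)) p))
  / ((2 : ℝ) ^ (1 - (if m = 1 then 1 else 0) : ℕ) *
      Real.sqrt ((fxy (f 0) p) ^ 2 - fxx (f 0) p * fyy (f 0) p))

/-- `C²`-convergence on `Ω` at parameter `t` of the series with terms `f m · t^m/m!`
to the function `F`. -/
def C2ConvergesTo (f : ℕ → ℝ × ℝ → ℝ) (Ω : Set (ℝ × ℝ)) (t : ℝ) (F : ℝ × ℝ → ℝ) : Prop :=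
  TendstoUniformlyOn
    (fun n p => ∑ m ∈ Finset.range n, f m p * t ^ m / (m.factorial : ℝ)) F atTop Ω ∧
  TendstoUniformlyOn
    (fun n p => ∑ m ∈ Finset.range n, pdx (f m) p * t ^ m / (m.factorial : ℝ)) (pdx F) atTop Ω ∧
  TendstoUniformlyOn
    (fun n p => ∑ m ∈ Finset.range n, pdy (f m) p * t ^ m / (m.factorial : ℝ)) (pdy F) atTop Ω ∧
  TendstoUniformlyOn
    (fun n p => ∑ m ∈ Finset.range n, fxx (f m) p * t ^ m / (m.factorial : ℝ)) (fxx F) atTop Ω ∧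
  TendstoUniformlyOn
    (fun n p => ∑ m ∈ Finset.range n, fxy (f m) p * t ^ m / (m.factorial : ℝ)) (fxy F) atTop Ω ∧
  TendstoUniformlyOn
    (fun n p => ∑ m ∈ Finset.range n, fyy (f m) p * t ^ m / (m.factorial : ℝ)) (fyy F) atTop Ω


/-- Multiplicity of an intersection point of a curve and a plane: the maximal `m`
(possibly `⊤`) such that the derivatives of orders `1,…,m-1` of `φ` vanish at `s`. -/
def intersectionMult (φ : ℝ → ℝ) (s : ℝ) : ℕ∞ :=
  sSup {m : ℕ∞ | ∀ i : ℕ, 1 ≤ i → (i : ℕ∞) < m → iteratedDeriv i φ s = 0}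

/-- Number of common points, counting multiplicities, of the curve `γ` (with period `T`)
and the plane `a x + b y + c z + d = 0`. -/
def planeCount (γ : ℝ → ℝ × ℝ × ℝ) (T a b c d : ℝ) : ℕ∞ :=
  ∑' s : {s : ℝ // s ∈ Ico 0 T ∧ a * (γ s).1 + b * (γ s).2.1 + c * (γ s).2.2 + d = 0},
    intersectionMult (fun u => a * (γ u).1 + b * (γ u).2.1 + c * (γ u).2.2 + d) s

namespace CRPC
open Metric Complex MeasureTheory
local notation "conj" => starRingEnd ℂ
open Metric Complex MeasureTheory intervalIntegral
open scoped Interval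

/-- holomorphic dependence of interval integrals on a parameter -/
lemma hasDerivAt_param {U : Set ℂ} (hU : IsOpen U) {F : ℂ → ℝ → ℂ} {a b : ℝ}
    (hc : ContinuousOn (Function.uncurry F) (U ×ˢ uIcc a b))
    (hd : ∀ t ∈ uIcc a b, DifferentiableOn ℂ (fun z => F z t) U) {z : ℂ} (hz : z ∈ U) :
    IntervalIntegrable (fun t => deriv (fun z => F z t) z) volume a b ∧
    HasDerivAt (fun z => ∫ t in a..b, F z t) (∫ t in a..b, deriv (fun z => F z t) z) z := by
  obtain ⟨r, hr, hrU⟩ := Metric.isOpen_iff.1 hU z hz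
  have hK : closedBall z (r/2) ⊆ U := (closedBall_subset_ball (by linarith)).trans hrU
  obtain ⟨C, hC⟩ : ∃ C, ∀ p ∈ closedBall z (r/2) ×ˢ uIcc a b, ‖Function.uncurry F p‖ ≤ C :=
    ((isCompact_closedBall z (r/2)).prod isCompact_uIcc).exists_bound_of_continuousOn
      (hc.mono (prod_mono hK le_rfl))
  have hcz : ∀ y ∈ U, ContinuousOn (F y) (uIcc a b) := fun y hy =>
    hc.comp (f := fun t => (y, t)) (by fun_prop) (fun t ht => ⟨hy, ht⟩)
  have hmeas : ∀ y ∈ U, AEStronglyMeasurable (F y) (volume.restrict (Ι a b)) := fun y hy =>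
    ((hcz y hy).mono uIoc_subset_uIcc).aestronglyMeasurable measurableSet_uIoc
  refine hasDerivAt_integral_of_dominated_loc_of_deriv_le (s := ball z (r/4)) (F := F)
    (F' := fun x t => deriv (fun z => F z t) x)
    (bound := fun _ => C / (r/4)) (ball_mem_nhds z (by linarith)) ?_ ?_ ?_ ?_ ?_ ?_
  · filter_upwards [hU.mem_nhds hz] with y hy using hmeas y hy
  · exact (hcz z hz).intervalIntegrable
  · -- limit of difference quotients
    have hseq : ∀ n : ℕ, z + ((r/4 / (n+1) : ℝ) : ℂ) ∈ U := fun n => hK (by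
      simp only [mem_closedBall, dist_self_add_left, norm_real]
      rw [Real.norm_of_nonneg (by positivity)]
      calc r/4/(n+1) ≤ r/4 := div_le_self (by positivity) (by linarith [n.cast_nonneg (α := ℝ)])
        _ ≤ r/2 := by linarith)
    have htend : Tendsto (fun n : ℕ => ((r/4 / (n+1) : ℝ) : ℂ)) atTop (𝓝[≠] 0) := by
      rw [tendsto_nhdsWithin_iff]
      constructor
      · rw [← ofReal_zero]
        apply (continuous_ofReal.tendsto 0).comp
        have := (tendsto_one_div_add_atTop_nhds_zero_nat (𝕜 := ℝ)).const_mul (r/4)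
        simpa [div_eq_mul_inv] using this
      · refine Eventually.of_forall fun n => ?_
        simp only [mem_compl_iff, mem_singleton_iff, ofReal_eq_zero]
        positivity
    refine aestronglyMeasurable_of_tendsto_ae atTop
      (f := fun (n : ℕ) t => ((r/4 / (n+1) : ℝ) : ℂ)⁻¹ • (F (z + ((r/4 / (n+1) : ℝ) : ℂ)) t - F z t))
      (fun n => ((hmeas _ (hseq n)).sub (hmeas z hz)).const_smul (((r/4 / (n+1) : ℝ) : ℂ)⁻¹)) ?_
    rw [ae_restrict_iff' measurableSet_uIoc]
    refine Eventually.of_forall fun t ht => ?_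
    have := ((hd t (uIoc_subset_uIcc ht)).differentiableAt (hU.mem_nhds hz)).hasDerivAt
    rw [hasDerivAt_iff_tendsto_slope_zero] at this
    exact this.comp htend
  · refine Eventually.of_forall fun t ht y hy => ?_
    have hsub : closedBall y (r/4) ⊆ closedBall z (r/2) :=
      closedBall_subset_closedBall' (by linarith [mem_ball.1 hy])
    refine norm_deriv_le_of_forall_mem_sphere_norm_le (by linarith) ?_ ?_
    · refine DifferentiableOn.diffContOnCl ?_
      rw [closure_ball _ (by linarith)]
      exact (hd t (uIoc_subset_uIcc ht)).mono (hsub.trans hK)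
    · intro x hx
      exact hC (x, t) ⟨hsub (sphere_subset_closedBall hx), uIoc_subset_uIcc ht⟩
  · exact intervalIntegrable_const
  · refine Eventually.of_forall fun t ht y hy => ?_
    have : y ∈ U := hrU (ball_subset_ball (by linarith) hy)
    exact ((hd t (uIoc_subset_uIcc ht)).differentiableAt (hU.mem_nhds this)).hasDerivAt

lemma differentiableOn_param {U : Set ℂ} (hU : IsOpen U) {F : ℂ → ℝ → ℂ} {a b : ℝ}
    (hc : ContinuousOn (Function.uncurry F) (U ×ˢ uIcc a b))
    (hd : ∀ t ∈ uIcc a b, DifferentiableOn ℂ (fun z => F z t) U) :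
    DifferentiableOn ℂ (fun z => ∫ t in a..b, F z t) U := fun _ hz =>
  (hasDerivAt_param hU hc hd hz).2.differentiableAt.differentiableWithinAt

/-- The radial averaging operator. -/
def rad (c : ℂ) (n : ℕ) (h : ℂ → ℂ) (y : ℂ) : ℂ := ∫ l in (0:ℝ)..1, (l:ℂ)^n * h (c + l * (y - c))

lemma seg_mem {U : Set ℂ} (hcv : Convex ℝ U) {c : ℂ} (hcU : c ∈ U) {y : ℂ} (hy : y ∈ U) {l : ℝ}
    (hl : l ∈ Icc (0:ℝ) 1) : c + l * (y - c) ∈ U := by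
  have := hcv.add_smul_sub_mem hcU hy hl
  simpa using this


lemma rad_cont {U : Set ℂ} (hcv : Convex ℝ U) {c : ℂ} (hcU : c ∈ U)
    {h : ℂ → ℂ} (hh : DifferentiableOn ℂ h U) (n : ℕ) : ContinuousOn (Function.uncurry fun y (l:ℝ) => (l:ℂ)^n * h (c + l * (y - c)))
    (U ×ˢ uIcc 0 1) := by
  simp only [Function.uncurry_def]
  refine ContinuousOn.mul (by fun_prop) ?_
  refine hh.continuousOn.comp (by fun_prop) ?_
  rintro ⟨y, l⟩ ⟨hy, hl⟩
  rw [uIcc_of_le zero_le_one] at hl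
  exact seg_mem hcv hcU hy hl

lemma rad_hasDerivAt {U : Set ℂ} (hU : IsOpen U) (hcv : Convex ℝ U) {c : ℂ} (hcU : c ∈ U)
    {h : ℂ → ℂ} (hh : DifferentiableOn ℂ h U) (n : ℕ) {y : ℂ} (hy : y ∈ U) :
    HasDerivAt (rad c n h) (rad c (n+1) (deriv h) y) y ∧
      (y - c) * rad c (n+1) (deriv h) y + (n+1) * rad c n h y = h y := by
  have hd : ∀ l ∈ Icc (0:ℝ) 1, ∀ y ∈ U, HasDerivAt (fun z => (l:ℂ)^n * h (c + l * (z - c)))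
      ((l:ℂ)^(n+1) * deriv h (c + l * (y - c))) y := by
    intro l hl y hy
    have h1 : HasDerivAt h (deriv h (c + l * (y - c))) (c + l * (y - c)) :=
      (hh.differentiableAt (hU.mem_nhds (seg_mem hcv hcU hy hl))).hasDerivAt
    have h2 : HasDerivAt (fun z : ℂ => c + l * (z - c)) (l:ℂ) y := by
      simpa using (((hasDerivAt_id y).sub_const c).const_mul (l:ℂ)).const_add c
    have := (h1.comp y h2).const_mul ((l:ℂ)^n)
    refine this.congr_deriv ?_
    ring
  have hp := hasDerivAt_param hU (rad_cont hcv hcU hh n)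
    (fun l hl y hy => (hd l (by rwa [uIcc_of_le zero_le_one] at hl) y hy).differentiableAt.differentiableWithinAt) hy
  have e1 : ∫ t in (0:ℝ)..1, deriv (fun z => (t:ℂ)^n * h (c + t * (z - c))) y
      = rad c (n+1) (deriv h) y := by
    refine integral_congr fun l hl => ?_
    rw [uIcc_of_le zero_le_one] at hl
    exact (hd l hl y hy).deriv
  have hcd : ContinuousOn (fun l:ℝ => (l:ℂ)^(n+1) * deriv h (c + l * (y - c))) (uIcc 0 1) := by
    refine ContinuousOn.mul (by fun_prop) ?_
    refine ((hh.deriv hU).continuousOn).comp (by fun_prop) ?_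
    intro l hl
    rw [uIcc_of_le zero_le_one] at hl
    exact seg_mem hcv hcU hy hl
  have hc0 : ContinuousOn (fun l:ℝ => (l:ℂ)^n * h (c + l * (y - c))) (uIcc 0 1) :=
    (rad_cont hcv hcU hh n).comp (f := fun l => (y,l)) (by fun_prop) (fun l hl => ⟨hy, hl⟩)
  refine ⟨e1 ▸ hp.2, ?_⟩
  have := integral_eq_sub_of_hasDerivAt (a := 0) (b := 1)
    (f := fun l:ℝ => (l:ℂ)^(n+1) * h (c + l * (y - c)))
    (f' := fun l:ℝ => (y - c) * ((l:ℂ)^(n+1) * deriv h (c + l * (y - c))) +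
      (n+1) * ((l:ℂ)^n * h (c + l * (y - c)))) ?_ ?_
  · rw [intervalIntegral.integral_add, intervalIntegral.integral_const_mul, intervalIntegral.integral_const_mul] at this
    · simpa [rad] using this
    · exact (hcd.intervalIntegrable).const_mul _
    · exact (hc0.intervalIntegrable).const_mul _
  · intro l hl
    rw [uIcc_of_le zero_le_one] at hl
    have h1 : HasDerivAt h (deriv h (c + l * (y - c))) (c + l * (y - c)) :=
      (hh.differentiableAt (hU.mem_nhds (seg_mem hcv hcU hy hl))).hasDerivAt
    have h3 : HasDerivAt (fun l : ℝ => (l:ℂ)) 1 l := by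
      simpa using (hasDerivAt_id l).ofReal_comp
    have h2 : HasDerivAt (fun l : ℝ => c + l * (y - c)) (y - c) l := by
      simpa using (h3.mul_const (y - c)).const_add c
    have h4 := (h3.fun_pow (n+1)).mul (h1.comp l h2)
    refine h4.congr_deriv ?_
    simp; ring
  · exact ((hcd.intervalIntegrable).const_mul _).add ((hc0.intervalIntegrable).const_mul _)
/-- the weight exponent -/
def om (δ : ℝ) (y : ℂ) : ℝ := δ - δ / 4 * ‖y - 1‖
/-- the disc on which radial coefficients live -/
def EE (δ : ℝ) : Set ℂ := ball 0 (1 + δ / 2)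

structure Adm (δ : ℝ) (g : ℤ → ℂ → ℂ) (m : ℤ → ℝ) : Prop where
  sum : Summable m
  hol : ∀ k, DifferentiableOn ℂ (g k) (EE δ)
  bd : ∀ k, ∀ y ∈ EE δ, ‖g k y‖ ≤ m k * Real.exp (-(k.natAbs : ℝ) * om δ y)

/-- bounded functions on the plane -/
def LB : Type := lp (fun _ : ℂ => ℂ) ⊤
instance : NormedAddCommGroup LB := inferInstanceAs (NormedAddCommGroup (lp (fun _ : ℂ => ℂ) ⊤))
instance : NormedSpace ℝ LB := inferInstanceAs (NormedSpace ℝ (lp (fun _ : ℂ => ℂ) ⊤))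
instance : CompleteSpace LB := inferInstanceAs (CompleteSpace (lp (fun _ : ℂ => ℂ) ⊤))
/-- summable families of bounded functions -/
def LL : Type := lp (fun _ : ℤ => LB) 1
instance : NormedAddCommGroup LL := inferInstanceAs (NormedAddCommGroup (lp (fun _ : ℤ => LB) 1))
instance : NormedSpace ℝ LL := inferInstanceAs (NormedSpace ℝ (lp (fun _ : ℤ => LB) 1))
instance : CompleteSpace LL := inferInstanceAs (CompleteSpace (lp (fun _ : ℤ => LB) 1))
/-- components -/
def LL.cm (f : LL) (k : ℤ) : LB := f.1 k
/-- values -/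
def LL.ev (f : LL) (k : ℤ) (y : ℂ) : ℂ := (f.cm k).1 y

lemma LL.ev_add (f g : LL) (k : ℤ) (y : ℂ) : (f + g).ev k y = f.ev k y + g.ev k y := rfl
lemma LL.ev_sub (f g : LL) (k : ℤ) (y : ℂ) : (f - g).ev k y = f.ev k y - g.ev k y := rfl
lemma LL.ev_smul (c : ℝ) (f : LL) (k : ℤ) (y : ℂ) : (c • f).ev k y = c * f.ev k y := by
  rw [← real_smul]; rfl
lemma LL.ev_zero (k : ℤ) (y : ℂ) : (0 : LL).ev k y = 0 := rfl

def raw (δ : ℝ) (f : LL) (k : ℤ) (y : ℂ) : ℂ :=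
  (Real.exp (-(k.natAbs : ℝ) * om δ y) : ℂ) * f.ev k y

lemma raw_add (δ : ℝ) (f g : LL) : raw δ (f + g) = raw δ f + raw δ g := by
  ext k y; simp [raw, mul_add, LL.ev_add]
lemma raw_smul (δ : ℝ) (c : ℝ) (f : LL) : raw δ (c • f) = c • raw δ f := by
  ext k y; simp [raw, LL.ev_smul]; ring
lemma raw_zero (δ : ℝ) : raw δ 0 = 0 := by
  ext k y; simp [raw, LL.ev_zero]

lemma om_nonneg {δ : ℝ} (h0 : 0 < δ) (h1 : δ ≤ 1) {y : ℂ} (hy : y ∈ EE δ) : δ * (3/8) ≤ om δ y := by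
  have : ‖y - 1‖ ≤ 5/2 := by
    have h2 : ‖y‖ < 1 + δ/2 := by simpa [EE] using hy
    have := norm_sub_le y 1
    simp only [norm_one] at this
    linarith
  unfold om
  nlinarith

lemma om_le {δ : ℝ} (h0 : 0 < δ) (y : ℂ) : om δ y ≤ δ := by
  unfold om; nlinarith [norm_nonneg (y-1)]

lemma norm_apply2 (f : LL) (k : ℤ) (y : ℂ) : ‖f.ev k y‖ ≤ ‖f.cm k‖ :=
  lp.norm_apply_le_norm (p := ⊤) (by simp) (f.cm k : lp (fun _ : ℂ => ℂ) ⊤) y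

lemma norm_cm_le (f : LL) (k : ℤ) : ‖f.cm k‖ ≤ ‖f‖ :=
  lp.norm_apply_le_norm (p := 1) (by simp) (f : lp (fun _ : ℤ => LB) 1) k

lemma norm_raw_le (δ : ℝ) (f : LL) (k : ℤ) (y : ℂ) :
    ‖raw δ f k y‖ ≤ ‖f.cm k‖ * Real.exp (-(k.natAbs : ℝ) * om δ y) := by
  rw [raw, norm_mul, norm_real, Real.norm_of_nonneg (Real.exp_pos _).le, mul_comm]
  exact mul_le_mul_of_nonneg_right (norm_apply2 f k y) (Real.exp_pos _).le

def HH (δ : ℝ) : Submodule ℝ LL where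
  carrier := {f | ∀ k, DifferentiableOn ℂ (raw δ f k) (EE δ) ∧ ∀ y ∉ EE δ, f.ev k y = 0}
  add_mem' := by
    intro a b ha hb k
    refine ⟨?_, fun y hy => by rw [LL.ev_add, (ha k).2 y hy, (hb k).2 y hy, add_zero]⟩
    rw [raw_add]; exact (ha k).1.add (hb k).1
  zero_mem' := by
    intro k
    refine ⟨?_, fun y _ => LL.ev_zero k y⟩
    rw [raw_zero]; exact differentiableOn_const 0
  smul_mem' := by
    intro c a ha k
    refine ⟨?_, fun y hy => by rw [LL.ev_smul, (ha k).2 y hy, mul_zero]⟩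
    rw [raw_smul]; exact (ha k).1.const_smul c

lemma HH_closed {δ : ℝ} (h0 : 0 < δ) (h1 : δ ≤ 1) : IsClosed (HH δ : Set LL) := by
  apply IsSeqClosed.isClosed
  intro f g hf hlim k
  have hk : ∀ y, ∀ n, ‖(f n).ev k y - g.ev k y‖ ≤ ‖f n - g‖ := fun y n => by
    have := (norm_apply2 (f n - g) k y).trans (norm_cm_le (f n - g) k)
    rwa [LL.ev_sub] at this
  have hz : Tendsto (fun n => ‖f n - g‖) atTop (𝓝 0) := tendsto_iff_norm_sub_tendsto_zero.1 hlim
  constructor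
  · have hu : TendstoUniformlyOn (fun n => raw δ (f n) k) (raw δ g k) atTop (EE δ) := by
      rw [Metric.tendstoUniformlyOn_iff]
      intro ε hε
      filter_upwards [hz.eventually (gt_mem_nhds hε)] with n hn y hy
      rw [dist_comm, dist_eq_norm, raw, raw, ← mul_sub, norm_mul, norm_real,
        Real.norm_of_nonneg (Real.exp_pos _).le]
      have e1 : Real.exp (-(k.natAbs : ℝ) * om δ y) ≤ 1 := by
        rw [Real.exp_le_one_iff]
        have := om_nonneg h0 h1 hy
        have : 0 ≤ om δ y := by nlinarith
        nlinarith [(k.natAbs).cast_nonneg (α := ℝ)]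
      calc _ ≤ 1 * ‖(f n).ev k y - g.ev k y‖ := by gcongr
        _ < ε := by rw [one_mul]; exact (hk y n).trans_lt hn
    exact hu.tendstoLocallyUniformlyOn.differentiableOn
      (Eventually.of_forall fun n => (hf n k).1) isOpen_ball
  · intro y hy
    have h2 : Tendsto (fun n => ‖(f n).ev k y - g.ev k y‖) atTop (𝓝 0) :=
      squeeze_zero (fun _ => norm_nonneg _) (fun n => hk y n) hz
    have h3 : ∀ n, ‖(f n).ev k y - g.ev k y‖ = ‖g.ev k y‖ := fun n => by rw [(hf n k).2 y hy]; simp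
    simp_rw [h3] at h2
    exact norm_eq_zero.1 (tendsto_nhds_unique tendsto_const_nhds h2)

lemma HH_complete {δ : ℝ} (h0 : 0 < δ) (h1 : δ ≤ 1) : CompleteSpace (HH δ) :=
  (HH_closed h0 h1).completeSpace_coe

lemma norm_LL (f : LL) : Summable (fun k => ‖f.cm k‖) ∧ ‖f‖ = ∑' k, ‖f.cm k‖ := by
  constructor
  · have this : Summable fun k => ‖f.cm k‖ ^ (1:ENNReal).toReal := (lp.memℓp (f : lp (fun _ : ℤ => LB) 1)).summable (by simp)
    simpa using this
  · have := lp.norm_eq_tsum_rpow (p := 1) (by simp) (f : lp (fun _ : ℤ => LB) 1)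
    simp only [ENNReal.toReal_one, Real.rpow_one, div_one] at this
    exact this

lemma adm_raw {δ : ℝ} (f : HH δ) : Adm δ (raw δ f) (fun k => ‖(f : LL).cm k‖) :=
  ⟨(norm_LL f).1, fun k => (f.2 k).1, fun k y _ => norm_raw_le δ f k y⟩

lemma exists_mk {δ : ℝ} (g : ℤ → ℂ → ℂ) (m : ℤ → ℝ) (h : Adm δ g m) (h0 : 0 < δ) :
    ∃ f : HH δ, (∀ k, ∀ y ∈ EE δ, raw δ f k y = g k y) ∧ ‖f‖ ≤ ∑' k, m k := by
  classical
  let F : ℤ → ℂ → ℂ := fun k y => if y ∈ EE δ then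
    (Real.exp ((k.natAbs : ℝ) * om δ y) : ℂ) * g k y else 0
  have zero_mem : (0:ℂ) ∈ EE δ := by simp [EE]; positivity
  have hm : ∀ k, 0 ≤ m k := fun k => by
    have := (norm_nonneg _).trans (h.bd k 0 zero_mem)
    exact nonneg_of_mul_nonneg_left this (Real.exp_pos _)
  have hF : ∀ k y, ‖F k y‖ ≤ m k := fun k y => by
    by_cases hy : y ∈ EE δ
    · simp only [F, hy, if_true]
      rw [norm_mul, norm_real, Real.norm_of_nonneg (Real.exp_pos _).le]
      calc _ ≤ Real.exp ((k.natAbs : ℝ) * om δ y) * (m k * Real.exp (-(k.natAbs : ℝ) * om δ y)) := by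
            gcongr; exact h.bd k y hy
        _ = m k * (Real.exp ((k.natAbs : ℝ) * om δ y + -(k.natAbs : ℝ) * om δ y)) := by
            rw [Real.exp_add]; ring
        _ = m k := by simp
    · simp [F, hy, hm k]
  have hmem : ∀ k, Memℓp (F k) ⊤ := fun k => memℓp_infty ⟨m k, by rintro _ ⟨y, rfl⟩; exact hF k y⟩
  let G : ℤ → LB := fun k => ⟨F k, hmem k⟩
  have hG : ∀ k, ‖G k‖ ≤ m k := fun k => lp.norm_le_of_forall_le (hm k) (hF k)
  have hGs : Summable fun k => ‖G k‖ := Summable.of_nonneg_of_le (fun _ => norm_nonneg _) hG h.sum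
  have hGm : Memℓp G 1 := memℓp_gen (by simpa using hGs)
  let f : LL := ⟨G, hGm⟩
  have hfk : ∀ k y, f.ev k y = F k y := fun k y => rfl
  have hraw : ∀ k, ∀ y ∈ EE δ, raw δ f k y = g k y := fun k y hy => by
    rw [raw, hfk]; simp only [F, hy, if_true]
    rw [← mul_assoc, ← ofReal_mul, ← Real.exp_add]; simp
  refine ⟨⟨f, fun k => ⟨(h.hol k).congr (hraw k), fun y hy => by rw [hfk]; simp [F, hy]⟩⟩, hraw, ?_⟩
  change ‖f‖ ≤ _
  rw [(norm_LL f).2]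
  exact Summable.tsum_le_tsum hG hGs h.sum

lemma HH_ext {δ : ℝ} {f g : HH δ} (h : ∀ k, ∀ y ∈ EE δ, raw δ f k y = raw δ g k y) : f = g := by
  apply Subtype.ext
  apply Subtype.ext
  funext k
  apply Subtype.ext
  funext y
  by_cases hy : y ∈ EE δ
  · have := h k y hy
    rw [raw, raw] at this
    exact mul_left_cancel₀ (ofReal_ne_zero.2 (Real.exp_pos _).ne') this
  · exact ((f.2 k).2 y hy).trans ((g.2 k).2 y hy).symm

/-- lift a raw operator to the Banach space -/
lemma exists_lift {δ : ℝ} (h0 : 0 < δ) (T : (ℤ → ℂ → ℂ) → ℤ → ℂ → ℂ) (C : ℝ)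
    (hT : ∀ g m, Adm δ g m → ∃ m', Adm δ (T g) m' ∧ ∑' k, m' k ≤ C * ∑' k, m k)
    (hadd : ∀ g h m m', Adm δ g m → Adm δ h m' → ∀ k, ∀ y ∈ EE δ, T (g + h) k y = T g k y + T h k y)
    (hsmul : ∀ (c : ℝ) g m, Adm δ g m → ∀ k, ∀ y ∈ EE δ, T (c • g) k y = c * T g k y) :
    ∃ L : HH δ →L[ℝ] HH δ, ∀ a : HH δ, ∀ k, ∀ y ∈ EE δ, raw δ (L a) k y = T (raw δ a) k y := by
  have key : ∀ a : HH δ, ∃ f : HH δ, (∀ k, ∀ y ∈ EE δ, raw δ f k y = T (raw δ a) k y) ∧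
      ‖f‖ ≤ C * ‖a‖ := fun a => by
    obtain ⟨m', h1, h2⟩ := hT _ _ (adm_raw a)
    obtain ⟨f, hf, hn⟩ := exists_mk _ _ h1 h0
    exact ⟨f, hf, hn.trans (h2.trans_eq (by rw [← (norm_LL a).2]; rfl))⟩
  choose L hL hLn using key
  refine ⟨LinearMap.mkContinuous ⟨⟨L, fun a b => ?_⟩, fun c a => ?_⟩ C hLn, hL⟩
  · apply HH_ext
    intro k y hy
    rw [hL _ k y hy, Submodule.coe_add, raw_add, hadd _ _ _ _ (adm_raw a) (adm_raw b) k y hy]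
    change _ = raw δ ((L a : LL) + (L b : LL)) k y
    rw [raw_add, Pi.add_apply, Pi.add_apply, hL a k y hy, hL b k y hy]
  · apply HH_ext
    intro k y hy
    rw [hL _ k y hy, Submodule.coe_smul, raw_smul, hsmul _ _ _ (adm_raw a) k y hy]
    change _ = raw δ (c • (L a : LL)) k y
    rw [raw_smul, Pi.smul_apply, Pi.smul_apply, hL a k y hy]; simp
lemma exp_int_bound (a : ℝ) (ha : 0 ≤ a) :
    ∫ l in (0:ℝ)..1, Real.exp (-(a * (1 - l))) ≤ 2 / (1 + a) := by
  have h1 : ∫ l in (0:ℝ)..1, Real.exp (-(a * (1 - l))) ≤ ∫ l in (0:ℝ)..1, (1:ℝ) := by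
    refine intervalIntegral.integral_mono_on zero_le_one ?_ (by simp) ?_
    · exact (by fun_prop : Continuous fun l : ℝ => Real.exp (-(a * (1 - l)))).intervalIntegrable _ _
    · intro l hl
      rw [Real.exp_le_one_iff]
      nlinarith [hl.1, hl.2]
  have h2 : a * ∫ l in (0:ℝ)..1, Real.exp (-(a * (1 - l))) = 1 - Real.exp (-a) := by
    rw [← intervalIntegral.integral_const_mul]
    rw [intervalIntegral.integral_eq_sub_of_hasDerivAt (f := fun l => Real.exp (-(a * (1 - l))))]
    · simp
    · intro l _
      have : HasDerivAt (fun l : ℝ => -(a * (1 - l))) a l := by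
        simpa using (((hasDerivAt_id l).const_sub 1).const_mul a).fun_neg
      simpa [mul_comm] using this.exp
    · exact (by fun_prop : Continuous fun l : ℝ => a * Real.exp (-(a * (1 - l)))).intervalIntegrable _ _
  rw [le_div_iff₀ (by linarith)]
  simp at h1
  nlinarith [Real.exp_pos (-a)]

lemma zero_mem_EE {δ : ℝ} (h0 : 0 < δ) : (0:ℂ) ∈ EE δ := by simp [EE]; positivity
lemma one_mem_EE {δ : ℝ} (h0 : 0 < δ) : (1:ℂ) ∈ EE δ := by simp [EE]; positivity
lemma convex_EE (δ : ℝ) : Convex ℝ (EE δ) := convex_ball _ _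
lemma open_EE (δ : ℝ) : IsOpen (EE δ) := isOpen_ball

lemma rad0_bound {δ : ℝ} (h0 : 0 < δ) (h1 : δ ≤ 1) {h : ℂ → ℂ} {M : ℝ} {n j : ℕ} (hnj : n ≤ j)
    {y : ℂ} (hy : y ∈ EE δ)
    (hb : ∀ l ∈ Icc (0:ℝ) 1, ‖h (l * y)‖ ≤ M * Real.exp (-(n:ℝ) * om δ (l * y))) :
    ‖rad 0 j h y‖ ≤ M * (4 / (n + 1)) * Real.exp (-(n:ℝ) * om δ y) := by
  have hM : 0 ≤ M := by
    have := (norm_nonneg _).trans (hb 0 (by simp))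
    exact nonneg_of_mul_nonneg_left this (Real.exp_pos _)
  have hyn : ‖y‖ ≤ 3/2 := by
    have : ‖y‖ < 1 + δ/2 := by simpa [EE] using hy
    linarith
  have key : ∀ l ∈ Icc (0:ℝ) 1, ‖(l:ℂ)^j * h (0 + l * (y - 0))‖ ≤
      M * Real.exp (-(n:ℝ) * om δ y) * Real.exp (-((n/2 : ℝ) * (1 - l))) := by
    intro l hl
    rw [zero_add, sub_zero, norm_mul, norm_pow, norm_real, Real.norm_of_nonneg hl.1]
    have e1 : l ^ j ≤ Real.exp (-(n * (1 - l))) := by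
      calc l ^ j ≤ l ^ n := pow_le_pow_of_le_one hl.1 hl.2 hnj
        _ ≤ (Real.exp (l - 1)) ^ n := by
          gcongr; exact hl.1; linarith [Real.add_one_le_exp (l-1)]
        _ = _ := by rw [← Real.exp_nat_mul]; congr 1; ring
    have e2 : om δ y - om δ (l * y) ≤ (1 - l) / 2 := by
      unfold om
      have : ‖(l:ℂ) * y - 1‖ ≤ ‖y - 1‖ + (1 - l) * ‖y‖ := by
        calc ‖(l:ℂ) * y - 1‖ = ‖(y - 1) - ((1 - l : ℝ):ℂ) * y‖ := by congr 1; push_cast; ring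
          _ ≤ ‖y - 1‖ + ‖((1 - l : ℝ):ℂ) * y‖ := norm_sub_le _ _
          _ = _ := by rw [norm_mul, norm_real, Real.norm_of_nonneg (by linarith [hl.2])]
      have : (1-l) * ‖y‖ ≤ (1-l) * (3/2) := by gcongr; linarith [hl.2]
      have : δ * (‖(l:ℂ) * y - 1‖ - ‖y - 1‖) ≤ δ * ((1-l) * (3/2)) := by gcongr; linarith
      nlinarith [hl.2]
    calc l ^ j * ‖h (l * y)‖ ≤ Real.exp (-(n * (1 - l))) * (M * Real.exp (-(n:ℝ) * om δ (l * y))) :=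
          mul_le_mul e1 (hb l hl) (norm_nonneg _) (Real.exp_pos _).le
      _ = M * Real.exp (-(n * (1 - l)) + -(n:ℝ) * om δ (l * y)) := by rw [Real.exp_add]; ring
      _ ≤ M * Real.exp (-(n:ℝ) * om δ y + -((n/2 : ℝ) * (1 - l))) := by
          refine mul_le_mul_of_nonneg_left (Real.exp_le_exp.2 ?_) hM
          nlinarith [mul_le_mul_of_nonneg_left e2 (n.cast_nonneg (α := ℝ))]
      _ = _ := by rw [Real.exp_add]; ring
  unfold rad
  refine (intervalIntegral.norm_integral_le_of_norm_le zero_le_one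
    (g := fun l => M * Real.exp (-(n:ℝ) * om δ y) * Real.exp (-((n/2 : ℝ) * (1 - l))))
    (Eventually.of_forall fun l hl => key l ⟨hl.1.le, hl.2⟩)
    ((by fun_prop : Continuous _).intervalIntegrable _ _)).trans ?_
  rw [intervalIntegral.integral_const_mul]
  have := exp_int_bound (n/2) (by positivity)
  calc _ ≤ M * Real.exp (-(n:ℝ) * om δ y) * (2 / (1 + n/2)) := by gcongr
    _ ≤ M * Real.exp (-(n:ℝ) * om δ y) * (4 / (n + 1)) := by
        gcongr ?_ * ?_
        rw [div_le_div_iff₀ (by positivity) (by positivity)]; nlinarith [n.cast_nonneg (α := ℝ)]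
    _ = _ := by ring

lemma rad1_bound {δ : ℝ} (h0 : 0 < δ) (h1 : δ ≤ 1) {h : ℂ → ℂ} {M : ℝ} {n : ℕ}
    (hb : ∀ y ∈ EE δ, ‖h y‖ ≤ M * Real.exp (-(n:ℝ) * om δ y)) {y : ℂ} (hy : y ∈ EE δ) :
    ‖(y - 1) * rad 1 0 h y‖ ≤ M * (8 / δ / (n + 1)) * Real.exp (-(n:ℝ) * om δ y) := by
  have hM : 0 ≤ M := by
    have := (norm_nonneg _).trans (hb 0 (zero_mem_EE h0))
    exact nonneg_of_mul_nonneg_left this (Real.exp_pos _)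
  have hyn : ‖y - 1‖ ≤ 5/2 := by
    have : ‖y‖ < 1 + δ/2 := by simpa [EE] using hy
    have := norm_sub_le y 1
    simp only [norm_one] at this
    linarith
  have key : ∀ l ∈ Icc (0:ℝ) 1, ‖(l:ℂ)^0 * h (1 + l * (y - 1))‖ ≤
      M * Real.exp (-(n:ℝ) * om δ y) * Real.exp (-((n * (δ/4) * ‖y - 1‖ : ℝ) * (1 - l))) := by
    intro l hl
    rw [pow_zero, one_mul]
    refine (hb _ (seg_mem (convex_EE δ) (one_mem_EE h0) hy hl)).trans_eq ?_
    rw [mul_assoc, ← Real.exp_add]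
    congr 2
    simp only [om, add_sub_cancel_left, norm_mul, norm_real, Real.norm_of_nonneg hl.1]
    ring
  have : ‖rad 1 0 h y‖ ≤ M * Real.exp (-(n:ℝ) * om δ y) * (2 / (1 + n * (δ/4) * ‖y - 1‖)) := by
    unfold rad
    refine (intervalIntegral.norm_integral_le_of_norm_le zero_le_one
      (g := fun l => M * Real.exp (-(n:ℝ) * om δ y) * Real.exp (-((n * (δ/4) * ‖y - 1‖ : ℝ) * (1 - l))))
      (Eventually.of_forall fun l hl => key l ⟨hl.1.le, hl.2⟩)
      ((by fun_prop : Continuous _).intervalIntegrable _ _)).trans ?_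
    rw [intervalIntegral.integral_const_mul]
    have := exp_int_bound (n * (δ/4) * ‖y - 1‖) (by positivity)
    gcongr
  rw [norm_mul]
  calc _ ≤ ‖y - 1‖ * (M * Real.exp (-(n:ℝ) * om δ y) * (2 / (1 + n * (δ/4) * ‖y - 1‖))) := by gcongr
    _ = M * (‖y - 1‖ * (2 / (1 + n * (δ/4) * ‖y - 1‖))) * Real.exp (-(n:ℝ) * om δ y) := by ring
    _ ≤ _ := by
      gcongr
      rw [div_div, mul_div_assoc', div_le_div_iff₀ (by positivity) (by positivity)]
      nlinarith [norm_nonneg (y-1), n.cast_nonneg (α := ℝ), mul_nonneg (n.cast_nonneg (α := ℝ)) (norm_nonneg (y-1))]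

lemma radd_bound {δ : ℝ} (h0 : 0 < δ) (h1 : δ ≤ 1) {h : ℂ → ℂ} {M : ℝ} {n : ℕ}
    (hh : DifferentiableOn ℂ h (EE δ))
    (hb : ∀ y ∈ EE δ, ‖h y‖ ≤ M * Real.exp (-(n:ℝ) * om δ y)) {y : ℂ} (hy : y ∈ EE δ) :
    ‖rad 0 (n+1) (deriv h) y‖ ≤ 16 * M * Real.exp (-(n:ℝ) * om δ y) := by
  have hM : 0 ≤ M := by
    have := (norm_nonneg _).trans (hb 0 (zero_mem_EE h0))
    exact nonneg_of_mul_nonneg_left this (Real.exp_pos _)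
  have hseg : ∀ l ∈ Icc (0:ℝ) 1, (l:ℂ) * y ∈ EE δ := fun l hl => by
    simpa using seg_mem (convex_EE δ) (zero_mem_EE h0) hy hl
  by_cases hy2 : 1/2 ≤ ‖y‖
  · have e := (rad_hasDerivAt (open_EE δ) (convex_EE δ) (zero_mem_EE h0) hh n hy).2
    have hp := rad0_bound h0 h1 (le_refl n) hy (fun l hl => hb _ (hseg l hl))
    have e2 : y * rad 0 (n+1) (deriv h) y = h y - (n+1) * rad 0 n h y := by
      rw [← e]; ring
    have e3 : ‖y‖ * ‖rad 0 (n+1) (deriv h) y‖ ≤ 5 * M * Real.exp (-(n:ℝ) * om δ y) := by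
      rw [← norm_mul, e2]
      refine (norm_sub_le _ _).trans ?_
      have e4 : ‖((n:ℂ)+1) * rad 0 n h y‖ ≤ (n+1) * (M * (4 / (n + 1)) * Real.exp (-(n:ℝ) * om δ y)) := by
        rw [norm_mul]
        have : ‖(n:ℂ)+1‖ = n + 1 := by
          rw [← Nat.cast_one (R := ℂ), ← Nat.cast_add, norm_natCast]; push_cast; ring
        rw [this]; gcongr
      have e5 : ((n:ℝ)+1) * (M * (4 / (n + 1)) * Real.exp (-(n:ℝ) * om δ y)) = 4 * M * Real.exp (-(n:ℝ) * om δ y) := by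
        field_simp
      linarith [hb y hy]
    have : (1/2) * ‖rad 0 (n+1) (deriv h) y‖ ≤ ‖y‖ * ‖rad 0 (n+1) (deriv h) y‖ := by gcongr
    have : 0 ≤ M * Real.exp (-(n:ℝ) * om δ y) := by positivity
    linarith
  · push Not at hy2
    have hd : ∀ l ∈ Icc (0:ℝ) 1, ‖deriv h (l * y)‖ ≤ (4 * (n+1) * M) * Real.exp (-(n:ℝ) * om δ (l * y)) := by
      intro l hl
      have hly : ‖(l:ℂ) * y‖ < 1/2 := by
        rw [norm_mul, norm_real, Real.norm_of_nonneg hl.1]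
        nlinarith [hl.1, hl.2, norm_nonneg y]
      have hr : (0:ℝ) < 1 / (2 * (n+1)) := by positivity
      have hr2 : (1:ℝ) / (2 * (n+1)) ≤ 1/2 := by
        gcongr; linarith [n.cast_nonneg (α := ℝ)]
      have hsub : closedBall ((l:ℂ) * y) (1 / (2 * (n+1))) ⊆ EE δ := by
        intro z hz
        simp only [EE, mem_ball, dist_zero_right]
        rw [mem_closedBall, dist_eq_norm] at hz
        have := norm_le_norm_sub_add z ((l:ℂ) * y)
        linarith
      have := norm_deriv_le_of_forall_mem_sphere_norm_le (f := h) (c := (l:ℂ) * y) hr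
        (C := M * (2 * Real.exp (-(n:ℝ) * om δ (l * y)))) ?_ ?_
      · refine this.trans_eq ?_
        field_simp; ring
      · refine DifferentiableOn.diffContOnCl ?_
        rw [closure_ball _ hr.ne']
        exact hh.mono hsub
      · intro z hz
        refine (hb z (hsub (sphere_subset_closedBall hz))).trans ?_
        gcongr
        have e0 : Real.exp (1/8) ≤ 2 := by
          have := Real.exp_one_lt_d9
          calc Real.exp (1/8) ≤ Real.exp (1/2) := by gcongr; norm_num
            _ ≤ 2 := by
              have h3 : Real.exp (1/2) * Real.exp (1/2) = Real.exp 1 := by rw [← Real.exp_add]; norm_num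
              nlinarith [Real.exp_pos (1/2)]
        calc _ ≤ Real.exp (1/8 + -(n:ℝ) * om δ (l * y)) := by
              gcongr
              rw [mem_sphere, dist_eq_norm] at hz
              have e1 : ‖z - 1‖ ≤ 1 / (2 * (n+1)) + ‖(l:ℂ) * y - 1‖ := by
                rw [← hz]; exact (congrArg norm (by ring)).trans_le (norm_add_le (z - l*y) (l*y - 1))
              have e2 : (n:ℝ) * (1 / (2 * (n+1))) ≤ 1/2 := by
                rw [mul_one_div, div_le_div_iff₀ (by positivity) (by norm_num)]; linarith
              unfold om
              have e3 : (n:ℝ) * (δ/4) * ‖z - 1‖ ≤ n * (δ/4) * (1 / (2 * (n+1)) + ‖(l:ℂ) * y - 1‖) := by gcongr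
              nlinarith
          _ ≤ _ := by rw [Real.exp_add]; gcongr
    have := rad0_bound h0 h1 (Nat.le_succ n) hy hd
    refine this.trans_eq ?_
    field_simp; ring
lemma rad_congr {δ : ℝ} {c : ℂ} (hc : c ∈ EE δ) {n : ℕ} {h h' : ℂ → ℂ} (hh : ∀ y ∈ EE δ, h y = h' y)
    {y : ℂ} (hy : y ∈ EE δ) : rad c n h y = rad c n h' y := by
  refine intervalIntegral.integral_congr fun l hl => ?_
  rw [uIcc_of_le zero_le_one] at hl
  simp only [hh _ (seg_mem (convex_EE δ) hc hy hl)]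

lemma rad_add {δ : ℝ} {c : ℂ} (hc : c ∈ EE δ) {n : ℕ} {h h' : ℂ → ℂ}
    (hh : DifferentiableOn ℂ h (EE δ)) (hh' : DifferentiableOn ℂ h' (EE δ))
    {y : ℂ} (hy : y ∈ EE δ) : rad c n (h + h') y = rad c n h y + rad c n h' y := by
  unfold rad
  have key : ∀ h : ℂ → ℂ, DifferentiableOn ℂ h (EE δ) →
      IntervalIntegrable (fun l : ℝ => (l:ℂ)^n * h (c + l * (y - c))) volume 0 1 := fun h hh =>
    ((rad_cont (convex_EE δ) hc hh n).comp (f := fun l => (y,l)) (by fun_prop)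
      (fun l hl => ⟨hy, hl⟩)).intervalIntegrable
  rw [← intervalIntegral.integral_add (key h hh) (key h' hh')]
  simp [mul_add]

lemma rad_smul {c : ℂ} {n : ℕ} (r : ℝ) (h : ℂ → ℂ) (y : ℂ) :
    rad c n (r • h) y = r * rad c n h y := by
  unfold rad
  rw [← intervalIntegral.integral_const_mul]
  congr 1; ext l; simp; ring

def Pp (h : ℤ → ℂ → ℂ) (k : ℤ) : ℂ → ℂ := rad 0 k.natAbs (h k)
def Gg (h : ℤ → ℂ → ℂ) (k : ℤ) (y : ℂ) : ℂ := (y - 1) * rad 1 0 (Pp h k) y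
def Pd (h : ℤ → ℂ → ℂ) (k : ℤ) : ℂ → ℂ := rad 0 (k.natAbs + 1) (deriv (h k))

section
variable {δ : ℝ} (h0 : 0 < δ) (h1 : δ ≤ 1) {h : ℤ → ℂ → ℂ} {m : ℤ → ℝ}

lemma Pp_deriv (h0 : 0 < δ) (H : Adm δ h m) (k : ℤ) {y : ℂ} (hy : y ∈ EE δ) :
    HasDerivAt (Pp h k) (Pd h k y) y ∧ y * Pd h k y + (k.natAbs + 1) * Pp h k y = h k y := by
  have := rad_hasDerivAt (open_EE δ) (convex_EE δ) (zero_mem_EE h0) (H.hol k) k.natAbs hy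
  rw [sub_zero] at this
  exact this

lemma Pp_diff (h0 : 0 < δ) (H : Adm δ h m) (k : ℤ) : DifferentiableOn ℂ (Pp h k) (EE δ) :=
  fun _ hy => (Pp_deriv h0 H k hy).1.differentiableAt.differentiableWithinAt

lemma Gg_deriv (h0 : 0 < δ) (H : Adm δ h m) (k : ℤ) {y : ℂ} (hy : y ∈ EE δ) :
    HasDerivAt (Gg h k) (Pp h k y) y := by
  have := rad_hasDerivAt (open_EE δ) (convex_EE δ) (one_mem_EE h0) (Pp_diff h0 H k) 0 hy
  refine (((hasDerivAt_id y).sub_const 1).mul this.1).congr_deriv ?_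
  rw [← this.2]; simp; ring

lemma Gg_diff (h0 : 0 < δ) (H : Adm δ h m) (k : ℤ) : DifferentiableOn ℂ (Gg h k) (EE δ) :=
  fun _ hy => (Gg_deriv h0 H k hy).differentiableAt.differentiableWithinAt

lemma Pd_diff (h0 : 0 < δ) (H : Adm δ h m) (k : ℤ) : DifferentiableOn ℂ (Pd h k) (EE δ) :=
  ((Pp_diff h0 H k).deriv (open_EE δ)).congr fun _ hy => (Pp_deriv h0 H k hy).1.deriv.symm

lemma Pp_bd (h0 : 0 < δ) (h1 : δ ≤ 1) (H : Adm δ h m) (k : ℤ) {y : ℂ} (hy : y ∈ EE δ) :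
    ‖Pp h k y‖ ≤ m k * (4 / (k.natAbs + 1)) * Real.exp (-(k.natAbs : ℝ) * om δ y) :=
  rad0_bound h0 h1 le_rfl hy fun l hl => H.bd k _
    (by simpa using seg_mem (convex_EE δ) (zero_mem_EE h0) hy hl)

lemma Gg_bd (h0 : 0 < δ) (h1 : δ ≤ 1) (H : Adm δ h m) (k : ℤ) {y : ℂ} (hy : y ∈ EE δ) :
    ‖Gg h k y‖ ≤ m k * (4 / (k.natAbs + 1)) * (8 / δ / (k.natAbs + 1)) *
      Real.exp (-(k.natAbs : ℝ) * om δ y) :=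
  rad1_bound h0 h1 (fun _ hy => Pp_bd h0 h1 H k hy) hy

lemma Pd_bd (h0 : 0 < δ) (h1 : δ ≤ 1) (H : Adm δ h m) (k : ℤ) {y : ℂ} (hy : y ∈ EE δ) :
    ‖Pd h k y‖ ≤ 16 * m k * Real.exp (-(k.natAbs : ℝ) * om δ y) :=
  radd_bound h0 h1 (H.hol k) (H.bd k) hy

lemma m_nonneg (h0 : 0 < δ) (H : Adm δ h m) (k : ℤ) : 0 ≤ m k := by
  have := (norm_nonneg _).trans (H.bd k 0 (zero_mem_EE h0))
  exact nonneg_of_mul_nonneg_left this (Real.exp_pos _)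

lemma wt_shift (h0 : 0 < δ) (h1 : δ ≤ 1) {n j : ℕ} (hj : j ≤ n + 2) {y : ℂ} (hy : y ∈ EE δ) :
    Real.exp (-(n:ℝ) * om δ y) ≤ 9 * Real.exp (-(j:ℝ) * om δ y) := by
  have e0 : Real.exp 2 ≤ 9 := by
    have h3 : Real.exp 1 * Real.exp 1 = Real.exp 2 := by rw [← Real.exp_add]; norm_num
    nlinarith [Real.exp_one_lt_d9, Real.exp_pos 1]
  calc _ ≤ Real.exp (2 + -(j:ℝ) * om δ y) := by
        gcongr
        have a1 := om_nonneg h0 h1 hy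
        have a2 := om_le h0 y
        have a3 : (j:ℝ) ≤ n + 2 := by exact_mod_cast hj
        nlinarith
    _ ≤ _ := by rw [Real.exp_add]; gcongr

lemma adm_shift (h0 : 0 < δ) (h1 : δ ≤ 1) (H : Adm δ h m) (C : ℝ) (s : ℤ)
    (hs : s.natAbs ≤ 2) {g : ℤ → ℂ → ℂ}
    (hg : ∀ k, DifferentiableOn ℂ (g k) (EE δ))
    (hb : ∀ k, ∀ y ∈ EE δ, ‖g k y‖ ≤ C * m (k + s) * Real.exp (-((k + s).natAbs : ℝ) * om δ y))
    (hC : 0 ≤ C) : ∃ m', Adm δ g m' ∧ ∑' k, m' k ≤ (9 * C) * ∑' k, m k := by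
  refine ⟨fun k => 9 * C * m (k + s), ⟨?_, hg, fun k y hy => ?_⟩, ?_⟩
  · exact (((Equiv.addRight s).summable_iff (f := m)).2 H.sum).mul_left _
  · refine (hb k y hy).trans ?_
    calc _ ≤ C * m (k + s) * (9 * Real.exp (-(k.natAbs : ℝ) * om δ y)) := by
          have := m_nonneg h0 H (k + s)
          have := wt_shift h0 h1 (n := (k+s).natAbs) (j := k.natAbs) (by omega) hy
          gcongr
      _ = _ := by ring
  · rw [tsum_mul_left]
    exact (congrArg _ ((Equiv.addRight s).tsum_eq m)).le

lemma Pp_add (h0 : 0 < δ) {h' : ℤ → ℂ → ℂ} {m' : ℤ → ℝ} (H : Adm δ h m) (H' : Adm δ h' m') (k : ℤ)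
    {y : ℂ} (hy : y ∈ EE δ) : Pp (h + h') k y = Pp h k y + Pp h' k y :=
  rad_add (zero_mem_EE h0) (H.hol k) (H'.hol k) hy

lemma Gg_add (h0 : 0 < δ) {h' : ℤ → ℂ → ℂ} {m' : ℤ → ℝ} (H : Adm δ h m) (H' : Adm δ h' m') (k : ℤ)
    {y : ℂ} (hy : y ∈ EE δ) : Gg (h + h') k y = Gg h k y + Gg h' k y := by
  rw [Gg, Gg, Gg, ← mul_add, ← rad_add (one_mem_EE h0) (Pp_diff h0 H k) (Pp_diff h0 H' k) hy]
  congr 1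
  exact rad_congr (one_mem_EE h0) (fun y hy => Pp_add h0 H H' k hy) hy

lemma Pd_add (h0 : 0 < δ) {h' : ℤ → ℂ → ℂ} {m' : ℤ → ℝ} (H : Adm δ h m) (H' : Adm δ h' m') (k : ℤ)
    {y : ℂ} (hy : y ∈ EE δ) : Pd (h + h') k y = Pd h k y + Pd h' k y := by
  rw [Pd, Pd, Pd, ← rad_add (zero_mem_EE h0) ((H.hol k).deriv (open_EE δ))
    ((H'.hol k).deriv (open_EE δ)) hy]
  refine rad_congr (zero_mem_EE h0) (fun y hy => ?_) hy
  exact deriv_add ((H.hol k).differentiableAt ((open_EE δ).mem_nhds hy))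
    ((H'.hol k).differentiableAt ((open_EE δ).mem_nhds hy))

lemma Pp_smul (c : ℝ) (h : ℤ → ℂ → ℂ) (k : ℤ) : Pp (c • h) k = c • Pp h k := by
  ext y; rw [Pp, Pi.smul_apply, rad_smul]; simp [Pp]

lemma Gg_smul (c : ℝ) (h : ℤ → ℂ → ℂ) (k : ℤ) : Gg (c • h) k = c • Gg h k := by
  ext y; rw [Gg, Pp_smul, rad_smul]; simp [Gg]; ring

lemma Pd_smul (h0 : 0 < δ) (c : ℝ) (H : Adm δ h m) (k : ℤ) {y : ℂ} (hy : y ∈ EE δ) :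
    Pd (c • h) k y = c * Pd h k y := by
  have e : Pd (c • h) k y = rad 0 (k.natAbs + 1) (c • deriv (h k)) y := by
    refine rad_congr (zero_mem_EE h0) (fun y hy => ?_) hy
    exact deriv_const_smul c ((H.hol k).differentiableAt ((open_EE δ).mem_nhds hy))
  rw [e, rad_smul]; rfl
end

def T1 (h : ℤ → ℂ → ℂ) (j : ℤ) (y : ℂ) : ℂ :=
  if 0 ≤ j then (j + 1) * Gg h (j+1) y + y * Pp h (j+1) y else Pp h (j+1) y

def T2 (h : ℤ → ℂ → ℂ) (j : ℤ) (y : ℂ) : ℂ :=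
  if 0 ≤ j then (j + 2) * (j + 1) * Gg h (j+2) y + (j + 1) * (y * Pp h (j+2) y) + y * h (j+2) y
  else if j = -1 then h (j+2) y else Pd h (j+2) y

lemma T1_pos {h : ℤ → ℂ → ℂ} {j : ℤ} (hj : 0 ≤ j) :
    T1 h j = fun y => (j + 1) * Gg h (j+1) y + y * Pp h (j+1) y := by funext y; simp [T1, hj]
lemma T1_neg {h : ℤ → ℂ → ℂ} {j : ℤ} (hj : ¬ 0 ≤ j) : T1 h j = Pp h (j+1) := by
  funext y; simp [T1, hj]
lemma T2_pos {h : ℤ → ℂ → ℂ} {j : ℤ} (hj : 0 ≤ j) : T2 h j = fun y =>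
    (j + 2) * (j + 1) * Gg h (j+2) y + (j + 1) * (y * Pp h (j+2) y) + y * h (j+2) y := by
  funext y; simp [T2, hj]
lemma T2_m1 {h : ℤ → ℂ → ℂ} : T2 h (-1) = h (-1 + 2) := by
  funext y; simp [T2]
lemma T2_neg {h : ℤ → ℂ → ℂ} {j : ℤ} (hj : ¬ 0 ≤ j) (hj1 : j ≠ -1) : T2 h j = Pd h (j+2) := by
  funext y; simp [T2, hj, hj1]

variable {δ : ℝ}

lemma norm_le_EE (h1 : δ ≤ 1) {y : ℂ} (hy : y ∈ EE δ) : ‖y‖ ≤ 2 := by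
  have : ‖y‖ < 1 + δ/2 := by simpa [EE] using hy
  linarith

lemma S_lift (h0 : 0 < δ) (h1 : δ ≤ 1) :
    ∃ L : HH δ →L[ℝ] HH δ, ∀ a : HH δ, ∀ k, ∀ y ∈ EE δ, raw δ (L a) k y = Gg (raw δ a) k y := by
  refine exists_lift h0 Gg (9 * (32/δ)) (fun g m H => ?_)
    (fun g h m m' H H' k y hy => Gg_add h0 H H' k hy) (fun c g m H k y hy => by
      rw [Gg_smul, Pi.smul_apply, real_smul])
  refine adm_shift h0 h1 H _ 0 (by norm_num) (fun k => Gg_diff h0 H k) (fun k y hy => ?_) (by positivity)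
  rw [add_zero]
  refine (Gg_bd h0 h1 H k hy).trans ?_
  have hm := m_nonneg h0 H k
  have hn := (k.natAbs).cast_nonneg (α := ℝ)
  refine mul_le_mul_of_nonneg_right ?_ (Real.exp_pos _).le
  calc m k * (4 / (k.natAbs + 1)) * (8 / δ / (k.natAbs + 1)) ≤ m k * (4 / 1) * (8 / δ / 1) := by
        gcongr <;> linarith
    _ = _ := by ring

lemma T1_lift (h0 : 0 < δ) (h1 : δ ≤ 1) :
    ∃ L : HH δ →L[ℝ] HH δ, ∀ a : HH δ, ∀ k, ∀ y ∈ EE δ, raw δ (L a) k y = T1 (raw δ a) k y := by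
  refine exists_lift h0 T1 (9 * (32/δ + 8)) (fun g m H => ?_)
    (fun g h m m' H H' k y hy => ?_) (fun c g m H k y hy => ?_)
  · refine adm_shift h0 h1 H _ 1 (by norm_num) (fun k => ?_) (fun k y hy => ?_) (by positivity)
    · by_cases hk : 0 ≤ k
      · rw [T1_pos hk]
        exact ((Gg_diff h0 H _).const_mul _).add (differentiableOn_id.mul (Pp_diff h0 H _))
      · rw [T1_neg hk]
        exact Pp_diff h0 H _
    · have hm := m_nonneg h0 H (k+1)
      have hE := Real.exp_pos (-((k+1).natAbs : ℝ) * om δ y)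
      have hn := ((k+1).natAbs).cast_nonneg (α := ℝ)
      have hP : ‖Pp g (k+1) y‖ ≤ m (k+1) * 4 * Real.exp (-((k+1).natAbs : ℝ) * om δ y) := by
        refine (Pp_bd h0 h1 H _ hy).trans ?_
        gcongr
        exact div_le_self (by norm_num) (by linarith)
      by_cases hk : 0 ≤ k
      · rw [T1_pos hk]
        refine (norm_add_le _ _).trans ?_
        rw [norm_mul, norm_mul]
        have e1 : ‖(k:ℂ)+1‖ = (k+1).natAbs := by
          rw [← Int.cast_one, ← Int.cast_add, norm_intCast, Nat.cast_natAbs, Int.cast_abs]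
        rw [e1]
        have e2 : ((k+1).natAbs : ℝ) * ‖Gg g (k+1) y‖ ≤ m (k+1) * (32/δ) *
            Real.exp (-((k+1).natAbs : ℝ) * om δ y) := by
          calc _ ≤ ((k+1).natAbs : ℝ) * _ := mul_le_mul_of_nonneg_left (Gg_bd h0 h1 H _ hy) hn
            _ = m (k+1) * (4 * (8 / δ / ((k+1).natAbs + 1))) * (((k+1).natAbs : ℝ) / ((k+1).natAbs + 1)) *
                Real.exp (-((k+1).natAbs : ℝ) * om δ y) := by ring
            _ ≤ m (k+1) * (4 * (8 / δ / 1)) * 1 * Real.exp (-((k+1).natAbs : ℝ) * om δ y) := by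
                gcongr
                · linarith
                · rw [div_le_one (by positivity)]; linarith
            _ = _ := by ring
        have e3 : ‖y‖ * ‖Pp g (k+1) y‖ ≤ 2 * (m (k+1) * 4 * Real.exp (-((k+1).natAbs : ℝ) * om δ y)) := by
          gcongr; exact norm_le_EE h1 hy
        linarith
      · rw [T1_neg hk]
        have : 0 ≤ 32/δ * m (k+1) * Real.exp (-((k+1).natAbs : ℝ) * om δ y) := by positivity
        have : 0 ≤ m (k+1) * Real.exp (-((k+1).natAbs : ℝ) * om δ y) := by positivity
        linarith
  · simp only [T1, Pp_add h0 H H' _ hy, Gg_add h0 H H' _ hy]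
    split_ifs <;> ring
  · simp only [T1, Pp_smul, Gg_smul, Pi.smul_apply, real_smul]
    split_ifs <;> ring

lemma T2_lift (h0 : 0 < δ) (h1 : δ ≤ 1) :
    ∃ L : HH δ →L[ℝ] HH δ, ∀ a : HH δ, ∀ k, ∀ y ∈ EE δ, raw δ (L a) k y = T2 (raw δ a) k y := by
  refine exists_lift h0 T2 (9 * (32/δ + 16)) (fun g m H => ?_)
    (fun g h m m' H H' k y hy => ?_) (fun c g m H k y hy => ?_)
  · refine adm_shift h0 h1 H _ 2 (by norm_num) (fun k => ?_) (fun k y hy => ?_) (by positivity)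
    · by_cases hk : 0 ≤ k
      · rw [T2_pos hk]
        exact (((Gg_diff h0 H _).const_mul _).add
          ((differentiableOn_id.mul (Pp_diff h0 H _)).const_mul _)).add (differentiableOn_id.mul (H.hol _))
      · by_cases hk1 : k = -1
        · rw [hk1, T2_m1]
          exact H.hol _
        · rw [T2_neg hk hk1]
          exact Pd_diff h0 H _
    · have hm := m_nonneg h0 H (k+2)
      have hE := Real.exp_pos (-((k+2).natAbs : ℝ) * om δ y)
      have hn := ((k+2).natAbs).cast_nonneg (α := ℝ)
      have hpos : 0 ≤ m (k+2) * Real.exp (-((k+2).natAbs : ℝ) * om δ y) := by positivity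
      have hpos2 : 0 ≤ 32/δ * m (k+2) * Real.exp (-((k+2).natAbs : ℝ) * om δ y) := by positivity
      have hh := H.bd (k+2) y hy
      by_cases hk : 0 ≤ k
      · rw [T2_pos hk]
        refine (norm_add_le _ _).trans ((add_le_add_left (norm_add_le _ _) _).trans ?_)
        simp only [norm_mul]
        have e1 : ‖(k:ℂ)+2‖ = (k+2).natAbs := by
          rw [← Int.cast_ofNat, ← Int.cast_add, norm_intCast, Nat.cast_natAbs, Int.cast_abs]
        have e1' : ‖(k:ℂ)+1‖ ≤ (k+2).natAbs := by
          rw [← Int.cast_one, ← Int.cast_add, norm_intCast, Nat.cast_natAbs, Int.cast_abs]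
          exact_mod_cast abs_le_abs_of_nonneg (by omega) (by omega)
        rw [e1]
        set n : ℝ := ((k+2).natAbs : ℝ) with hnd
        have e2 : n * ‖(k:ℂ)+1‖ * ‖Gg g (k+2) y‖ ≤ m (k+2) * (32/δ) * Real.exp (-n * om δ y) := by
          calc _ ≤ n * n * _ := mul_le_mul (by gcongr) (Gg_bd h0 h1 H _ hy) (norm_nonneg _) (by positivity)
            _ = m (k+2) * (32 / δ) * (n / (n + 1)) * (n / (n + 1)) * Real.exp (-n * om δ y) := by
                rw [← hnd]; ring
            _ ≤ m (k+2) * (32 / δ) * 1 * 1 * Real.exp (-n * om δ y) := by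
                gcongr
                · rw [div_le_one (by positivity)]; linarith
                · rw [div_le_one (by positivity)]; linarith
            _ = _ := by ring
        have e3 : ‖(k:ℂ)+1‖ * (‖y‖ * ‖Pp g (k+2) y‖) ≤ 8 * (m (k+2) * Real.exp (-n * om δ y)) := by
          calc _ ≤ n * (2 * _) := mul_le_mul e1' (mul_le_mul (norm_le_EE h1 hy) (Pp_bd h0 h1 H _ hy)
                  (norm_nonneg _) (by norm_num)) (by positivity) hn
            _ = 8 * m (k+2) * (n / (n + 1)) * Real.exp (-n * om δ y) := by rw [← hnd]; ring
            _ ≤ 8 * m (k+2) * 1 * Real.exp (-n * om δ y) := by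
                gcongr
                rw [div_le_one (by positivity)]; linarith
            _ = _ := by ring
        have e4 : ‖y‖ * ‖g (k+2) y‖ ≤ 2 * (m (k+2) * Real.exp (-n * om δ y)) := by
          gcongr; exact norm_le_EE h1 hy
        linarith
      · by_cases hk1 : k = -1
        · subst hk1
          rw [T2_m1, mul_assoc]
          have : 0 < 32/δ := by positivity
          exact hh.trans (le_mul_of_one_le_left hpos (by linarith))
        · rw [T2_neg hk hk1]
          have := Pd_bd h0 h1 H (k+2) hy
          linarith
  · simp only [T2, Pp_add h0 H H' _ hy, Gg_add h0 H H' _ hy, Pd_add h0 H H' _ hy, Pi.add_apply]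
    split_ifs <;> ring
  · simp only [T2, Pp_smul, Gg_smul, Pd_smul h0 c H _ hy, Pi.smul_apply, real_smul]
    split_ifs <;> ring
def ee (j l : ℤ) : ℕ := (j.natAbs + l.natAbs - (j+l).natAbs) / 2
lemma ee_eq (j l : ℤ) : j.natAbs + l.natAbs = (j+l).natAbs + 2 * ee j l := by
  unfold ee; omega

def stR (g : ℤ → ℂ → ℂ) (k : ℤ) (y : ℂ) : ℂ := (starRingEnd ℂ) (g (-k) ((starRingEnd ℂ) y))
def mlR (g h : ℤ → ℂ → ℂ) (n : ℤ) (y : ℂ) : ℂ := ∑' j, y^(ee j (n-j)) * (g j y * h (n-j) y)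

variable {δ : ℝ}

lemma conj_EE {y : ℂ} (hy : y ∈ EE δ) : (starRingEnd ℂ) y ∈ EE δ := by
  simpa [EE] using hy
lemma om_conj (y : ℂ) : om δ ((starRingEnd ℂ) y) = om δ y := by
  unfold om
  congr 2
  rw [← norm_conj (y-1), map_sub, map_one]

lemma st_adm {g : ℤ → ℂ → ℂ} {m : ℤ → ℝ} (H : Adm δ g m) : Adm δ (stR g) (fun k => m (-k)) := by
  refine ⟨(Equiv.neg ℤ).summable_iff.2 H.sum, fun k y hy => ?_, fun k y hy => ?_⟩
  · have := ((H.hol (-k)).differentiableAt ((open_EE δ).mem_nhds (conj_EE hy))).conj_conj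
    simp only [conj_conj] at this
    exact this.differentiableWithinAt
  · have := H.bd (-k) _ (conj_EE hy)
    rw [om_conj, Int.natAbs_neg] at this
    simpa only [stR, norm_conj] using this

lemma st_lift (h0 : 0 < δ) :
    ∃ L : HH δ →L[ℝ] HH δ, ∀ a : HH δ, ∀ k, ∀ y ∈ EE δ, raw δ (L a) k y = stR (raw δ a) k y := by
  refine exists_lift h0 stR 1 (fun g m H => ⟨_, st_adm H, ?_⟩) (fun g h m m' H H' k y hy => ?_)
    (fun c g m H k y hy => ?_)
  · rw [one_mul, (Equiv.neg ℤ).tsum_eq m |>.symm]; rfl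
  · simp [stR]
  · simp [stR]

lemma norm_y_le (h0 : 0 < δ) (h1 : δ ≤ 1) {y : ℂ} (hy : y ∈ EE δ) : ‖y‖ ≤ Real.exp (2 * om δ y) := by
  have h2 : ‖y‖ < 1 + δ/2 := by simpa [EE] using hy
  have := om_nonneg h0 h1 hy
  have := Real.add_one_le_exp (2 * om δ y)
  linarith

lemma ml_term (h0 : 0 < δ) (h1 : δ ≤ 1) {g h : ℤ → ℂ → ℂ} {m m' : ℤ → ℝ} (H : Adm δ g m) (H' : Adm δ h m')
    (j l : ℤ) {y : ℂ} (hy : y ∈ EE δ) :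
    ‖y^(ee j l) * (g j y * h l y)‖ ≤ m j * m' l * Real.exp (-((j+l).natAbs : ℝ) * om δ y) := by
  have hm := m_nonneg h0 H j
  have hm' := m_nonneg h0 H' l
  rw [norm_mul, norm_mul, norm_pow]
  calc _ ≤ Real.exp (2 * om δ y) ^ (ee j l) * ((m j * Real.exp (-(j.natAbs : ℝ) * om δ y)) *
        (m' l * Real.exp (-(l.natAbs : ℝ) * om δ y))) :=
        mul_le_mul (pow_le_pow_left₀ (norm_nonneg _) (norm_y_le h0 h1 hy) _)
          (mul_le_mul (H.bd j y hy) (H'.bd l y hy) (norm_nonneg _) (by positivity)) (by positivity) (by positivity)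
    _ = m j * m' l * Real.exp ((ee j l : ℝ) * (2 * om δ y) + -(j.natAbs : ℝ) * om δ y + -(l.natAbs : ℝ) * om δ y) := by
        rw [← Real.exp_nat_mul, Real.exp_add, Real.exp_add]; ring
    _ = _ := by
        congr 2
        have : (j.natAbs : ℝ) + l.natAbs = (j+l).natAbs + 2 * ee j l := by exact_mod_cast ee_eq j l
        linear_combination (-om δ y) * this

def shE : ℤ × ℤ ≃ ℤ × ℤ where
  toFun p := (p.2, p.1 - p.2)
  invFun p := (p.1 + p.2, p.1)
  left_inv p := by ext <;> simp
  right_inv p := by ext <;> simp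

lemma ml_sum (h0 : 0 < δ) {g h : ℤ → ℂ → ℂ} {m m' : ℤ → ℝ} (H : Adm δ g m) (H' : Adm δ h m') :
    Summable (fun p : ℤ × ℤ => m p.2 * m' (p.1 - p.2)) ∧
    ∑' p : ℤ × ℤ, m p.2 * m' (p.1 - p.2) = (∑' k, m k) * ∑' k, m' k := by
  have s1 := H.sum.mul_of_nonneg H'.sum (m_nonneg h0 H) (m_nonneg h0 H')
  refine ⟨shE.summable_iff.2 s1, ?_⟩
  rw [H.sum.tsum_mul_tsum H'.sum s1]
  exact shE.tsum_eq (fun p : ℤ × ℤ => m p.1 * m' p.2)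

lemma ml_fib (h0 : 0 < δ) {g h : ℤ → ℂ → ℂ} {m m' : ℤ → ℝ} (H : Adm δ g m) (H' : Adm δ h m') (n : ℤ) :
    Summable (fun j : ℤ => m j * m' (n - j)) := (ml_sum h0 H H').1.prod_factor n

lemma ml_tsum_term (h0 : 0 < δ) (h1 : δ ≤ 1) {g h : ℤ → ℂ → ℂ} {m m' : ℤ → ℝ} (H : Adm δ g m) (H' : Adm δ h m')
    (n : ℤ) {y : ℂ} (hy : y ∈ EE δ) : Summable (fun j => ‖y^(ee j (n-j)) * (g j y * h (n-j) y)‖) := by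
  refine Summable.of_nonneg_of_le (fun _ => norm_nonneg _) (fun j => ?_)
    ((ml_fib h0 H H' n).mul_right (Real.exp (-(n.natAbs : ℝ) * om δ y)))
  have := ml_term h0 h1 H H' j (n-j) hy
  rwa [add_sub_cancel] at this

lemma ml_adm (h0 : 0 < δ) (h1 : δ ≤ 1) {g h : ℤ → ℂ → ℂ} {m m' : ℤ → ℝ} (H : Adm δ g m) (H' : Adm δ h m') :
    Adm δ (mlR g h) (fun n => ∑' j, m j * m' (n - j)) := by
  refine ⟨(ml_sum h0 H H').1.prod, fun n => ?_, fun n y hy => ?_⟩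
  · refine differentiableOn_tsum_of_summable_norm (ml_fib h0 H H' n) (fun j => ?_) (open_EE δ) (fun j y hy => ?_)
    · exact (differentiableOn_id.pow _).mul ((H.hol j).mul (H'.hol _))
    · have := ml_term h0 h1 H H' j (n-j) hy
      refine this.trans (mul_le_of_le_one_right (mul_nonneg (m_nonneg h0 H _) (m_nonneg h0 H' _)) ?_)
      rw [Real.exp_le_one_iff]
      have := om_nonneg h0 h1 hy
      have : 0 ≤ om δ y := by nlinarith
      nlinarith [((j + (n-j)).natAbs).cast_nonneg (α := ℝ)]
  · rw [← tsum_mul_right]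
    refine (norm_tsum_le_tsum_norm (ml_tsum_term h0 h1 H H' n hy)).trans
      (Summable.tsum_le_tsum (fun j => ?_) (ml_tsum_term h0 h1 H H' n hy) ((ml_fib h0 H H' n).mul_right _))
    have := ml_term h0 h1 H H' j (n-j) hy
    rwa [add_sub_cancel] at this

lemma ml_lift (h0 : 0 < δ) (h1 : δ ≤ 1) :
    ∃ B : HH δ →L[ℝ] HH δ →L[ℝ] HH δ, ∀ a b : HH δ, ∀ k, ∀ y ∈ EE δ,
      raw δ (B a b) k y = mlR (raw δ a) (raw δ b) k y := by
  have key : ∀ a b : HH δ, ∃ f : HH δ, (∀ k, ∀ y ∈ EE δ, raw δ f k y = mlR (raw δ a) (raw δ b) k y) ∧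
      ‖f‖ ≤ 1 * ‖a‖ * ‖b‖ := fun a b => by
    obtain ⟨f, hf, hn⟩ := exists_mk _ _ (ml_adm h0 h1 (adm_raw a) (adm_raw b)) h0
    refine ⟨f, hf, hn.trans_eq ?_⟩
    have e := (ml_sum h0 (adm_raw a) (adm_raw b))
    rw [← e.1.tsum_prod, e.2, ← (norm_LL a).2, ← (norm_LL b).2, one_mul]; rfl
  choose L hL hLn using key
  have hs := fun (a b : HH δ) n y hy => (ml_tsum_term (y := y) h0 h1 (adm_raw a) (adm_raw b) n hy).of_norm
  refine ⟨LinearMap.mkContinuous₂ (LinearMap.mk₂ ℝ L ?_ ?_ ?_ ?_) 1 hLn, hL⟩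
  · intro a b c
    apply HH_ext; intro k y hy
    rw [hL _ _ k y hy, Submodule.coe_add, Submodule.coe_add, raw_add, raw_add, Pi.add_apply, Pi.add_apply,
      hL _ _ k y hy, hL _ _ k y hy, mlR, mlR, mlR, ← (hs a c k y hy).tsum_add (hs b c k y hy)]
    congr 1; ext j; simp; ring
  · intro c a b
    apply HH_ext; intro k y hy
    rw [hL _ _ k y hy, Submodule.coe_smul, Submodule.coe_smul, raw_smul, raw_smul, Pi.smul_apply, Pi.smul_apply,
      hL _ _ k y hy, mlR, mlR, real_smul, ← tsum_mul_left]
    congr 1; ext j; simp; ring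
  · intro c a b
    apply HH_ext; intro k y hy
    rw [hL _ _ k y hy, Submodule.coe_add, Submodule.coe_add, raw_add, raw_add, Pi.add_apply, Pi.add_apply,
      hL _ _ k y hy, hL _ _ k y hy, mlR, mlR, mlR, ← (hs c a k y hy).tsum_add (hs c b k y hy)]
    congr 1; ext j; simp; ring
  · intro c a b
    apply HH_ext; intro k y hy
    rw [hL _ _ k y hy, Submodule.coe_smul, Submodule.coe_smul, raw_smul, raw_smul, Pi.smul_apply, Pi.smul_apply,
      hL _ _ k y hy, mlR, mlR, real_smul, ← tsum_mul_left]
    congr 1; ext j; simp; ring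
def mn (k : ℤ) (ξ η : ℂ) : ℂ := if 0 ≤ k then ξ ^ k.natAbs else η ^ k.natAbs
def evv (g : ℤ → ℂ → ℂ) (ξ η : ℂ) : ℂ := ∑' k, mn k ξ η * g k (ξ * η)
def flp (g : ℤ → ℂ → ℂ) (k : ℤ) : ℂ → ℂ := g (-k)
/-- the bidisc radius -/
def R1 (δ : ℝ) : ℝ := 1 + δ / 8

lemma mn_flip (k : ℤ) (ξ η : ℂ) : mn (-k) η ξ = mn k ξ η := by
  unfold mn
  rcases lt_trichotomy k 0 with h | h | h
  · rw [if_pos (by omega), if_neg (by omega), Int.natAbs_neg]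
  · subst h; simp
  · rw [if_neg (by omega), if_pos (by omega), Int.natAbs_neg]

lemma mn_conj (k : ℤ) (ξ η : ℂ) : (starRingEnd ℂ) (mn k ξ η) = mn k ((starRingEnd ℂ) ξ) ((starRingEnd ℂ) η) := by
  unfold mn; split_ifs <;> simp

lemma mn_mul (j l : ℤ) (ξ η : ℂ) : mn j ξ η * mn l ξ η = mn (j + l) ξ η * (ξ * η) ^ ee j l := by
  have e := ee_eq j l
  unfold mn
  rw [mul_pow]
  by_cases hj : 0 ≤ j <;> by_cases hl : 0 ≤ l <;> by_cases hjl : 0 ≤ j + l <;>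
    simp only [hj, hl, hjl, if_true, if_false] <;> try omega
  · have : ee j l = 0 := by omega
    rw [this, ← pow_add, show (j+l).natAbs = j.natAbs + l.natAbs by omega]; simp
  · have h1 : ee j l = l.natAbs := by omega
    rw [h1, show j.natAbs = (j+l).natAbs + l.natAbs by omega, pow_add]; ring
  · have h1 : ee j l = j.natAbs := by omega
    rw [h1, show l.natAbs = (j+l).natAbs + j.natAbs by omega, pow_add]; ring
  · have h1 : ee j l = j.natAbs := by omega
    rw [h1, show l.natAbs = (j+l).natAbs + j.natAbs by omega, pow_add]; ring
  · have h1 : ee j l = l.natAbs := by omega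
    rw [h1, show j.natAbs = (j+l).natAbs + l.natAbs by omega, pow_add]; ring
  · have : ee j l = 0 := by omega
    rw [this, ← pow_add, show (j+l).natAbs = j.natAbs + l.natAbs by omega]; simp

variable {δ : ℝ}

lemma mul_mem_EE (h0 : 0 < δ) (h1 : δ ≤ 1) {ξ η : ℂ} (hξ : ξ ∈ ball (0:ℂ) (R1 δ)) (hη : η ∈ ball (0:ℂ) (R1 δ)) :
    ξ * η ∈ EE δ := by
  simp only [EE, mem_ball_zero_iff, R1, norm_mul] at *
  nlinarith [norm_nonneg ξ, norm_nonneg η, mul_le_mul hξ.le hη.le (norm_nonneg _) (by positivity)]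

lemma mn_norm (h0 : 0 < δ) (k : ℤ) {ξ η : ℂ} (hξ : ξ ∈ ball (0:ℂ) (R1 δ)) (hη : η ∈ ball (0:ℂ) (R1 δ)) :
    ‖mn k ξ η‖ ≤ Real.exp (k.natAbs * (δ/8)) := by
  have key : ∀ ξ ∈ ball (0:ℂ) (R1 δ), ‖ξ‖ ≤ Real.exp (δ/8) := fun ξ hξ => by
    simp only [mem_ball_zero_iff, R1] at hξ
    have := Real.add_one_le_exp (δ/8)
    linarith
  rw [Real.exp_nat_mul]
  unfold mn
  split_ifs <;> rw [norm_pow]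
  · exact pow_le_pow_left₀ (norm_nonneg _) (key _ hξ) _
  · exact pow_le_pow_left₀ (norm_nonneg _) (key _ hη) _

lemma g_norm (h0 : 0 < δ) (h1 : δ ≤ 1) {g : ℤ → ℂ → ℂ} {m : ℤ → ℝ} (H : Adm δ g m) (k : ℤ) {y : ℂ} (hy : y ∈ EE δ) :
    ‖g k y‖ ≤ m k * Real.exp (-(k.natAbs * (3 * δ / 8))) := by
  refine (H.bd k y hy).trans (mul_le_mul_of_nonneg_left (Real.exp_le_exp.2 ?_) (m_nonneg h0 H k))
  have := om_nonneg h0 h1 hy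
  nlinarith [(k.natAbs).cast_nonneg (α := ℝ)]

lemma ev_term (h0 : 0 < δ) (h1 : δ ≤ 1) {g : ℤ → ℂ → ℂ} {m : ℤ → ℝ} (H : Adm δ g m) (k : ℤ) {ξ η : ℂ}
    (hξ : ξ ∈ ball (0:ℂ) (R1 δ)) (hη : η ∈ ball (0:ℂ) (R1 δ)) : ‖mn k ξ η * g k (ξ * η)‖ ≤ m k := by
  have hm := m_nonneg h0 H k
  rw [norm_mul]
  calc _ ≤ Real.exp (k.natAbs * (δ/8)) * (m k * Real.exp (-(k.natAbs * (3 * δ / 8)))) :=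
        mul_le_mul (mn_norm h0 k hξ hη) (g_norm h0 h1 H k (mul_mem_EE h0 h1 hξ hη)) (norm_nonneg _) (by positivity)
    _ = m k * Real.exp (k.natAbs * (δ/8) + -(k.natAbs * (3 * δ / 8))) := by rw [Real.exp_add]; ring
    _ ≤ m k * 1 := by
        refine mul_le_mul_of_nonneg_left (Real.exp_le_one_iff.2 ?_) hm
        nlinarith [(k.natAbs).cast_nonneg (α := ℝ)]
    _ = _ := mul_one _

lemma ev_summable (h0 : 0 < δ) (h1 : δ ≤ 1) {g : ℤ → ℂ → ℂ} {m : ℤ → ℝ} (H : Adm δ g m) {ξ η : ℂ}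
    (hξ : ξ ∈ ball (0:ℂ) (R1 δ)) (hη : η ∈ ball (0:ℂ) (R1 δ)) : Summable fun k => ‖mn k ξ η * g k (ξ * η)‖ :=
  Summable.of_nonneg_of_le (fun _ => norm_nonneg _) (fun k => ev_term h0 h1 H k hξ hη) H.sum

lemma ev_congr (h0 : 0 < δ) (h1 : δ ≤ 1) {g h : ℤ → ℂ → ℂ} (H : ∀ k, ∀ y ∈ EE δ, g k y = h k y) {ξ η : ℂ}
    (hξ : ξ ∈ ball (0:ℂ) (R1 δ)) (hη : η ∈ ball (0:ℂ) (R1 δ)) : evv g ξ η = evv h ξ η := by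
  unfold evv
  congr 1; ext k; rw [H k _ (mul_mem_EE h0 h1 hξ hη)]

lemma ev_add (h0 : 0 < δ) (h1 : δ ≤ 1) {g h : ℤ → ℂ → ℂ} {m m' : ℤ → ℝ} (H : Adm δ g m) (H' : Adm δ h m') {ξ η : ℂ}
    (hξ : ξ ∈ ball (0:ℂ) (R1 δ)) (hη : η ∈ ball (0:ℂ) (R1 δ)) : evv (g + h) ξ η = evv g ξ η + evv h ξ η := by
  unfold evv
  rw [← (ev_summable h0 h1 H hξ hη).of_norm.tsum_add (ev_summable h0 h1 H' hξ hη).of_norm]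
  congr 1; ext k; simp; ring

lemma ev_smul (c : ℝ) (g : ℤ → ℂ → ℂ) (ξ η : ℂ) : evv (c • g) ξ η = c * evv g ξ η := by
  unfold evv
  rw [← tsum_mul_left]
  congr 1; ext k; simp; ring

lemma ev_mul (h0 : 0 < δ) (h1 : δ ≤ 1) {g h : ℤ → ℂ → ℂ} {m m' : ℤ → ℝ} (H : Adm δ g m) (H' : Adm δ h m') {ξ η : ℂ}
    (hξ : ξ ∈ ball (0:ℂ) (R1 δ)) (hη : η ∈ ball (0:ℂ) (R1 δ)) : evv (mlR g h) ξ η = evv g ξ η * evv h ξ η := by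
  have s := ev_summable h0 h1 H hξ hη
  have s' := ev_summable h0 h1 H' hξ hη
  unfold evv
  rw [tsum_mul_tsum_of_summable_norm s s']
  have sp := (summable_mul_of_summable_norm s s')
  rw [← shE.tsum_eq, show (∑' c : ℤ × ℤ, mn (shE c).1 ξ η * g (shE c).1 (ξ * η) * (mn (shE c).2 ξ η * h (shE c).2 (ξ * η))) = _ from (shE.summable_iff.2 sp).tsum_prod]
  congr 1; ext n
  rw [mlR, ← tsum_mul_left]
  congr 1; ext j
  have := mn_mul j (n - j) ξ η
  rw [add_sub_cancel] at this
  change _ = (mn j ξ η * g j (ξ * η)) * (mn (n-j) ξ η * h (n-j) (ξ * η))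
  linear_combination (-g j (ξ * η) * h (n-j) (ξ * η)) * this

lemma ev_flip (g : ℤ → ℂ → ℂ) (ξ η : ℂ) : evv (flp g) η ξ = evv g ξ η := by
  unfold evv
  rw [← (Equiv.neg ℤ).tsum_eq]
  congr 1; ext k
  simp [flp, mn_flip, mul_comm η ξ]

lemma flp_adm {g : ℤ → ℂ → ℂ} {m : ℤ → ℝ} (H : Adm δ g m) : Adm δ (flp g) (fun k => m (-k)) :=
  ⟨(Equiv.neg ℤ).summable_iff.2 H.sum, fun k => H.hol (-k), fun k y hy => by
    simpa only [Int.natAbs_neg, flp] using H.bd (-k) y hy⟩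

lemma ev_conj (g : ℤ → ℂ → ℂ) (ξ : ℂ) :
    evv (stR g) ξ ((starRingEnd ℂ) ξ) = (starRingEnd ℂ) (evv g ξ ((starRingEnd ℂ) ξ)) := by
  unfold evv
  rw [conj_tsum, ← (Equiv.neg ℤ).tsum_eq]
  congr 1; ext k
  simp only [Equiv.neg_apply, stR, neg_neg, map_mul, mn_conj, conj_conj]
  rw [← mn_flip k, mul_comm ξ]

def D1 (δ : ℝ) (g g' : ℤ → ℂ → ℂ) : Prop := ∀ k, ∀ y ∈ EE δ,
  g' (k - 1) y = if 1 ≤ k then k * g k y + y * deriv (g k) y else deriv (g k) y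

lemma ev_deriv (h0 : 0 < δ) (h1 : δ ≤ 1) {g g' : ℤ → ℂ → ℂ} {m : ℤ → ℝ} (H : Adm δ g m) (hD : D1 δ g g') {ξ η : ℂ}
    (hξ : ξ ∈ ball (0:ℂ) (R1 δ)) (hη : η ∈ ball (0:ℂ) (R1 δ)) :
    HasDerivAt (fun z => evv g z η) (evv g' ξ η) ξ := by
  have hd : ∀ k, ∀ z ∈ ball (0:ℂ) (R1 δ), HasDerivAt (fun z => mn k z η * g k (z * η))
      (mn (k-1) z η * g' (k-1) (z * η)) z := fun k z hz => by
    have hy := mul_mem_EE h0 h1 hz hη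
    have hg : HasDerivAt (fun z => g k (z * η)) (deriv (g k) (z * η) * η) z := by
      have e1 := ((H.hol k).differentiableAt ((open_EE δ).mem_nhds hy)).hasDerivAt
      have e2 : HasDerivAt (fun z => z * η) η z := by simpa using (hasDerivAt_id z).mul_const η
      exact e1.comp z e2
    rw [hD k _ hy]
    by_cases hk : 1 ≤ k
    · obtain ⟨n, rfl⟩ : ∃ n : ℕ, k = n + 1 := ⟨(k-1).toNat, by omega⟩
      have e3 : (fun z => mn (n+1) z η * g (n+1) (z * η)) = fun z => z^(n+1) * g (n+1) (z * η) := by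
        funext z; rw [mn, if_pos (by omega)]; congr 1
      rw [e3, if_pos hk]
      have : mn ((n:ℤ) + 1 - 1) z η = z ^ n := by
        rw [mn, if_pos (by omega)]; congr 1; omega
      rw [this]
      refine ((hasDerivAt_pow (n+1) z).mul hg).congr_deriv ?_
      push_cast; ring
    · rw [if_neg hk]
      have e3 : mn (k-1) z η = η * η ^ k.natAbs := by
        rw [mn, if_neg (by omega), ← pow_succ']; congr 1; omega
      have e4 : ∀ z, mn k z η = η ^ k.natAbs := fun z => by
        rw [mn]; split_ifs with h
        · have : k = 0 := by omega
          subst this; simp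
        · rfl
      simp only [e3, e4]
      exact (hg.const_mul (η ^ k.natAbs)).congr_deriv (by ring)
  have hdo : ∀ k, DifferentiableOn ℂ (fun z => mn k z η * g k (z * η)) (ball (0:ℂ) (R1 δ)) :=
    fun k z hz => (hd k z hz).differentiableAt.differentiableWithinAt
  have hs := hasSum_deriv_of_summable_norm H.sum hdo isOpen_ball
    (fun k z hz => ev_term h0 h1 H k hz hη) hξ
  have hdd := differentiableOn_tsum_of_summable_norm H.sum hdo isOpen_ball
    (fun k z hz => ev_term h0 h1 H k hz hη)
  have h3 := (hdd.differentiableAt (isOpen_ball.mem_nhds hξ)).hasDerivAt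
  refine h3.congr_deriv ?_
  rw [← hs.tsum_eq, evv, ← (Equiv.subRight (1:ℤ)).tsum_eq (fun k => mn k ξ η * g' k (ξ * η))]
  congr 1; ext k
  rw [(hd k ξ hξ).deriv]; rfl

lemma ev_deriv2 (h0 : 0 < δ) (h1 : δ ≤ 1) {g g' : ℤ → ℂ → ℂ} {m : ℤ → ℝ} (H : Adm δ g m)
    (hD : D1 δ (flp g) (flp g')) {ξ η : ℂ}
    (hξ : ξ ∈ ball (0:ℂ) (R1 δ)) (hη : η ∈ ball (0:ℂ) (R1 δ)) :
    HasDerivAt (fun z => evv g ξ z) (evv g' ξ η) η := by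
  have := ev_deriv h0 h1 (flp_adm H) hD hη hξ
  simpa only [ev_flip] using this
variable {δ : ℝ}

/-- summable sequences -/
abbrev L1 : Type := lp (fun _ : ℤ => ℂ) 1

lemma geom_int {s : ℝ} (hs0 : 0 ≤ s) (hs : s < 1) : Summable fun k : ℤ => s ^ k.natAbs := by
  rw [summable_int_iff_summable_nat_and_neg]
  simpa using summable_geometric_of_lt_one hs0 hs

lemma Yan (h0 : 0 < δ) (p : ℤ → Prop) [DecidablePred p] : ∃ Y : ℂ → (L1 →L[ℂ] ℂ), AnalyticOnNhd ℂ Y (ball 0 (R1 δ)) ∧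
    ∀ ξ ∈ ball (0:ℂ) (R1 δ), ∀ x : L1, HasSum (fun k : ℤ =>
    (if p k then (ξ / Real.exp (3 * δ / 8)) ^ k.natAbs else 0) * x k) (Y ξ x) := by
  have hr : R1 δ / Real.exp (3 * δ / 8) < 1 := by
    rw [div_lt_one (Real.exp_pos _), R1]
    have := Real.add_one_le_exp (3 * δ/8)
    linarith
  have hr0 : 0 ≤ R1 δ / Real.exp (3 * δ / 8) := by unfold R1; positivity
  have hb : ∀ k : ℤ, ∀ ξ ∈ ball (0:ℂ) (R1 δ), ‖(if p k then (ξ / Real.exp (3 * δ / 8)) ^ k.natAbs else 0) •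
      lp.evalCLM ℂ (fun _ : ℤ => ℂ) 1 k‖ ≤ (R1 δ / Real.exp (3 * δ / 8)) ^ k.natAbs := fun k ξ hξ => by
    have hn : ‖lp.evalCLM ℂ (fun _ : ℤ => ℂ) 1 k‖ ≤ 1 :=
      ContinuousLinearMap.opNorm_le_bound _ zero_le_one fun x => by
        rw [one_mul]; exact lp.norm_apply_le_norm (by simp) x k
    rw [norm_smul]
    refine (mul_le_of_le_one_right (norm_nonneg _) hn).trans ?_
    split_ifs
    · rw [norm_pow, norm_div, norm_real, Real.norm_of_nonneg (Real.exp_pos _).le]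
      gcongr
      exact (mem_ball_zero_iff.1 hξ).le
    · rw [norm_zero]; positivity
  refine ⟨_, (differentiableOn_tsum_of_summable_norm (geom_int hr0 hr) (fun k => ?_) isOpen_ball hb).analyticOnNhd
      isOpen_ball, ?_⟩
  · refine DifferentiableOn.smul_const ?_ _
    split_ifs
    · exact ((differentiableOn_id.div_const _).pow _)
    · exact differentiableOn_const 0
  · intro ξ hξ x
    have := (Summable.of_nonneg_of_le (fun _ => norm_nonneg _) (fun k => hb k ξ hξ) (geom_int hr0 hr)).of_norm
    exact this.hasSum.mapL (ContinuousLinearMap.apply ℂ ℂ x)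

lemma Xan (h0 : 0 < δ) (h1 : δ ≤ 1) {g : ℤ → ℂ → ℂ} {m : ℤ → ℝ} (H : Adm δ g m) :
    ∃ X : ℂ → L1, AnalyticOnNhd ℂ X (EE δ) ∧ ∀ y ∈ EE δ, ∀ k, X y k = g k y * (Real.exp (3 * δ / 8) : ℂ) ^ k.natAbs := by
  classical
  let r : ℂ := Real.exp (3 * δ / 8)
  have hXb : ∀ k, ∀ y ∈ EE δ, ‖(g k y * r ^ k.natAbs) • (lp.single 1 k (1:ℂ) : L1)‖ ≤ m k := fun k y hy => by
    rw [norm_smul, lp.norm_single (by simp), norm_one, mul_one, norm_mul, norm_pow, norm_real,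
      Real.norm_of_nonneg (Real.exp_pos _).le, ← Real.exp_nat_mul]
    calc _ ≤ m k * Real.exp (-(k.natAbs * (3 * δ / 8))) * Real.exp (k.natAbs * (3 * δ / 8)) := by
          gcongr; exact g_norm h0 h1 H k hy
      _ = m k := by rw [mul_assoc, ← Real.exp_add]; simp
  refine ⟨fun y => ∑' k : ℤ, (g k y * r ^ k.natAbs) • (lp.single 1 k (1:ℂ) : L1),
    (differentiableOn_tsum_of_summable_norm H.sum (fun k => ((H.hol k).mul_const _).smul_const _) (open_EE δ) hXb).analyticOnNhd
      (open_EE δ), fun y hy k => ?_⟩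
  have hXs : Summable fun k : ℤ => (g k y * r ^ k.natAbs) • (lp.single 1 k (1:ℂ) : L1) :=
    (Summable.of_nonneg_of_le (fun _ => norm_nonneg _) (fun k => hXb k y hy) H.sum).of_norm
  have e := hXs.hasSum.mapL (lp.evalCLM ℂ (fun _ : ℤ => ℂ) 1 k)
  have e2 : ∀ j, lp.evalCLM ℂ (fun _ : ℤ => ℂ) 1 k ((g j y * r ^ j.natAbs) • (lp.single 1 j (1:ℂ) : L1)) =
      (g j y * r ^ j.natAbs) * (lp.single 1 j (1:ℂ) : L1) k := fun j => rfl
  refine e.unique ?_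
  simp only [e2]
  convert hasSum_single k ?_ using 1
  · simp [r]
  · intro j hj
    simp [hj.symm]

lemma ev_analytic (h0 : 0 < δ) (h1 : δ ≤ 1) {g : ℤ → ℂ → ℂ} {m : ℤ → ℝ} (H : Adm δ g m) :
    AnalyticOnNhd ℂ (fun p : ℂ × ℂ => evv g p.1 p.2) (ball (0:ℂ) (R1 δ) ×ˢ ball (0:ℂ) (R1 δ)) := by
  obtain ⟨X, hX, hXc⟩ := Xan h0 h1 H
  obtain ⟨Y, hY, hYs⟩ := Yan h0 (fun k => 0 ≤ k)
  obtain ⟨Z, hZ, hZs⟩ := Yan h0 (fun k => ¬ 0 ≤ k)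
  have key : ∀ p ∈ ball (0:ℂ) (R1 δ) ×ˢ ball (0:ℂ) (R1 δ), (Y p.1 + Z p.2) (X (p.1 * p.2)) = evv g p.1 p.2 := by
    rintro ⟨ξ, η⟩ ⟨hξ, hη⟩
    have hy := mul_mem_EE h0 h1 hξ hη
    simp only at hξ hη
    have e := (hYs ξ hξ (X (ξ * η))).add (hZs η hη (X (ξ * η)))
    refine (e.tsum_eq.symm).trans ?_
    rw [evv]
    congr 1; ext k
    rw [hXc _ hy, mn]
    have hr' : (Real.exp (3 * δ / 8) : ℂ) ^ k.natAbs ≠ 0 := pow_ne_zero _ (ofReal_ne_zero.2 (Real.exp_pos _).ne')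
    by_cases hk : 0 ≤ k
    · simp only [hk, if_true, not_true, if_false, zero_mul, add_zero, div_pow]
      field_simp
    · simp only [hk, if_true, not_false_iff, if_false, zero_mul, zero_add, div_pow]
      field_simp
  have hop : IsOpen (ball (0:ℂ) (R1 δ) ×ˢ ball (0:ℂ) (R1 δ)) := isOpen_ball.prod isOpen_ball
  refine AnalyticOnNhd.congr hop (f := fun p : ℂ × ℂ => (Y p.1 + Z p.2) (X (p.1 * p.2))) (fun p hp => ?_) key
  have a1 : AnalyticAt ℂ (fun p : ℂ × ℂ => Y p.1 + Z p.2) p :=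
    ((hY p.1 hp.1).comp analyticAt_fst).add ((hZ p.2 hp.2).comp analyticAt_snd)
  have a2 : AnalyticAt ℂ (fun p : ℂ × ℂ => X (p.1 * p.2)) p :=
    AnalyticAt.comp (f := fun p : ℂ × ℂ => p.1 * p.2) (hX _ (mul_mem_EE h0 h1 hp.1 hp.2)) (analyticAt_fst.mul analyticAt_snd)
  exact (ContinuousLinearMap.analyticAt_bilinear (ContinuousLinearMap.id ℂ (L1 →L[ℂ] ℂ)) (Y p.1 + Z p.2, X (p.1 * p.2))).comp₂ a1 a2

lemma D1_a (h0 : 0 < δ) {h : ℤ → ℂ → ℂ} {m : ℤ → ℝ} (H : Adm δ h m) : D1 δ (Gg h) (T1 h) := fun k y hy => by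
  rw [(Gg_deriv h0 H k hy).deriv, T1, sub_add_cancel]
  by_cases hk : 1 ≤ k
  · rw [if_pos hk, if_pos (by omega)]; push_cast; ring
  · rw [if_neg hk, if_neg (by omega)]

lemma D1_b (h0 : 0 < δ) {h : ℤ → ℂ → ℂ} {m : ℤ → ℝ} (H : Adm δ h m) : D1 δ (T1 h) (T2 h) := fun k y hy => by
  have e1 := Pp_deriv h0 H (k+1) hy
  have e2 := Gg_deriv h0 H (k+1) hy
  have e0 : k - 1 + 2 = k + 1 := by ring
  by_cases hk : 1 ≤ k
  · rw [if_pos hk, T2_pos (by omega), T1_pos (by omega)]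
    have : HasDerivAt (fun y => ((k:ℂ)+1) * Gg h (k+1) y + y * Pp h (k+1) y) _ y :=
      (e2.const_mul ((k:ℂ)+1)).add ((hasDerivAt_id y).mul e1.1)
    rw [this.deriv]
    have e4 : ((k+1).natAbs : ℂ) = k + 1 := by
      have : ((k+1).natAbs : ℤ) = k + 1 := by omega
      rw [← Int.cast_natCast, this]; push_cast; rfl
    rw [e4] at e1
    simp only [e0, id]
    push_cast
    linear_combination -y * e1.2
  · rw [if_neg hk]
    by_cases hk0 : k = 0
    · subst hk0
      have : HasDerivAt (fun y => (((0:ℤ):ℂ)+1) * Gg h (0+1) y + y * Pp h (0+1) y) _ y :=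
        (e2.const_mul (((0:ℤ):ℂ)+1)).add ((hasDerivAt_id y).mul e1.1)
      rw [T1_pos le_rfl, this.deriv, show (0:ℤ) - 1 = -1 by rfl, T2_m1, show (-1:ℤ) + 2 = 0 + 1 by rfl, ← e1.2]
      simp; ring
    · rw [T1_neg (by omega), T2_neg (by omega) (by omega), e0, e1.1.deriv]

lemma D1_c (h0 : 0 < δ) {h : ℤ → ℂ → ℂ} {m : ℤ → ℝ} (H : Adm δ h m) : D1 δ (flp (T1 h)) (flp h) := fun k y hy => by
  have e1 := Pp_deriv h0 H (-k+1) hy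
  have e2 := Gg_deriv h0 H (-k+1) hy
  unfold flp
  rw [show -(k-1) = -k+1 by ring]
  by_cases hk : 1 ≤ k
  · rw [if_pos hk, T1_neg (by omega), e1.1.deriv, ← e1.2]
    have e4 : ((-k+1).natAbs : ℂ) = k - 1 := by
      have : ((-k+1).natAbs : ℤ) = k - 1 := by omega
      rw [← Int.cast_natCast, this]; push_cast; rfl
    rw [e4]; ring
  · rw [if_neg hk]
    have : HasDerivAt (fun y => (((-k:ℤ):ℂ)+1) * Gg h (-k+1) y + y * Pp h (-k+1) y) _ y :=
      (e2.const_mul (((-k:ℤ):ℂ)+1)).add ((hasDerivAt_id y).mul e1.1)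
    rw [T1_pos (by omega), this.deriv, ← e1.2]
    have e4 : ((-k+1).natAbs : ℂ) = (-k:ℤ) + 1 := by
      have : ((-k+1).natAbs : ℤ) = -k + 1 := by omega
      rw [← Int.cast_natCast, this]; push_cast; rfl
    rw [e4]; simp; ring

lemma conj_rad (c : ℂ) (n : ℕ) (h : ℂ → ℂ) (y : ℂ) : (starRingEnd ℂ) (rad c n h y) =
    rad ((starRingEnd ℂ) c) n (fun z => (starRingEnd ℂ) (h ((starRingEnd ℂ) z))) ((starRingEnd ℂ) y) := by
  unfold rad
  rw [← intervalIntegral.intervalIntegral_conj]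
  congr 1; ext l
  simp

lemma Gg_st (h : ℤ → ℂ → ℂ) (k : ℤ) (y : ℂ) : Gg (stR h) k y = stR (Gg h) k y := by
  have e : ∀ z, (starRingEnd ℂ) (Pp h (-k) ((starRingEnd ℂ) z)) = Pp (stR h) k z := fun z => by
    unfold Pp
    rw [conj_rad]; simp only [conj_conj, map_zero, Int.natAbs_neg]; rfl
  unfold Gg
  rw [stR, map_mul, conj_rad]
  simp only [e, map_one, map_sub, conj_conj]
variable {δ : ℝ}

lemma embed (h0 : 0 < δ) (h1 : δ ≤ 1) {ρ : ℝ} (hρ : Real.exp δ < ρ) {F : ℂ → ℂ} (hF : DifferentiableOn ℂ F (ball 0 ρ)) :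
    ∃ f : HH δ, ∀ ξ ∈ ball (0:ℂ) (R1 δ), ∀ η ∈ ball (0:ℂ) (R1 δ), evv (raw δ f) ξ η = F ξ := by
  obtain ⟨R', hR1', hR2⟩ := exists_between hρ
  have hR0' : 0 < R' := (Real.exp_pos _).trans hR1'
  lift R' to NNReal using hR0'.le with R
  have hR1 : Real.exp δ < R := hR1'
  have hR0 : 0 < R := by exact_mod_cast hR0'
  have hps := (hF.mono (closedBall_subset_ball hR2)).hasFPowerSeriesOnBall hR0
  set p := cauchyPowerSeries F 0 R with hp
  let r : NNReal := ⟨Real.exp δ, (Real.exp_pos _).le⟩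
  have hr : (r : ENNReal) < p.radius := by
    refine lt_of_lt_of_le ?_ hps.r_le
    exact ENNReal.coe_lt_coe.2 (show r < R from hR1)
  have hsum := p.summable_norm_mul_pow hr
  let g : ℤ → ℂ → ℂ := fun k _ => if 0 ≤ k then p.coeff k.natAbs else 0
  let m : ℤ → ℝ := fun k => if 0 ≤ k then ‖p k.natAbs‖ * Real.exp δ ^ k.natAbs else 0
  have hadm : Adm δ g m := by
    refine ⟨?_, fun k => differentiableOn_const _, fun k y hy => ?_⟩
    · refine (Function.Injective.summable_iff (f := m) Nat.cast_injective ?_).1 ?_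
      · intro k hk
        have : ¬ 0 ≤ k := fun h => hk ⟨k.natAbs, by omega⟩
        simp [m, this]
      · refine hsum.congr fun n => ?_
        simp [m, r]; left; rfl
    · simp only [g, m]
      split_ifs
      · rw [FormalMultilinearSeries.norm_apply_eq_norm_coef, mul_assoc, ← Real.exp_nat_mul, ← Real.exp_add]
        refine le_mul_of_one_le_right (norm_nonneg _) (Real.one_le_exp ?_)
        have := om_le h0 y
        nlinarith [(k.natAbs).cast_nonneg (α := ℝ)]
      · simp
  obtain ⟨f, hf, -⟩ := exists_mk g m hadm h0
  refine ⟨f, fun ξ hξ η hη => ?_⟩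
  rw [ev_congr h0 h1 hf hξ hη, evv]
  have hx : ξ ∈ Metric.eball (0:ℂ) R := by
    rw [Metric.eball_coe, mem_ball_zero_iff]
    rw [mem_ball_zero_iff, R1] at hξ
    have := Real.add_one_le_exp δ
    linarith
  have hs := hps.hasSum hx
  rw [zero_add] at hs
  rw [← hs.tsum_eq]
  refine (Function.Injective.tsum_eq (g := ((↑) : ℕ → ℤ)) Nat.cast_injective ?_).symm.trans ?_
  · intro k hk
    by_contra h
    have : ¬ 0 ≤ k := fun h' => h ⟨k.natAbs, by omega⟩
    simp [g, this] at hk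
  · congr 1; ext n
    rw [FormalMultilinearSeries.apply_eq_pow_smul_coeff]
    simp [g, mn]

lemma exists_sqrt {ρ : ℝ} {a : ℂ → ℂ} (ha : DifferentiableOn ℂ a (ball 0 ρ)) (hne : ∀ z ∈ ball (0:ℂ) ρ, a z ≠ 0) (hρ : 0 < ρ) :
    ∃ G : ℂ → ℂ, DifferentiableOn ℂ G (ball 0 ρ) ∧ ∀ z ∈ ball (0:ℂ) ρ, a z = G z ^ 2 := by
  have hq : DifferentiableOn ℂ (fun z => deriv a z / a z) (ball 0 ρ) := (ha.deriv isOpen_ball).div ha hne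
  obtain ⟨l, hl⟩ := hq.isExactOn_ball
  have hz : (0:ℂ) ∈ ball (0:ℂ) ρ := mem_ball_self hρ
  have hd : ∀ z ∈ ball (0:ℂ) ρ, HasDerivAt (fun z => a z * exp (-l z)) 0 z := fun z hz => by
    have h1 := (ha.differentiableAt (isOpen_ball.mem_nhds hz)).hasDerivAt
    have h2 := (hl z hz).fun_neg.cexp
    refine (h1.mul h2).congr_deriv ?_
    have := hne z hz
    field_simp; ring
  have hc : ∀ z ∈ ball (0:ℂ) ρ, a z * exp (-l z) = a 0 * exp (-l 0) := fun z hz' =>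
    IsOpen.is_const_of_deriv_eq_zero isOpen_ball (convex_ball _ _).isPreconnected
      (fun w hw => (hd w hw).differentiableAt.differentiableWithinAt) (fun w hw => (hd w hw).deriv) hz' hz
  refine ⟨fun z => exp ((log (a 0 * exp (-l 0)) + l z)/2), fun z hz => ?_, fun z hz' => ?_⟩
  · exact (((hl z hz).const_add _).div_const 2).cexp.differentiableAt.differentiableWithinAt
  · rw [← exp_nat_mul, Nat.cast_ofNat, mul_div_cancel₀ _ (by norm_num), exp_add, exp_log, ← hc z hz', mul_assoc,
      ← exp_add]
    · simp
    · exact mul_ne_zero (hne 0 hz) (exp_ne_zero _)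

lemma bil_strict {V P : Type*} [NormedAddCommGroup V] [NormedSpace ℝ V] [NormedAddCommGroup P] [NormedSpace ℝ P]
    (B : V →L[ℝ] V →L[ℝ] V) {a b : P → V} {a' b' : P →L[ℝ] V} (ha : HasStrictFDerivAt a a' 0)
    (hb : HasStrictFDerivAt b b' 0) (ha0 : a 0 = 0) (hb0 : b 0 = 0) :
    HasStrictFDerivAt (fun p => B (a p) (b p)) (0 : P →L[ℝ] V) 0 := by
  have := (B.isBoundedBilinearMap.hasStrictFDerivAt (a 0, b 0)).comp (0:P) (ha.prodMk hb)
  refine HasStrictFDerivAt.congr_fderiv this ?_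
  ext v
  simp [ha0, hb0]

lemma solve_abs {V : Type*} [NormedAddCommGroup V] [NormedSpace ℝ V] [CompleteSpace V]
    (B : V →L[ℝ] V →L[ℝ] V) (st L : V →L[ℝ] V) (e : V) : ∃ ε > 0, ∀ κ : ℝ, |κ| < ε → ∃ n : V, ‖n‖ < 1/2 ∧
      n = (1/2 : ℝ) • (κ • L (e + n) + st (κ • L (e + n)) + B (κ • L (e + n)) (st (κ • L (e + n))) - B n (st n)) := by
  let q : ℝ × V → V := fun p => p.1 • L (e + p.2)
  have hq : HasStrictFDerivAt q ((ContinuousLinearMap.fst ℝ ℝ V).smulRight (L e)) 0 := by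
    have h1 : HasStrictFDerivAt (fun p : ℝ × V => L (e + p.2)) (L.comp (ContinuousLinearMap.snd ℝ ℝ V)) 0 :=
      L.hasStrictFDerivAt.comp (0 : ℝ × V) (hasStrictFDerivAt_snd.const_add e)
    refine HasStrictFDerivAt.congr_fderiv (hasStrictFDerivAt_fst.smul h1) ?_
    ext v <;> simp
  have hq0 : q 0 = 0 := by simp [q]
  have hsq : HasStrictFDerivAt (fun p => st (q p)) (st.comp ((ContinuousLinearMap.fst ℝ ℝ V).smulRight (L e))) 0 :=
    st.hasStrictFDerivAt.comp (0 : ℝ × V) hq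
  have hn : HasStrictFDerivAt (fun p : ℝ × V => p.2) (ContinuousLinearMap.snd ℝ ℝ V) 0 := hasStrictFDerivAt_snd
  have hsn : HasStrictFDerivAt (fun p : ℝ × V => st p.2) (st.comp (ContinuousLinearMap.snd ℝ ℝ V)) 0 :=
    st.hasStrictFDerivAt.comp (0 : ℝ × V) hn
  have hN := (((hq.add hsq).add (bil_strict B hq hsq hq0 (by simp [hq0]))).sub
    (bil_strict B hn hsn rfl (by simp))).const_smul (1/2 : ℝ)
  have hΦ := (hasStrictFDerivAt_fst (𝕜 := ℝ) (p := (0 : ℝ × V))).prodMk (hn.sub hN)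
  have hs := hΦ.map_nhds_eq_of_surj (by
    rw [LinearMap.range_eq_top]
    rintro ⟨k, v⟩
    refine ⟨(k, v + (1/2:ℝ) • (k • L e + st (k • L e))), ?_⟩
    simp)
  have hU : {p : ℝ × V | ‖p.2‖ < 1/2} ∈ 𝓝 (0 : ℝ × V) :=
    (isOpen_lt (by fun_prop) continuous_const).mem_nhds (by simp)
  have h2 := image_mem_map (m := fun p : ℝ × V => (p.1, p.2 - (1/2 : ℝ) • (q p + st (q p) + B (q p) (st (q p)) - B p.2 (st p.2)))) hU
  have h3 := hs ▸ h2
  simp only [Prod.fst_zero, Pi.sub_apply, Pi.add_apply, Pi.smul_apply] at h3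
  have h6 : (0:ℝ × V).2 - (1/2 : ℝ) • (q 0 + st (q 0) + B (q 0) (st (q 0)) - B (0:ℝ×V).2 (st (0:ℝ×V).2)) = 0 := by
    simp [hq0]
  rw [h6] at h3
  have h4 := ContinuousAt.preimage_mem_nhds (f := fun κ : ℝ => (κ, (0:V))) (x := 0) (by fun_prop) h3
  obtain ⟨ε, hε, h5⟩ := Metric.mem_nhds_iff.1 h4
  refine ⟨ε, hε, fun κ hκ => ?_⟩
  obtain ⟨⟨k, n⟩, hn1, hn2⟩ := h5 (show κ ∈ ball 0 ε by simpa using hκ)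
  simp only [Prod.mk.injEq] at hn2
  obtain ⟨rfl, hn2⟩ := hn2
  exact ⟨n, hn1, sub_eq_zero.1 hn2⟩
/-- The nonlinear perturbation problem on the unit disc. -/
theorem FP {ρ : ℝ} (hρ : 1 < ρ) {a b : ℂ → ℂ} (ha : DifferentiableOn ℂ a (ball 0 ρ)) (hb : DifferentiableOn ℂ b (ball 0 ρ))
    (hne : ∀ z ∈ ball (0:ℂ) ρ, a z ≠ 0) : ∃ ε > 0, ∃ R > 1, ∀ κ : ℝ, |κ| < ε → ∃ U U1 U11 U12 : ℂ × ℂ → ℂ,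
      AnalyticOnNhd ℂ U (ball (0:ℂ) R ×ˢ ball (0:ℂ) R) ∧
      (∀ ξ ∈ ball (0:ℂ) R, ∀ η ∈ ball (0:ℂ) R, HasDerivAt (fun z => U (z, η)) (U1 (ξ, η)) ξ ∧
        HasDerivAt (fun z => U1 (z, η)) (U11 (ξ, η)) ξ ∧ HasDerivAt (fun z => U1 (ξ, z)) (U12 (ξ, η)) η) ∧
      ∀ ξ ∈ ball (0:ℂ) R, (U (ξ, (starRingEnd ℂ) ξ)).im = 0 ∧ (‖ξ‖ = 1 → U (ξ, (starRingEnd ℂ) ξ) = 0) ∧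
        U12 (ξ, (starRingEnd ℂ) ξ) = κ * ‖a ξ + U11 (ξ, (starRingEnd ℂ) ξ) + b ξ * U1 (ξ, (starRingEnd ℂ) ξ)‖ := by
  obtain ⟨δ, h0, h1, hδ⟩ : ∃ δ : ℝ, 0 < δ ∧ δ ≤ 1 ∧ Real.exp δ < ρ := by
    refine ⟨min 1 (Real.log ρ / 2), lt_min one_pos (half_pos (Real.log_pos hρ)), min_le_left _ _, ?_⟩
    rw [← Real.lt_log_iff_exp_lt (by linarith)]
    exact (min_le_right _ _).trans_lt (half_lt_self (Real.log_pos hρ))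
  have := HH_complete h0 h1
  obtain ⟨S, hS⟩ := S_lift h0 h1
  obtain ⟨L1, hL1⟩ := T1_lift h0 h1
  obtain ⟨L2, hL2⟩ := T2_lift h0 h1
  obtain ⟨st, hst⟩ := st_lift h0
  obtain ⟨B, hB⟩ := ml_lift h0 h1
  obtain ⟨G, hG, haG⟩ := exists_sqrt ha hne (by linarith)
  obtain ⟨vG, hvG⟩ := embed h0 h1 hδ hG
  obtain ⟨vb, hvb⟩ := embed h0 h1 hδ hb
  obtain ⟨va, hva⟩ := embed h0 h1 hδ (ha.inv hne)
  obtain ⟨e, he⟩ := embed h0 h1 hδ (differentiableOn_const (s := ball (0:ℂ) ρ) (1:ℂ))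
  let D := ball (0:ℂ) (R1 δ)
  let E : HH δ → ℂ → ℂ → ℂ := fun f => evv (raw δ f)
  have Eadd : ∀ f g : HH δ, ∀ ξ ∈ D, ∀ η ∈ D, E (f + g) ξ η = E f ξ η + E g ξ η := fun f g ξ hξ η hη => by
    simp only [E, Submodule.coe_add, raw_add]; exact ev_add h0 h1 (adm_raw f) (adm_raw g) hξ hη
  have Esmul : ∀ (c : ℝ) (f : HH δ), ∀ ξ η, E (c • f) ξ η = c * E f ξ η := fun c f ξ η => by
    simp only [E, Submodule.coe_smul, raw_smul]; exact ev_smul _ _ _ _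
  have Esub : ∀ f g : HH δ, ∀ ξ ∈ D, ∀ η ∈ D, E (f - g) ξ η = E f ξ η - E g ξ η := fun f g ξ hξ η hη => by
    have := Eadd (f - g) g ξ hξ η hη
    rw [sub_add_cancel] at this
    rw [this]; ring
  have Emul : ∀ f g : HH δ, ∀ ξ ∈ D, ∀ η ∈ D, E (B f g) ξ η = E f ξ η * E g ξ η := fun f g ξ hξ η hη => by
    simp only [E]
    rw [ev_congr h0 h1 (hB f g) hξ hη]; exact ev_mul h0 h1 (adm_raw f) (adm_raw g) hξ hη
  have cD : ∀ ξ ∈ D, (starRingEnd ℂ) ξ ∈ D := fun ξ hξ => by simpa [D] using hξ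
  have Est : ∀ f : HH δ, ∀ ξ ∈ D, E (st f) ξ ((starRingEnd ℂ) ξ) = (starRingEnd ℂ) (E f ξ ((starRingEnd ℂ) ξ)) :=
    fun f ξ hξ => by
      simp only [E]
      rw [ev_congr h0 h1 (hst f) hξ (cD ξ hξ)]; exact ev_conj _ _
  have stst : ∀ f, st (st f) = f := fun f => HH_ext fun k y hy => by
    rw [hst _ k y hy, stR, hst _ _ _ (conj_EE hy), stR]; simp
  have Sst : ∀ f, S (st f) = st (S f) := fun f => HH_ext fun k y hy => by
    rw [hS _ k y hy, hst _ k y hy, stR, hS _ _ _ (conj_EE hy)]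
    change _ = stR (Gg (raw δ f)) k y
    rw [← Gg_st]
    simp only [Gg]
    congr 1
    refine rad_congr (one_mem_EE h0) (fun z hz => ?_) hy
    exact rad_congr (zero_mem_EE h0) (fun w hw => hst f k w hw) hz
  let X : HH δ →L[ℝ] HH δ := B (B vG (st vG))
  let Xt : HH δ →L[ℝ] HH δ := (1/2 : ℝ) • (X + st.comp X)
  let L : HH δ →L[ℝ] HH δ := (B va).comp (L2.comp Xt + (B vb).comp (L1.comp Xt))
  obtain ⟨ε, hε, hsol⟩ := solve_abs B st L e
  refine ⟨ε, hε, R1 δ, by unfold R1; linarith, fun κ hκ => ?_⟩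
  obtain ⟨n, hn1, hn2⟩ := hsol κ hκ
  let x := Xt (e + n)
  have Hx := adm_raw x
  refine ⟨fun p => κ * evv (Gg (raw δ x)) p.1 p.2, fun p => κ * evv (T1 (raw δ x)) p.1 p.2,
    fun p => κ * evv (T2 (raw δ x)) p.1 p.2, fun p => κ * E x p.1 p.2, ?_, fun ξ hξ η hη => ⟨?_, ?_, ?_⟩, fun ξ hξ => ⟨?_, ?_, ?_⟩⟩
  · have e1 := ev_analytic h0 h1 (adm_raw (S x))
    refine AnalyticOnNhd.congr (isOpen_ball.prod isOpen_ball) (f := fun p => κ * evv (raw δ (S x)) p.1 p.2)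
      (analyticOnNhd_const.mul e1) fun p hp => ?_
    simp only
    rw [ev_congr h0 h1 (hS x) hp.1 hp.2]
  · have e1 : Adm δ (Gg (raw δ x)) (fun k => ‖((S x : HH δ) : LL).cm k‖) := by
      have := adm_raw (S x)
      exact ⟨this.sum, fun k => (Gg_diff h0 Hx k), fun k y hy => by rw [← hS x k y hy]; exact this.bd k y hy⟩
    exact (ev_deriv h0 h1 e1 (D1_a h0 Hx) hξ hη).const_mul _
  · have e1 : Adm δ (T1 (raw δ x)) (fun k => ‖((L1 x : HH δ) : LL).cm k‖) := by
      have := adm_raw (L1 x)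
      exact ⟨this.sum, fun k => (this.hol k).congr (fun y hy => (hL1 x k y hy).symm), fun k y hy => by rw [← hL1 x k y hy]; exact this.bd k y hy⟩
    exact (ev_deriv h0 h1 e1 (D1_b h0 Hx) hξ hη).const_mul _
  · have e1 : Adm δ (T1 (raw δ x)) (fun k => ‖((L1 x : HH δ) : LL).cm k‖) := by
      have := adm_raw (L1 x)
      exact ⟨this.sum, fun k => (this.hol k).congr (fun y hy => (hL1 x k y hy).symm), fun k y hy => by rw [← hL1 x k y hy]; exact this.bd k y hy⟩
    exact (ev_deriv2 h0 h1 e1 (D1_c h0 Hx) hξ hη).const_mul _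
  · have e1 : st x = x := by
      change st ((1/2:ℝ) • (X (e + n) + st (X (e + n)))) = (1/2:ℝ) • (X (e + n) + st (X (e + n)))
      rw [map_smul, map_add, stst, add_comm]
    have e2 := Est (S x) ξ hξ
    rw [← Sst, e1] at e2
    have e3 := conj_eq_iff_im.1 e2.symm
    simp only [E] at e3
    rw [ev_congr h0 h1 (hS x) hξ (cD ξ hξ)] at e3
    simp [e3]
  · intro h
    have : ξ * (starRingEnd ℂ) ξ = 1 := by rw [mul_conj, normSq_eq_norm_sq, h]; simp
    simp [evv, this, Gg]
  · have hξ' := cD ξ hξ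
    have Est' : ∀ f : HH δ, E (st f) ξ ((starRingEnd ℂ) ξ) = (starRingEnd ℂ) (E f ξ ((starRingEnd ℂ) ξ)) :=
      fun f => Est f ξ hξ
    generalize (starRingEnd ℂ) ξ = ζ at hξ' Est' ⊢
    have hξρ : ξ ∈ ball (0:ℂ) ρ := by
      have := Real.add_one_le_exp δ
      have h3 := mem_ball_zero_iff.1 hξ
      rw [R1] at h3
      rw [mem_ball_zero_iff]; linarith
    set N := E n ξ ζ with hN
    set Q := E (κ • L (e + n)) ξ ζ with hQ
    have hNb : ‖N‖ < 1/2 := by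
      refine lt_of_le_of_lt ?_ hn1
      have hs := ev_summable h0 h1 (adm_raw n) hξ hξ'
      refine (norm_tsum_le_tsum_norm hs).trans ((hs.tsum_le_tsum (fun k => ev_term h0 h1 (adm_raw n) k hξ hξ') (adm_raw n).sum).trans_eq ?_)
      exact (norm_LL n).2.symm
    have hEq : N = (1/2 : ℝ) * (Q + (starRingEnd ℂ) Q + Q * (starRingEnd ℂ) Q - N * (starRingEnd ℂ) N) := by
      have := congrArg (fun f => E f ξ ζ) hn2
      simp only [Esmul (1/2), Esub _ _ ξ hξ ζ hξ', Eadd _ _ ξ hξ ζ hξ', Emul _ _ ξ hξ ζ hξ', Est', ← hN, ← hQ] at this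
      exact this
    rw [add_conj, mul_conj, mul_conj] at hEq
    obtain ⟨ν, hν⟩ : ∃ ν : ℝ, N = ν := ⟨(1/2) * (2 * Q.re + normSq Q - normSq N), by refine hEq.trans ?_; push_cast; ring⟩
    rw [hν] at hEq hNb
    have hH : (1 + ν) = ‖1 + Q‖ := by
      have hν1 : 0 ≤ 1 + ν := by
        rw [norm_real] at hNb
        have := neg_abs_le ν
        rw [Real.norm_eq_abs] at hNb
        linarith
      rw [← Real.sqrt_sq hν1, norm_def]
      congr 1
      have : ν = (1/2) * (2 * Q.re + normSq Q - normSq (ν:ℂ)) := by exact_mod_cast hEq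
      rw [normSq_ofReal] at this
      rw [normSq_add]
      simp
      linarith
    have hx1 : E (X (e + n)) ξ ζ = ‖a ξ‖ * (1 + ν) := by
      simp only [X]
      rw [Emul _ _ ξ hξ ζ hξ', Emul _ _ ξ hξ ζ hξ', Est', Eadd _ _ ξ hξ ζ hξ', ← hN, hν]
      simp only [E, hvG ξ hξ ζ hξ', he ξ hξ ζ hξ', mul_conj, normSq_eq_norm_sq, haG ξ hξρ, norm_pow]
    have hx : E x ξ ζ = ‖a ξ‖ * (1 + ν) := by
      simp only [x, Xt, smul_apply, add_apply, ContinuousLinearMap.comp_apply]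
      rw [Esmul, Eadd _ _ ξ hξ ζ hξ', Est', hx1]
      simp; ring
    have hQ2 : Q = (a ξ)⁻¹ * (κ * evv (T2 (raw δ x)) ξ ζ + b ξ * (κ * evv (T1 (raw δ x)) ξ ζ)) := by
      rw [hQ, Esmul]
      simp only [L, ContinuousLinearMap.comp_apply, add_apply]
      rw [Emul _ _ ξ hξ ζ hξ', Eadd _ _ ξ hξ ζ hξ', Emul _ _ ξ hξ ζ hξ']
      simp only [E, hva ξ hξ ζ hξ', hvb ξ hξ ζ hξ']
      rw [ev_congr h0 h1 (hL2 _) hξ hξ', ev_congr h0 h1 (hL1 _) hξ hξ']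
      simp only [Pi.inv_apply, x]; ring
    simp only
    rw [hx]
    have : a ξ + κ * evv (T2 (raw δ x)) ξ ζ + b ξ * (κ * evv (T1 (raw δ x)) ξ ζ) = a ξ * (1 + Q) := by
      have := hne ξ hξρ
      rw [hQ2]; field_simp; ring
    rw [this, norm_mul, ← hH]
    push_cast; ring
lemma loc_ext {f : ℝ → ℂ} {s : ℝ} (hf : AnalyticAt ℝ f s) : ∃ r > 0, ∃ G : ℂ → ℂ, DifferentiableOn ℂ G (ball (s:ℂ) r) ∧
    ∀ x : ℝ, (x:ℂ) ∈ ball (s:ℂ) r → G x = f x := by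
  obtain ⟨p, R, hp⟩ := hf
  obtain ⟨r, hr0, hr⟩ := ENNReal.lt_iff_exists_nnreal_btwn.1 hp.r_pos
  have hr0 : 0 < r := by exact_mod_cast hr0
  refine ⟨r, hr0, fun z => ∑' n, p.coeff n * (z - s) ^ n, ?_, fun x hx => ?_⟩
  · refine differentiableOn_tsum_of_summable_norm (p.summable_norm_mul_pow (hr.trans_le hp.r_le)) (fun n => by fun_prop) isOpen_ball fun n z hz => ?_
    rw [norm_mul, norm_pow, ← p.norm_apply_eq_norm_coef]
    gcongr
    exact (mem_ball_iff_norm.1 hz).le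
  · have hx' : ‖x - s‖ < r := by
      rw [mem_ball_iff_norm, ← ofReal_sub, norm_real] at hx; exact hx
    have := (hp.hasSum (y := x - s) (by
      rw [mem_eball_zero_iff]
      refine lt_trans ?_ hr
      rw [← ofReal_norm, ENNReal.ofReal_lt_iff_lt_toReal (norm_nonneg _) (by simp)]; simpa using hx')).tsum_eq
    simp only [add_sub_cancel] at this
    rw [← this]
    refine tsum_congr fun n => ?_
    rw [p.apply_eq_pow_smul_coeff, real_smul]; push_cast; ring

lemma id_real {U : Set ℂ} (hU : IsOpen U) (hc : IsPreconnected U) {F G : ℂ → ℂ} (hF : DifferentiableOn ℂ F U) (hG : DifferentiableOn ℂ G U)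
    {s : ℝ} (hs : (s:ℂ) ∈ U) (h : ∀ᶠ x : ℝ in 𝓝 s, F x = G x) : EqOn F G U := by
  refine (hF.analyticOnNhd hU).eqOn_of_preconnected_of_frequently_eq (hG.analyticOnNhd hU) hc hs ?_
  have h1 : Tendsto (fun x : ℝ => (x:ℂ)) (𝓝[≠] s) (𝓝[≠] (s:ℂ)) :=
    tendsto_nhdsWithin_of_tendsto_nhds_of_eventually_within _ (continuous_ofReal.continuousAt.tendsto.mono_left nhdsWithin_le_nhds)
      (eventually_nhdsWithin_of_forall fun x hx => by simpa using hx)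
  exact h1.frequently (h.filter_mono nhdsWithin_le_nhds).frequently

def strip (δ : ℝ) : Set ℂ := {z | |z.im| < δ}

lemma strip_open (δ : ℝ) : IsOpen (strip δ) := isOpen_lt (by fun_prop) continuous_const

lemma strip_convex (δ : ℝ) : Convex ℝ (strip δ) := by
  have : strip δ = imCLM ⁻¹' (ball 0 δ) := by ext; simp [strip]
  rw [this]; exact (convex_ball _ _).linear_preimage imCLM.toLinearMap

lemma real_strip {δ : ℝ} (h : 0 < δ) (s : ℝ) : (s:ℂ) ∈ strip δ := by simp [strip, h]

lemma P1 {f : ℝ → ℂ} (hf : AnalyticOnNhd ℝ f univ) {T : ℝ} (hT : 0 < T) (hper : ∀ s, f (s + T) = f s) :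
    ∃ δ > 0, ∃ F : ℂ → ℂ, DifferentiableOn ℂ F (strip δ) ∧ (∀ s : ℝ, F s = f s) ∧ ∀ z ∈ strip δ, F (z + T) = F z := by
  choose r hr G hG hGf using fun s => loc_ext (hf s (mem_univ s))
  obtain ⟨δ, hδ, hcov⟩ := lebesgue_number_lemma_of_metric ((isCompact_Icc (a := (0:ℝ)) (b := T)).image continuous_ofReal) (c := fun s : ℝ => ball (s:ℂ) (r s))
    (fun _ => isOpen_ball) (by rintro _ ⟨s, _, rfl⟩; exact mem_iUnion.2 ⟨s, mem_ball_self (hr s)⟩)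
  -- uniform radius
  have key : ∀ s : ℝ, ∃ H : ℂ → ℂ, DifferentiableOn ℂ H (ball (s:ℂ) δ) ∧ ∀ x : ℝ, (x:ℂ) ∈ ball (s:ℂ) δ → H x = f x := by
    intro s
    have hP : Function.Periodic f T := hper
    obtain ⟨s', hs', n, hn⟩ : ∃ s' ∈ Ico 0 T, ∃ n : ℤ, s = s' + n * T := by
      have h1 := toIcoMod_mem_Ico' hT s
      refine ⟨_, h1, toIcoDiv hT 0 s, ?_⟩
      have := toIcoMod_add_toIcoDiv_zsmul hT 0 s
      rw [zsmul_eq_mul] at this; exact this.symm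
    obtain ⟨i, hsub⟩ := hcov s' ⟨s', ⟨hs'.1, hs'.2.le⟩, rfl⟩
    have hmv : ∀ z ∈ ball (s:ℂ) δ, z - n * T ∈ ball (s':ℂ) δ := fun z hz => by
      rw [mem_ball_iff_norm] at hz ⊢
      convert hz using 2
      rw [hn]; push_cast; ring
    refine ⟨fun z => G i (z - n * T), (hG i).comp (by fun_prop) fun z hz => hsub (hmv z hz), fun x hx => ?_⟩
    have h1 := hGf i (x - n * T) (by push_cast; exact hsub (hmv _ hx))
    push_cast at h1
    simp only
    rw [h1, hP.sub_int_mul_eq]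
  choose H hH hHf using key
  have hloc : ∀ a b : ℝ, ∀ z ∈ ball (a:ℂ) δ, z ∈ ball (b:ℂ) δ → H a z = H b z := by
    intro a b z hza hzb
    have hre : ∀ c : ℝ, z ∈ ball (c:ℂ) δ → (z.re : ℂ) ∈ ball (c:ℂ) δ := fun c hc => by
      rw [mem_ball_iff_norm] at hc ⊢
      refine lt_of_le_of_lt ?_ hc
      have := abs_re_le_norm (z - c)
      rw [← ofReal_sub, norm_real]; simpa using this
    refine id_real (U := ball (a:ℂ) δ ∩ ball (b:ℂ) δ) (isOpen_ball.inter isOpen_ball) ((convex_ball _ _).inter (convex_ball _ _)).isPreconnected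
      ((hH a).mono inter_subset_left) ((hH b).mono inter_subset_right) ⟨hre a hza, hre b hzb⟩ ?_ ⟨hza, hzb⟩
    have : (fun x : ℝ => (x:ℂ)) ⁻¹' (ball (a:ℂ) δ ∩ ball (b:ℂ) δ) ∈ 𝓝 z.re :=
      continuous_ofReal.continuousAt.preimage_mem_nhds ((isOpen_ball.inter isOpen_ball).mem_nhds ⟨hre a hza, hre b hzb⟩)
    filter_upwards [this] with x hx
    rw [hHf a x hx.1, hHf b x hx.2]
  have hst : ∀ z ∈ strip δ, z ∈ ball (z.re : ℂ) δ := fun z hz => by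
    have : z - z.re = z.im * I := by apply Complex.ext <;> simp
    rw [mem_ball_iff_norm, this, norm_mul, norm_I, mul_one, norm_real]; exact hz
  have hF : DifferentiableOn ℂ (fun z => H z.re z) (strip δ) := fun z hz => by
    have h1 := (hH z.re).differentiableAt (isOpen_ball.mem_nhds (hst z hz))
    refine (h1.congr_of_eventuallyEq ?_).differentiableWithinAt
    filter_upwards [isOpen_ball.mem_nhds (hst z hz), (strip_open δ).mem_nhds hz] with y hy hy2
    exact hloc _ _ y (hst y hy2) hy
  have hFf : ∀ s : ℝ, H ((s:ℂ).re) s = f s := fun s => by rw [ofReal_re]; exact hHf s s (mem_ball_self hδ)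
  refine ⟨δ, hδ, fun z => H z.re z, hF, hFf, ?_⟩
  refine id_real (F := fun z => H (z + T).re (z + T)) (strip_open δ) (strip_convex δ).isPreconnected
    (hF.comp (f := fun z => z + (T:ℂ)) (by fun_prop) fun z hz => by simpa [strip] using hz) hF (s := 0) (real_strip hδ 0) (Eventually.of_forall fun x => ?_)
  have := hFf (x + T)
  push_cast at this
  rw [this, hper, hFf]
/-- Positively oriented strictly convex analytic closed plane curve. -/
structure Cv (T : ℝ) (w : ℝ → ℂ) : Prop where
  hT : 0 < T
  an : AnalyticOnNhd ℝ w univ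
  per : ∀ s, w (s + T) = w s
  J : ∀ s h, 0 < h → h < T → 0 < (conj (deriv w s) * (w (s + h) - w s)).im
  curv : ∀ s, 0 < (conj (deriv w s) * deriv (deriv w) s).im

def Om (w : ℝ → ℂ) : Set ℂ := {p | ∀ s, 0 < (conj (deriv w s) * (p - w s)).im}

lemma per_deriv {f : ℝ → ℂ} {T : ℝ} (h : ∀ s, f (s + T) = f s) (s : ℝ) : deriv f (s + T) = deriv f s := by
  rw [← deriv_comp_add_const]
  simp only [h]

lemma Ico_rep {T : ℝ} (hT : 0 < T) (a s : ℝ) : ∃ h ∈ Ico a (a + T), ∃ n : ℤ, s = h + n * T := by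
  refine ⟨_, toIcoMod_mem_Ico hT a s, toIcoDiv hT a s, ?_⟩
  have := toIcoMod_add_toIcoDiv_zsmul hT a s
  rw [zsmul_eq_mul] at this; exact this.symm

namespace Cv
variable {T : ℝ} {w : ℝ → ℂ}

lemma cont (C : Cv T w) : Continuous w := continuous_iff_continuousAt.2 fun s => (C.an s (mem_univ s)).continuousAt
lemma cont' (C : Cv T w) : Continuous (deriv w) := continuous_iff_continuousAt.2 fun s => (C.an s (mem_univ s)).deriv.continuousAt
lemma hd (C : Cv T w) (s : ℝ) : HasDerivAt w (deriv w s) s := (C.an s (mem_univ s)).differentiableAt.hasDerivAt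
lemma hd' (C : Cv T w) (s : ℝ) : HasDerivAt (deriv w) (deriv (deriv w) s) s := (C.an s (mem_univ s)).deriv.differentiableAt.hasDerivAt
lemma P (C : Cv T w) : Function.Periodic w T := C.per
lemma P' (C : Cv T w) : Function.Periodic (deriv w) T := per_deriv C.per

lemma ne (C : Cv T w) (s : ℝ) : deriv w s ≠ 0 := fun h => by simpa [h] using C.curv s

lemma Jpos (C : Cv T w) {s s' : ℝ} (h : ∀ n : ℤ, s' ≠ s + n * T) : 0 < (conj (deriv w s) * (w s' - w s)).im := by
  obtain ⟨r, hr, n, rfl⟩ := Ico_rep C.hT s s'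
  have h1 : r ≠ s := fun e => h n (by rw [e])
  rw [C.P.int_mul n r]
  have := C.J s (r - s) (sub_pos.2 (lt_of_le_of_ne hr.1 h1.symm)) (by linarith [hr.2])
  simpa using this

lemma Jnn (C : Cv T w) (s s' : ℝ) : 0 ≤ (conj (deriv w s) * (w s' - w s)).im := by
  by_cases h : ∃ n : ℤ, s' = s + n * T
  · obtain ⟨n, rfl⟩ := h
    rw [C.P.int_mul n s]; simp
  · push Not at h
    exact (C.Jpos h).le

lemma inj (C : Cv T w) {s s' : ℝ} (h : w s' = w s) : ∃ n : ℤ, s' = s + n * T := by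
  by_contra hc
  push Not at hc
  simpa [h] using C.Jpos hc

lemma mem_Om (C : Cv T w) (a : ℝ) {p : ℂ} (h : ∀ s ∈ Icc a (a + T), 0 < (conj (deriv w s) * (p - w s)).im) : p ∈ Om w := fun s => by
  obtain ⟨r, hr, n, rfl⟩ := Ico_rep C.hT a s
  rw [C.P.int_mul n r, C.P'.int_mul n r]
  exact h r ⟨hr.1, hr.2.le⟩

lemma open_Om (C : Cv T w) : IsOpen (Om w) := by
  rw [isOpen_iff_mem_nhds]
  intro p hp
  have h1 := C.cont; have h2 := C.cont'
  have := (isCompact_Icc (a := (0:ℝ)) (b := 0 + T)).eventually_forall_of_forall_eventually (x₀ := p)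
    (P := fun p s => 0 < (conj (deriv w s) * (p - w s)).im) fun s _ => by
      have hc : ContinuousAt (fun q : ℂ × ℝ => (conj (deriv w q.2) * (q.1 - w q.2)).im) (p, s) := by fun_prop
      exact hc.eventually (lt_mem_nhds (hp s))
  filter_upwards [this] with q hq using C.mem_Om 0 hq

lemma TC (C : Cv T w) {s₁ : ℝ} {v : ℂ} (hv : 0 < (conj (deriv w s₁) * v).im) :
    ∀ᶠ q : ℝ × ℂ in 𝓝 ((0:ℝ), v), 0 < q.1 → w s₁ + q.1 * q.2 ∈ Om w := by
  have h1 := C.cont; have h2 := C.cont'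
  have := (isCompact_Icc (a := s₁ - T / 2) (b := s₁ - T / 2 + T)).eventually_forall_of_forall_eventually (x₀ := ((0:ℝ), v))
    (P := fun q s => 0 < q.1 → 0 < (conj (deriv w s) * (w s₁ + q.1 * q.2 - w s)).im) fun s hs => by
      by_cases hss : s = s₁
      · subst hss
        have hc : ContinuousAt (fun q : (ℝ × ℂ) × ℝ => (conj (deriv w q.2) * q.1.2).im) ((0, v), s) := by fun_prop
        filter_upwards [hc.eventually (lt_mem_nhds hv)] with q hq hq0
        have e : (conj (deriv w q.2) * (w s + q.1.1 * q.1.2 - w q.2)).im =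
            (conj (deriv w q.2) * (w s - w q.2)).im + q.1.1 * (conj (deriv w q.2) * q.1.2).im := by
          rw [← im_ofReal_mul, ← add_im]; congr 1; ring
        rw [e]
        have := C.Jnn q.2 s
        positivity
      · have hc : ContinuousAt (fun q : (ℝ × ℂ) × ℝ => (conj (deriv w q.2) * (w s₁ + q.1.1 * q.1.2 - w q.2)).im) ((0, v), s) := by fun_prop
        have hT := C.hT
        have hp : 0 < (conj (deriv w s) * (w s₁ - w s)).im := C.Jpos fun n hn => by
          have e1 : (n:ℝ) * T < 1 * T := by linarith [hs.1, hs.2]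
          have e2 : (-1:ℝ) * T < n * T := by linarith [hs.1, hs.2]
          have e1 := lt_of_mul_lt_mul_right e1 hT.le
          have e2 := lt_of_mul_lt_mul_right e2 hT.le
          have : n = 0 := by
            have : n < 1 := by exact_mod_cast e1
            have : -1 < n := by exact_mod_cast e2
            omega
          subst this
          exact hss (by simpa using hn.symm)
        filter_upwards [hc.eventually (lt_mem_nhds (a := 0) (by simpa using hp))] with q hq _ using hq
  filter_upwards [this] with q hq hq0 using C.mem_Om _ fun s hs => hq s hs hq0

lemma convex_Om : Convex ℝ (Om w) := by
  have : Om w = ⋂ s, {p | (conj (deriv w s) * w s).im < (conj (deriv w s) * p).im} := by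
    ext p; simp [Om, mul_sub, sub_pos]
  rw [this]
  refine convex_iInter fun s => convex_halfSpace_gt ?_ _
  exact ⟨fun x y => by rw [mul_add, add_im], fun c x => by rw [real_smul, smul_eq_mul, ← im_ofReal_mul]; congr 1; ring⟩

lemma range_closure (C : Cv T w) (s : ℝ) : w s ∈ closure (Om w) := by
  have hv : 0 < (conj (deriv w s) * (I * deriv w s)).im := by
    have : conj (deriv w s) * (I * deriv w s) = I * (‖deriv w s‖ ^ 2 : ℝ) := by
      rw [← normSq_eq_norm_sq, ← mul_conj]; ring
    rw [this, im_mul_ofReal]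
    have := C.ne s
    simp [this]
  have h1 : Tendsto (fun e : ℝ => (e, I * deriv w s)) (𝓝[>] 0) (𝓝 ((0:ℝ), I * deriv w s)) :=
    (Continuous.tendsto' (by fun_prop) _ _ rfl).mono_left nhdsWithin_le_nhds
  have h2 : Tendsto (fun e : ℝ => w s + e * (I * deriv w s)) (𝓝[>] 0) (𝓝 (w s)) :=
    (Continuous.tendsto' (by fun_prop) _ _ (by simp)).mono_left nhdsWithin_le_nhds
  refine mem_closure_of_tendsto h2 ?_
  filter_upwards [h1.eventually (C.TC hv), self_mem_nhdsWithin] with e he he0 using he he0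

lemma nonempty_Om (C : Cv T w) : (Om w).Nonempty := closure_nonempty_iff.1 ⟨_, C.range_closure 0⟩

lemma closure_nn {p : ℂ} (hp : p ∈ closure (Om w)) (s : ℝ) : 0 ≤ (conj (deriv w s) * (p - w s)).im := by
  have : IsClosed {p | 0 ≤ (conj (deriv w s) * (p - w s)).im} := isClosed_le continuous_const (by fun_prop)
  exact this.closure_subset_iff.2 (fun q hq => (hq s).le) hp

lemma closure_cases (C : Cv T w) {p : ℂ} (hp : p ∈ closure (Om w)) : p ∈ Om w ∨ ∃ s, p = w s := by
  by_cases h : p ∈ Om w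
  · exact .inl h
  right
  simp only [Om, mem_ofPred_eq, not_forall, not_lt] at h
  obtain ⟨s, hs⟩ := h
  have h0 := le_antisymm hs (closure_nn hp s)
  refine ⟨s, ?_⟩
  have hne := C.ne s
  obtain ⟨l, hl⟩ : ∃ l : ℝ, p - w s = l * deriv w s := by
    refine ⟨((conj (deriv w s) * (p - w s)).re) / normSq (deriv w s), ?_⟩
    have e1 : conj (deriv w s) * (p - w s) = ((conj (deriv w s) * (p - w s)).re : ℝ) := by
      apply Complex.ext <;> simp only [ofReal_re, ofReal_im, h0]
    have e2 : conj (deriv w s) ≠ 0 := by simpa using hne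
    push_cast
    rw [← e1, ← mul_conj]
    field_simp
  have hmin : IsLocalMin (fun s => (conj (deriv w s) * (p - w s)).im) s := Eventually.of_forall fun s' => by
    simp only [h0]; exact closure_nn hp s'
  have hder : HasDerivAt (fun s => (conj (deriv w s) * (p - w s)).im)
      (conj (deriv (deriv w) s) * (p - w s) + conj (deriv w s) * (0 - deriv w s)).im s := by
    have a1 := (conjCLE.toContinuousLinearMap.hasFDerivAt.comp_hasDerivAt s (C.hd' s)).mul (((hasDerivAt_const s p).sub (C.hd s)))
    exact imCLM.hasFDerivAt.comp_hasDerivAt s a1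
  have e := hmin.hasDerivAt_eq_zero hder
  rw [hl, add_im, zero_sub, mul_neg, neg_im, mul_comm (conj (deriv w s)), mul_conj, ofReal_im, neg_zero, add_zero] at e
  have e3 : (conj (deriv (deriv w) s) * (l * deriv w s)).im = - l * (conj (deriv w s) * deriv (deriv w) s).im := by
    simp; ring
  rw [e3] at e
  have := (C.curv s).ne'
  have hl0 : l = 0 := by
    rcases mul_eq_zero.1 e with h | h
    · linarith
    · exact absurd h this
  rw [hl0] at hl
  simpa [sub_eq_zero] using hl

lemma not_mem (s : ℝ) : w s ∉ Om w := fun h => by simpa using h s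

lemma frontier_Om (C : Cv T w) : frontier (Om w) = range w := by
  ext p
  rw [frontier, C.open_Om.interior_eq]
  constructor
  · rintro ⟨h1, h2⟩
    obtain h | ⟨s, rfl⟩ := C.closure_cases h1
    · exact absurd h h2
    · exact mem_range_self s
  · rintro ⟨s, rfl⟩
    exact ⟨C.range_closure s, not_mem s⟩

lemma bounded_Om (C : Cv T w) : Bornology.IsBounded (Om w) := by
  have h1 := C.cont
  obtain ⟨M, hM⟩ : ∃ M, ∀ s, ‖w s‖ ≤ M := by
    obtain ⟨s₀, _, hs₀⟩ := (isCompact_Icc (a := (0:ℝ)) (b := 0 + T)).exists_isMaxOn (f := fun s => ‖w s‖) ⟨0, by simp [C.hT.le]⟩ (by fun_prop)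
    refine ⟨‖w s₀‖, fun s => ?_⟩
    obtain ⟨r, hr, n, rfl⟩ := Ico_rep C.hT 0 s
    rw [C.P.int_mul n r]; exact hs₀ ⟨hr.1, hr.2.le⟩
  refine isBounded_iff_forall_norm_le.2 ⟨M, fun p hp => ?_⟩
  by_cases hp0 : p = 0
  · rw [hp0, norm_zero]; exact (norm_nonneg _).trans (hM 0)
  obtain ⟨s, _, hs⟩ := (isCompact_Icc (a := (0:ℝ)) (b := 0 + T)).exists_isMaxOn (f := fun s => (conj p * w s).re) ⟨0, by simp [C.hT.le]⟩ (by fun_prop)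
  have hs : ∀ s', (conj p * w s').re ≤ (conj p * w s).re := fun s' => by
    obtain ⟨r, hr, n, rfl⟩ := Ico_rep C.hT 0 s'
    rw [C.P.int_mul n r]; exact hs ⟨hr.1, hr.2.le⟩
  have hd : HasDerivAt (fun s => (conj p * w s).re) (conj p * deriv w s).re s :=
    reCLM.hasFDerivAt.comp_hasDerivAt s ((C.hd s).const_mul (conj p))
  have e := IsLocalMax.hasDerivAt_eq_zero (Eventually.of_forall hs) hd
  -- conj p * w' = i m
  set m := (conj p * deriv w s).im with hm
  have e1 : conj p * deriv w s = m * I := by apply Complex.ext <;> simp [e, hm]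
  have e2 : ∀ q : ℂ, normSq p * (conj (deriv w s) * q).im = - m * (conj p * q).re := fun q => by
    have : (normSq p : ℂ) * (conj (deriv w s) * q) = conj (conj p * deriv w s) * (conj p * q) := by
      rw [← mul_conj, map_mul, conj_conj]; ring
    rw [← im_ofReal_mul, this, e1]; simp
  have hn : 0 < normSq p := normSq_pos.2 hp0
  have hT := C.hT
  have e3 := C.J s (T / 2) (by linarith) (by linarith)
  have e4 := e2 (w (s + T/2) - w s)
  have e5 := hs (s + T/2)
  rw [mul_sub (conj p), sub_re] at e4
  have e6 : 0 < m := by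
    by_contra hc
    push Not at hc
    nlinarith [mul_pos hn e3, mul_nonneg (neg_nonneg.2 hc) (sub_nonneg.2 e5)]
  have e7 := e2 (p - w s)
  have e8 := mul_pos hn (hp s)
  rw [e7, mul_sub, sub_re, mul_comm (conj p) p, mul_conj, ofReal_re] at e8
  have e9 : normSq p < (conj p * w s).re := by nlinarith
  have e10 := (re_le_norm (conj p * w s))
  rw [norm_mul, norm_conj] at e10
  rw [normSq_eq_norm_sq] at e9
  have e11 : 0 < ‖p‖ := norm_pos_iff.2 hp0
  have e12 : ‖p‖ < ‖w s‖ := by nlinarith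
  exact e12.le.trans (hM s)

lemma compact_cl (C : Cv T w) : IsCompact (closure (Om w)) := C.bounded_Om.isCompact_closure

end Cv
lemma rad_joint {U : Set ℂ} (hcv : Convex ℝ U) {h : ℂ → ℂ} (hh : ContinuousOn h U) (n : ℕ) :
    ContinuousOn (fun q : ℂ × ℂ => rad q.1 n h q.2) (U ×ˢ U) := by
  rw [continuousOn_iff_continuous_domRestrict]
  let pr : ℝ → ℝ := fun l => (projIcc 0 1 zero_le_one l : ℝ)
  have hpr : Continuous pr := continuous_subtype_val.comp continuous_projIcc
  have h1 : Continuous fun x : ((U ×ˢ U : Set (ℂ × ℂ)) × ℝ) => h (x.1.1.1 + pr x.2 * (x.1.1.2 - x.1.1.1)) :=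
    hh.comp_continuous (by fun_prop) fun x => seg_mem hcv x.1.2.1 x.1.2.2 (projIcc 0 1 zero_le_one x.2).2
  have h2 := intervalIntegral.continuous_parametric_intervalIntegral_of_continuous' (μ := volume)
    (f := fun (x : (U ×ˢ U : Set (ℂ × ℂ))) (l : ℝ) => (l:ℂ) ^ n * h (x.1.1 + pr l * (x.1.2 - x.1.1))) (by
      simp only [Function.uncurry_def]
      exact Continuous.mul (by fun_prop) h1) 0 1
  refine h2.congr fun x => intervalIntegral.integral_congr fun l hl => ?_
  rw [uIcc_of_le zero_le_one] at hl
  have : pr l = l := by simp only [pr, projIcc_of_mem zero_le_one hl]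
  simp only [this]

lemma rad_diff_c {U : Set ℂ} (hU : IsOpen U) (hcv : Convex ℝ U) {h : ℂ → ℂ} (hh : DifferentiableOn ℂ h U) (n : ℕ) {z : ℂ} (hz : z ∈ U) :
    DifferentiableOn ℂ (fun ζ => rad ζ n h z) U := by
  have hm : ∀ l ∈ uIcc (0:ℝ) 1, ∀ ζ ∈ U, ζ + l * (z - ζ) ∈ U := fun l hl ζ hζ => by
    rw [uIcc_of_le zero_le_one] at hl; exact seg_mem hcv hζ hz hl
  refine differentiableOn_param hU (F := fun ζ l => (l:ℂ)^n * h (ζ + l * (z - ζ))) ?_ fun l hl => ?_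
  · simp only [Function.uncurry_def]
    exact ContinuousOn.mul (by fun_prop) (hh.continuousOn.comp (by fun_prop) fun q hq => hm _ hq.2 _ hq.1)
  · exact (hh.comp (by fun_prop) fun ζ hζ => hm l hl ζ hζ).const_mul _

lemma rad_ftc {U : Set ℂ} (hU : IsOpen U) (hcv : Convex ℝ U) {W : ℂ → ℂ} (hW : DifferentiableOn ℂ W U) {ζ z : ℂ} (hζ : ζ ∈ U) (hz : z ∈ U) :
    (z - ζ) * rad ζ 0 (deriv W) z = W z - W ζ := by
  have hm : ∀ l ∈ uIcc (0:ℝ) 1, ζ + l * (z - ζ) ∈ U := fun l hl => by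
    rw [uIcc_of_le zero_le_one] at hl; exact seg_mem hcv hζ hz hl
  have := intervalIntegral.integral_eq_sub_of_hasDerivAt (a := 0) (b := 1) (f := fun l : ℝ => W (ζ + l * (z - ζ)))
    (f' := fun l : ℝ => deriv W (ζ + l * (z - ζ)) * (1 * (z - ζ))) (fun l hl => by
      have h1 := (hW.differentiableAt (hU.mem_nhds (hm l hl))).hasDerivAt
      exact h1.comp l ((ofRealCLM.hasDerivAt (x := l)).mul_const _ |>.const_add ζ)) (by
      apply ContinuousOn.intervalIntegrable
      exact ((hW.deriv hU).continuousOn.comp (by fun_prop) hm).mul continuousOn_const)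
  simp only [intervalIntegral.integral_mul_const] at this
  simp only [rad, pow_zero, one_mul] at this ⊢
  simp at this
  rw [← this]; ring

/-- holomorphic extension data -/
structure Ex (T : ℝ) (f : ℝ → ℂ) (δ : ℝ) (F : ℂ → ℂ) : Prop where
  pos : 0 < δ
  diff : DifferentiableOn ℂ F (strip δ)
  eq : ∀ s : ℝ, F s = f s
  per : ∀ z ∈ strip δ, F (z + T) = F z

def qq (W : ℂ → ℂ) (ζ z : ℂ) : ℂ := rad ζ 0 (deriv W) z
def RR (W : ℂ → ℂ) (ζ z : ℂ) : ℂ := rad ζ 1 (deriv (deriv W)) z / qq W ζ z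

lemma exists_Ex {f : ℝ → ℂ} (hf : AnalyticOnNhd ℝ f univ) {T : ℝ} (hT : 0 < T) (hper : ∀ s, f (s + T) = f s) : ∃ δ F, Ex T f δ F := by
  obtain ⟨δ, h1, F, h2, h3, h4⟩ := P1 hf hT hper
  exact ⟨δ, F, h1, h2, h3, h4⟩

lemma strip_add {δ : ℝ} {z : ℂ} (s : ℝ) : z + s ∈ strip δ ↔ z ∈ strip δ := by simp [strip]

namespace Ex
variable {T δ : ℝ} {f : ℝ → ℂ} {F : ℂ → ℂ}
lemma diff' (E : Ex T f δ F) : DifferentiableOn ℂ (deriv F) (strip δ) := E.diff.deriv (strip_open δ)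
lemma diff'' (E : Ex T f δ F) : DifferentiableOn ℂ (deriv (deriv F)) (strip δ) := E.diff'.deriv (strip_open δ)
lemma hd (E : Ex T f δ F) {z : ℂ} (hz : z ∈ strip δ) : HasDerivAt F (deriv F z) z := (E.diff.differentiableAt ((strip_open δ).mem_nhds hz)).hasDerivAt
lemma hd' (E : Ex T f δ F) {z : ℂ} (hz : z ∈ strip δ) : HasDerivAt (deriv F) (deriv (deriv F) z) z := (E.diff'.differentiableAt ((strip_open δ).mem_nhds hz)).hasDerivAt
lemma deq (E : Ex T f δ F) (s : ℝ) : deriv F s = deriv f s := by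
  have := (E.hd (real_strip E.pos s)).comp_ofReal
  simp only [E.eq] at this
  exact this.deriv.symm
lemma deq' (E : Ex T f δ F) (s : ℝ) : deriv (deriv F) s = deriv (deriv f) s := by
  have := (E.hd' (real_strip E.pos s)).comp_ofReal
  simp only [E.deq] at this
  exact this.deriv.symm
lemma per' (E : Ex T f δ F) : ∀ z ∈ strip δ, deriv F (z + T) = deriv F z := fun z hz => by
  rw [← deriv_comp_add_const]
  refine EventuallyEq.deriv_eq ?_
  filter_upwards [(strip_open δ).mem_nhds hz] with y hy using E.per y hy
lemma per'' (E : Ex T f δ F) : ∀ z ∈ strip δ, deriv (deriv F) (z + T) = deriv (deriv F) z := fun z hz => by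
  rw [← deriv_comp_add_const]
  refine EventuallyEq.deriv_eq ?_
  filter_upwards [(strip_open δ).mem_nhds hz] with y hy using E.per' y hy

lemma rad_per {h : ℂ → ℂ} (hp : ∀ z ∈ strip δ, h (z + T) = h z) (n : ℕ) {ζ z : ℂ} (hζ : ζ ∈ strip δ) (hz : z ∈ strip δ) :
    rad (ζ + T) n h (z + T) = rad ζ n h z := by
  refine intervalIntegral.integral_congr fun l hl => ?_
  rw [uIcc_of_le zero_le_one] at hl
  beta_reduce
  rw [← hp _ (seg_mem (strip_convex δ) hζ hz hl)]
  congr 2; ring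

lemma qq_ftc (E : Ex T f δ F) {ζ z : ℂ} (hζ : ζ ∈ strip δ) (hz : z ∈ strip δ) : (z - ζ) * qq F ζ z = F z - F ζ :=
  rad_ftc (strip_open δ) (strip_convex δ) E.diff hζ hz
lemma qq_cont (E : Ex T f δ F) : ContinuousOn (fun q : ℂ × ℂ => qq F q.1 q.2) (strip δ ×ˢ strip δ) :=
  rad_joint (strip_convex δ) E.diff'.continuousOn 0
lemma qq_deriv (E : Ex T f δ F) {ζ z : ℂ} (hζ : ζ ∈ strip δ) (hz : z ∈ strip δ) :
    HasDerivAt (qq F ζ) (rad ζ 1 (deriv (deriv F)) z) z ∧ (z - ζ) * rad ζ 1 (deriv (deriv F)) z + qq F ζ z = deriv F z := by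
  have := rad_hasDerivAt (strip_open δ) (strip_convex δ) hζ E.diff' 0 hz
  simp only [Nat.cast_zero, zero_add, one_mul] at this
  exact this
lemma qq_self (ζ : ℂ) : qq F ζ ζ = deriv F ζ := by simp [qq, rad]
lemma RR_cont (E : Ex T f δ F) : ContinuousOn (fun q : ℂ × ℂ => RR F q.1 q.2) ((strip δ ×ˢ strip δ) ∩ {q | qq F q.1 q.2 ≠ 0}) :=
  ((rad_joint (strip_convex δ) E.diff''.continuousOn 1).mono inter_subset_left).div (E.qq_cont.mono inter_subset_left) fun q hq => hq.2
lemma RR_eq (E : Ex T f δ F) {ζ z : ℂ} (hζ : ζ ∈ strip δ) (hz : z ∈ strip δ) (hne : z ≠ ζ) (hq : qq F ζ z ≠ 0) :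
    deriv F z / (F z - F ζ) = 1 / (z - ζ) + RR F ζ z := by
  rw [← E.qq_ftc hζ hz, ← (E.qq_deriv hζ hz).2, RR]
  have := sub_ne_zero.2 hne
  field_simp; ring
end Ex

namespace Cv
variable {T δ : ℝ} {w : ℝ → ℂ} {W : ℂ → ℂ}

lemma BB_sign (C : Cv T w) (E : Ex T w δ W) {s τ : ℝ} (h1 : -T < τ) (h2 : τ < T) :
    (0 < τ → 0 < (conj (deriv w s) * qq W s (s + τ : ℝ)).im) ∧ (τ < 0 → (conj (deriv w s) * qq W s (s + τ : ℝ)).im < 0) ∧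
    conj (deriv w s) * qq W s (s + τ : ℝ) ∈ slitPlane ∧ qq W s (s + τ : ℝ) ≠ 0 := by
  have e := E.qq_ftc (real_strip E.pos s) (real_strip E.pos (s + τ))
  rw [E.eq, E.eq, ← ofReal_sub, add_sub_cancel_left] at e
  have e2 : (conj (deriv w s) * (w (s + τ) - w s)).im = τ * (conj (deriv w s) * qq W s (s + τ : ℝ)).im := by
    rw [← e, ← im_ofReal_mul]; congr 1; ring
  have hJ : τ ≠ 0 → 0 < (conj (deriv w s) * (w (s + τ) - w s)).im := fun h0 => C.Jpos fun n hn => by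
    have hT := C.hT
    have e1 : (n:ℝ) * T < 1 * T := by linarith
    have e2 : (-1:ℝ) * T < n * T := by linarith
    have e1 := lt_of_mul_lt_mul_right e1 hT.le
    have e2 := lt_of_mul_lt_mul_right e2 hT.le
    have : n = 0 := by
      have : n < 1 := by exact_mod_cast e1
      have : -1 < n := by exact_mod_cast e2
      omega
    subst this
    exact h0 (by simpa using hn)
  rw [e2] at hJ
  have p1 : 0 < τ → 0 < (conj (deriv w s) * qq W s (s + τ : ℝ)).im := fun h => pos_of_mul_pos_right (hJ h.ne') h.le
  have p2 : τ < 0 → (conj (deriv w s) * qq W s (s + τ : ℝ)).im < 0 := fun h => neg_of_mul_pos_right (hJ h.ne) h.le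
  have p3 : conj (deriv w s) * qq W s (s + τ : ℝ) ∈ slitPlane := by
    rcases lt_trichotomy τ 0 with h | h | h
    · exact .inr (p2 h).ne
    · left
      rw [h, add_zero, Ex.qq_self, E.deq, mul_comm, mul_conj, ofReal_re]
      exact normSq_pos.2 (C.ne s)
    · exact .inr (p1 h).ne'
  exact ⟨p1, p2, p3, right_ne_zero_of_mul (slitPlane_ne_zero p3)⟩

lemma RR_pos (C : Cv T w) (E : Ex T w δ W) {s τ : ℝ} (h1 : -T < τ) (h2 : τ < T) : 0 < (RR W s (s + τ : ℝ)).im := by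
  have hq := (C.BB_sign E h1 h2 (s := s)).2.2.2
  by_cases h0 : τ = 0
  · rw [RR, h0, add_zero, Ex.qq_self, E.deq]
    have : rad (s:ℂ) 1 (deriv (deriv W)) s = (1/2 : ℝ) * deriv (deriv w) s := by
      have : ∫ x in (0:ℝ)..1, (x:ℂ) = (1/2 : ℝ) := by rw [intervalIntegral.integral_ofReal, integral_id]; norm_num
      simp [rad, E.deq', this]
    rw [this, mul_div_assoc, im_ofReal_mul]
    refine mul_pos (by norm_num) ?_
    have e : deriv (deriv w) s / deriv w s = ((normSq (deriv w s))⁻¹ : ℝ) * (conj (deriv w s) * deriv (deriv w) s) := by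
      rw [div_eq_mul_inv, inv_def]; ring
    rw [e, im_ofReal_mul]
    exact mul_pos (inv_pos.2 (normSq_pos.2 (C.ne s))) (C.curv s)
  · have e := E.RR_eq (real_strip E.pos s) (real_strip E.pos (s + τ)) (by simpa using h0) hq
    have hb := (C.BB_sign E (s := s + τ) (τ := -τ) (by linarith) (by linarith))
    rw [add_neg_cancel_right] at hb
    have e3 := E.qq_ftc (real_strip E.pos (s + τ)) (real_strip E.pos s)
    have e2 : (RR W s (s + τ : ℝ)).im = (deriv W (s + τ : ℝ) / (W (s + τ : ℝ) - W s)).im := by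
      rw [e, add_im, ← ofReal_sub, ← ofReal_one, ← ofReal_div, ofReal_im, zero_add]
    rw [e2, ← neg_sub (W s), ← e3, E.deq]
    set q := qq W (s + τ : ℝ) s with hqd
    have e4 : deriv w (s + τ) / -(((s:ℂ) - (s + τ : ℝ)) * q) = ((τ * normSq q)⁻¹ : ℝ) * (conj (conj (deriv w (s + τ)) * q)) := by
      have : (s:ℂ) - (s + τ : ℝ) = - τ := by push_cast; ring
      rw [this, map_mul, conj_conj]
      push_cast
      rw [← mul_conj]
      have a1 : conj q ≠ 0 := by simpa using hb.2.2.2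
      have a2 := hb.2.2.2
      have a3 : (τ:ℂ) ≠ 0 := by exact_mod_cast h0
      field_simp
    have hn := normSq_pos.2 hb.2.2.2
    rw [e4, im_ofReal_mul, conj_im]
    rcases lt_or_gt_of_ne h0 with h | h
    · have := hb.1 (by linarith)
      exact mul_pos_of_neg_of_neg (inv_lt_zero.2 (mul_neg_of_neg_of_pos h hn)) (by linarith)
    · have := hb.2.1 (by linarith)
      exact mul_pos (inv_pos.2 (mul_pos h hn)) (by linarith)

lemma ct (C : Cv T w) (E : Ex T w δ W) : ContinuousOn (fun q : ℝ × ℝ => RR W q.1 (q.1 + q.2 : ℝ)) (univ ×ˢ Ioo (-T) T) :=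
  E.RR_cont.comp (f := fun q : ℝ × ℝ => ((q.1 : ℂ), ((q.1 + q.2 : ℝ):ℂ))) (by fun_prop) fun q hq =>
    ⟨⟨real_strip E.pos _, real_strip E.pos _⟩, (C.BB_sign E hq.2.1 hq.2.2).2.2.2⟩

lemma RR_int (C : Cv T w) (E : Ex T w δ W) (s : ℝ) : ∫ τ in (-(T/2))..(T/2), RR W s (s + τ : ℝ) = Real.pi * I := by
  have hT := C.hT
  have hsub : ∀ τ ∈ uIcc (-(T/2)) (T/2), -T < τ ∧ τ < T := fun τ hτ => by
    rw [uIcc_of_le (by linarith)] at hτ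
    exact ⟨by linarith [hτ.1], by linarith [hτ.2]⟩
  have h := intervalIntegral.integral_eq_sub_of_hasDerivAt (a := -(T/2)) (b := T/2) (f := fun τ : ℝ => Complex.log (conj (deriv w s) * qq W s (s + τ : ℝ)))
    (f' := fun τ : ℝ => RR W s (s + τ : ℝ)) (fun τ hτ => by
      have hb := C.BB_sign E (s := s) (hsub τ hτ).1 (hsub τ hτ).2
      have h1 := (E.qq_deriv (real_strip E.pos s) (real_strip E.pos (s + τ))).1
      have h2 : HasDerivAt (fun τ : ℝ => ((s + τ : ℝ) : ℂ)) 1 τ := by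
        have := ((hasDerivAt_id τ).const_add s).ofReal_comp
        simpa using this
      have h3 := ((h1.comp τ h2).const_mul (conj (deriv w s))).clog_real hb.2.2.1
      rw [mul_one, mul_div_mul_left _ _ ((map_ne_zero _).2 (C.ne s))] at h3
      exact h3) (by
      apply ContinuousOn.intervalIntegrable
      exact (C.ct E).comp (f := fun τ => (s, τ)) (by fun_prop) fun τ hτ => ⟨mem_univ _, (hsub τ hτ).1, (hsub τ hτ).2⟩)
  rw [h]
  have hb := (C.BB_sign E (s := s) (τ := T/2) (by linarith) (by linarith)).1 (by linarith)
  have e1 := E.qq_ftc (real_strip E.pos s) (real_strip E.pos (s + T/2))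
  have e2 := E.qq_ftc (real_strip E.pos s) (real_strip E.pos (s + -(T/2)))
  have e3 : w (s + T/2) = w (s + -(T/2)) := by rw [← C.per (s + -(T/2))]; congr 1; ring
  rw [E.eq, E.eq] at e1 e2
  rw [e3, ← e2] at e1
  have e4 : qq W s (s + -(T/2) : ℝ) = - qq W s (s + T/2 : ℝ) := by
    have : (T:ℂ)/2 ≠ 0 := by simpa using hT.ne'
    have a1 : ((s + T/2 : ℝ):ℂ) - s = T/2 := by push_cast; ring
    have a2 : ((s + -(T/2) : ℝ):ℂ) - s = -(T/2) := by push_cast; ring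
    rw [a1, a2] at e1
    refine mul_left_cancel₀ this ?_
    linear_combination e1
  rw [e4, mul_neg, log, log, norm_neg, arg_neg_eq_arg_sub_pi_of_im_pos hb]
  push_cast; ring
end Cv
lemma per_bdd {T : ℝ} (hT : 0 < T) {g : ℝ → ℝ} (hg : Continuous g) (hgp : ∀ s, g (s + T) = g s) : ∃ B, ∀ s, |g s| ≤ B := by
  have h1 : Function.Periodic g T := hgp
  obtain ⟨B, hB⟩ := (h1.isBounded_of_continuous hT.ne' hg).exists_norm_le
  exact ⟨B, fun s => hB _ (mem_range_self s)⟩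

lemma solve_int {T : ℝ} (hT : 0 < T) {k : ℝ → ℝ → ℝ} (hk : Continuous (Function.uncurry k)) (hper : ∀ s τ, k (s+T) τ = k s τ)
    (hpos : ∀ s τ, 0 < k s τ) (hint : ∀ s, ∫ τ in (-(T/2))..(T/2), k s τ = 1) {g : ℝ → ℝ} (hg : Continuous g) (hgp : ∀ s, g (s + T) = g s) :
    ∃ μ : ℝ → ℝ, Continuous μ ∧ (∀ s, μ (s+T) = μ s) ∧ ∀ s, μ s + ∫ τ in (-(T/2))..(T/2), k s τ * μ (s+τ) = 2 * g s := by
  have hab : -(T/2) ≤ T/2 := by linarith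
  obtain ⟨c, hc0, hc⟩ : ∃ c, 0 < c ∧ ∀ s, ∀ τ ∈ Icc (-(T/2)) (T/2), c ≤ k s τ := by
    have hK : IsCompact (Icc 0 T ×ˢ Icc (-(T/2)) (T/2)) := isCompact_Icc.prod isCompact_Icc
    obtain ⟨q, hq, hm⟩ := hK.exists_isMinOn ⟨(0, 0), ⟨le_rfl, hT.le⟩, by constructor <;> linarith⟩ hk.continuousOn
    refine ⟨_, hpos q.1 q.2, fun s τ hτ => ?_⟩
    obtain ⟨h, hh, n, rfl⟩ := Ico_rep hT 0 s
    have hp : Function.Periodic (fun s => k s τ) T := fun s => hper s τ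
    have : k (h + n * T) τ = k h τ := hp.int_mul n h
    rw [this]
    exact hm (show (h, τ) ∈ _ from ⟨⟨hh.1, by linarith [hh.2]⟩, hτ⟩)
  have hks : ∀ s, Continuous (k s) := fun s => hk.comp (by fun_prop : Continuous fun τ => (s, τ))
  have hint' : ∀ s, ∫ τ in (-(T/2))..(T/2), (k s τ - c) = 1 - c * T := fun s => by
    rw [intervalIntegral.integral_sub ((hks s).intervalIntegrable _ _) (by simp), hint]; simp; ring
  have hest : ∀ (s : ℝ) (v : ℝ → ℝ) (B : ℝ), (∀ x, |v x| ≤ B) → |∫ τ in (-(T/2))..(T/2), (k s τ - c) * v (s + τ)| ≤ (1 - c * T) * B := fun s v B hv => by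
    rw [← hint' s, ← intervalIntegral.integral_mul_const]
    rw [← Real.norm_eq_abs]
    refine intervalIntegral.norm_integral_le_of_norm_le hab (Eventually.of_forall fun τ hτ => ?_) (((hks s).sub continuous_const).mul continuous_const |>.intervalIntegrable _ _)
    have := hc s τ ⟨hτ.1.le, hτ.2⟩
    rw [norm_mul, Real.norm_eq_abs, abs_of_nonneg (by linarith)]
    exact mul_le_mul_of_nonneg_left (hv _) (by linarith)
  have hcT : 0 ≤ 1 - c * T := by
    rw [← hint' 0]
    exact intervalIntegral.integral_nonneg hab fun τ hτ => by linarith [hc 0 τ hτ]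
  obtain ⟨G, hG⟩ := per_bdd hT hg hgp
  have hcont : ∀ v : ℝ → ℝ, Continuous v → Continuous fun s => ∫ τ in (-(T/2))..(T/2), (k s τ - c) * v (s + τ) := fun v hv => by
    refine intervalIntegral.continuous_parametric_intervalIntegral_of_continuous' ?_ _ _
    simp only [Function.uncurry_def]
    have : Continuous fun a : ℝ × ℝ => k a.1 a.2 := hk
    exact (this.sub continuous_const).mul (hv.comp (by fun_prop))
  let Φ : BoundedContinuousFunction ℝ ℝ → BoundedContinuousFunction ℝ ℝ := fun v =>
    BoundedContinuousFunction.ofNormedAddCommGroup (fun s => 2 * g s - ∫ τ in (-(T/2))..(T/2), (k s τ - c) * v (s + τ))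
      ((continuous_const.mul hg).sub (hcont v v.continuous)) (2 * G + (1 - c * T) * ‖v‖) fun s => by
        have h1 := hest s v ‖v‖ fun x => v.norm_coe_le_norm x
        have h2 := hG s
        rw [Real.norm_eq_abs]
        refine (abs_sub _ _).trans ?_
        rw [abs_mul, abs_of_pos (two_pos : (0:ℝ) < 2)]
        linarith
  have hΦ : ContractingWith (Real.toNNReal (1 - c * T)) Φ := by
    refine ⟨Real.toNNReal_lt_one.2 (by linarith [mul_pos hc0 hT]), LipschitzWith.of_dist_le_mul fun v v' => ?_⟩
    refine (BoundedContinuousFunction.dist_le (by positivity)).2 fun s => ?_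
    have h1 := hest s (fun x => v x - v' x) (dist v v') fun x => by
      rw [← Real.dist_eq]; exact BoundedContinuousFunction.dist_coe_le_dist x
    have h2 : ∀ v : BoundedContinuousFunction ℝ ℝ, IntervalIntegrable (fun τ => (k s τ - c) * v (s + τ)) volume (-(T/2)) (T/2) := fun v =>
      (((hks s).sub continuous_const).mul (v.continuous.comp (by fun_prop))).intervalIntegrable _ _
    rw [Real.dist_eq, abs_sub_comm]
    simp only [mul_sub] at h1
    rw [intervalIntegral.integral_sub (h2 v) (h2 v')] at h1
    rw [Real.coe_toNNReal _ hcT]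
    convert h1 using 2
    simp [Φ]
  let ν := hΦ.fixedPoint
  have hν : ∀ s, 2 * g s - ∫ τ in (-(T/2))..(T/2), (k s τ - c) * ν (s + τ) = ν s := fun s => by
    have : Φ ν = ν := hΦ.fixedPoint_isFixedPt
    exact DFunLike.congr_fun this s
  have hνp : ∀ s, ν (s + T) = ν s := by
    let ν' : BoundedContinuousFunction ℝ ℝ := ν.compContinuous ⟨fun s => s + T, by fun_prop⟩
    have : Φ ν' = ν' := by
      ext s
      change 2 * g s - ∫ τ in (-(T/2))..(T/2), (k s τ - c) * ν (s + τ + T) = ν (s + T)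
      rw [← hν (s + T), hgp]
      simp only [hper, add_right_comm]
    have : ν' = ν := hΦ.fixedPoint_unique this
    exact fun s => DFunLike.congr_fun this s
  have hI : ∀ s, ∫ τ in (-(T/2))..(T/2), ν (s + τ) = ∫ τ in (0:ℝ)..T, ν τ := fun s => by
    rw [intervalIntegral.integral_comp_add_left (fun x => ν x)]
    have hp : Function.Periodic ν T := hνp
    have := hp.intervalIntegral_add_eq (s + -(T/2)) 0
    rw [zero_add] at this
    rw [← this]; congr 1; ring
  set J := ∫ τ in (0:ℝ)..T, ν τ
  refine ⟨fun s => ν s - c * J / 2, ν.continuous.sub continuous_const, fun s => by simp [hνp], fun s => ?_⟩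
  have i1 : IntervalIntegrable (fun τ => k s τ * ν (s + τ)) volume (-(T/2)) (T/2) := ((hks s).mul (ν.continuous.comp (by fun_prop))).intervalIntegrable _ _
  have i2 : IntervalIntegrable (fun τ => c * ν (s + τ)) volume (-(T/2)) (T/2) := (continuous_const.mul (ν.continuous.comp (by fun_prop))).intervalIntegrable _ _
  have i3 : IntervalIntegrable (fun τ => k s τ * (c * J / 2)) volume (-(T/2)) (T/2) := ((hks s).mul continuous_const).intervalIntegrable _ _
  have := hν s
  simp only [sub_mul, mul_sub] at this ⊢
  rw [intervalIntegral.integral_sub i1 i2, intervalIntegral.integral_const_mul, hI] at this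
  rw [intervalIntegral.integral_sub i1 i3, intervalIntegral.integral_mul_const, hint]
  linarith
namespace Cv
variable {T δ : ℝ} {w : ℝ → ℂ} {W : ℂ → ℂ}

/-- the double layer kernel -/
lemma solve_cont (C : Cv T w) (E : Ex T w δ W) {g : ℝ → ℝ} (hg : Continuous g) (hgp : ∀ s, g (s + T) = g s) :
    ∃ μ : ℝ → ℝ, Continuous μ ∧ (∀ s, μ (s+T) = μ s) ∧
      ∀ s, μ s + Real.pi⁻¹ * ∫ τ in (-(T/2))..(T/2), (RR W s (s + τ : ℝ)).im * μ (s+τ) = 2 * g s := by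
  have hT := C.hT
  have hab : -(T/2) ≤ T/2 := by linarith
  let pr : ℝ → ℝ := fun l => (projIcc _ _ hab l : ℝ)
  have hpr : Continuous pr := continuous_subtype_val.comp continuous_projIcc
  have hpm : ∀ τ, -T < pr τ ∧ pr τ < T := fun τ => by
    have := (projIcc _ _ hab τ).2
    exact ⟨by linarith [this.1], by linarith [this.2]⟩
  have hpe : ∀ τ ∈ Icc (-(T/2)) (T/2), pr τ = τ := fun τ hτ => by simp only [pr, projIcc_of_mem hab hτ]
  have hcR : Continuous fun q : ℝ × ℝ => RR W q.1 (q.1 + pr q.2 : ℝ) :=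
    (C.ct E).comp_continuous (f := fun q : ℝ × ℝ => (q.1, pr q.2)) (by fun_prop) fun q => ⟨mem_univ _, hpm q.2⟩
  obtain ⟨μ, h1, h2, h3⟩ := solve_int hT (k := fun s τ => Real.pi⁻¹ * (RR W s (s + pr τ : ℝ)).im)
    (by
      simp only [Function.uncurry_def]
      exact continuous_const.mul (continuous_im.comp hcR))
    (fun s τ => by
      have e1 : ((s + T : ℝ):ℂ) = s + T := by push_cast; ring
      have e2 : ((s + T + pr τ : ℝ):ℂ) = (s + pr τ : ℝ) + T := by push_cast; ring
      have a1 := Ex.rad_per E.per' 0 (real_strip E.pos s) (real_strip E.pos (s + pr τ))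
      have a2 := Ex.rad_per E.per'' 1 (real_strip E.pos s) (real_strip E.pos (s + pr τ))
      simp only [RR, qq]
      rw [e1, e2, a1, a2])
    (fun s τ => mul_pos (inv_pos.2 Real.pi_pos) (C.RR_pos E (hpm τ).1 (hpm τ).2))
    (fun s => by
      rw [intervalIntegral.integral_const_mul]
      have e : ∫ τ in (-(T/2))..(T/2), (RR W s (s + pr τ : ℝ)).im = (∫ τ in (-(T/2))..(T/2), RR W s (s + pr τ : ℝ)).im := by
        have := imCLM.intervalIntegral_comp_comm (μ := volume) (a := -(T/2)) (b := T/2) (f := fun τ => RR W s (s + pr τ : ℝ))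
          ((hcR.comp (by fun_prop : Continuous fun τ => (s, τ))).intervalIntegrable _ _)
        simpa using this
      have e2 : ∫ τ in (-(T/2))..(T/2), RR W s (s + pr τ : ℝ) = ∫ τ in (-(T/2))..(T/2), RR W s (s + τ : ℝ) :=
        intervalIntegral.integral_congr fun τ hτ => by
          rw [uIcc_of_le hab] at hτ; beta_reduce; rw [hpe τ hτ]
      rw [e, e2, C.RR_int E]
      simp [Real.pi_ne_zero]) hg hgp
  refine ⟨μ, h1, h2, fun s => ?_⟩
  rw [← h3 s, ← intervalIntegral.integral_const_mul]
  congr 1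
  refine intervalIntegral.integral_congr fun τ hτ => ?_
  rw [uIcc_of_le hab] at hτ; beta_reduce; rw [hpe τ hτ, mul_assoc]

lemma RR_im (C : Cv T w) (E : Ex T w δ W) {s t : ℝ} (h1 : s - T < t) (h2 : t < s + T) (hne : t ≠ s) :
    (RR W s t).im = (deriv w t / (w t - w s)).im := by
  have hb := (C.BB_sign E (s := s) (τ := t - s) (by linarith) (by linarith)).2.2.2
  rw [add_sub_cancel] at hb
  have e := E.RR_eq (real_strip E.pos s) (real_strip E.pos t) (by simpa using hne) hb
  rw [E.deq, E.eq, E.eq] at e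
  rw [e, add_im, ← ofReal_sub, ← ofReal_one, ← ofReal_div, ofReal_im, zero_add]

lemma solve_an (C : Cv T w) (E : Ex T w δ W) {g : ℝ → ℝ} (hg : AnalyticOnNhd ℝ g univ) (hgp : ∀ s, g (s + T) = g s) :
    ∃ μ : ℝ → ℝ, AnalyticOnNhd ℝ μ univ ∧ (∀ s, μ (s+T) = μ s) ∧
      ∀ s, μ s + Real.pi⁻¹ * ∫ τ in (-(T/2))..(T/2), (RR W s (s + τ : ℝ)).im * μ (s+τ) = 2 * g s := by
  have hT := C.hT
  obtain ⟨μ, h1, h2, h3⟩ := C.solve_cont E (g := g) (continuous_iff_continuousAt.2 fun s => (hg s (mem_univ s)).continuousAt) hgp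
  refine ⟨μ, fun s₀ _ => ?_, h2, h3⟩
  let a := s₀ - T/2
  let b := s₀ - T/2 + T
  have hab : a ≤ b := by simp only [a, b]; linarith
  have hO : IsOpen ((strip δ ×ˢ strip δ) ∩ {q : ℂ × ℂ | qq W q.1 q.2 ≠ 0}) := by
    have := E.qq_cont.isOpen_inter_preimage ((strip_open δ).prod (strip_open δ)) isOpen_ne (t := {x | x ≠ 0})
    exact this
  have htube : ∀ᶠ ζ : ℂ in 𝓝 (s₀:ℂ), ∀ t ∈ Icc a b, ((ζ, ((t:ℝ):ℂ)) : ℂ × ℂ) ∈ ((strip δ ×ˢ strip δ) ∩ {q : ℂ × ℂ | qq W q.1 q.2 ≠ 0}) := by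
    refine isCompact_Icc.eventually_forall_of_forall_eventually fun t ht => ?_
    have hc : Continuous fun z : ℂ × ℝ => ((z.1, ((z.2:ℝ):ℂ)) : ℂ × ℂ) := by fun_prop
    refine hc.continuousAt.eventually_mem (hO.mem_nhds ⟨⟨real_strip E.pos _, real_strip E.pos _⟩, ?_⟩)
    simp only [a, b] at ht
    have hb := (C.BB_sign E (s := s₀) (τ := t - s₀) (by linarith [ht.1]) (by linarith [ht.2])).2.2.2
    rw [add_sub_cancel] at hb
    exact hb
  obtain ⟨r, hr, hball⟩ := Metric.eventually_nhds_iff_ball.1 htube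
  let H : ℂ → ℂ := fun ζ => ∫ t in a..b, RR W ζ t * μ t
  have hH : DifferentiableOn ℂ H (ball (s₀:ℂ) r) := by
    refine differentiableOn_param isOpen_ball (F := fun ζ t => RR W ζ t * μ t) ?_ fun t ht => ?_
    · simp only [Function.uncurry_def]
      rw [uIcc_of_le hab]
      refine ContinuousOn.mul (E.RR_cont.comp (f := fun q : ℂ × ℝ => ((q.1, ((q.2:ℝ):ℂ)) : ℂ × ℂ)) (by fun_prop) fun q hq => hball q.1 hq.1 q.2 hq.2) ?_
      exact (continuous_ofReal.comp (h1.comp continuous_snd)).continuousOn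
    · rw [uIcc_of_le hab] at ht
      have hsub : ball (s₀:ℂ) r ⊆ strip δ := fun ζ hζ => (hball ζ hζ t ht).1.1
      refine DifferentiableOn.mul_const (DifferentiableOn.div ?_ ?_ fun ζ hζ => (hball ζ hζ t ht).2) _
      · exact (rad_diff_c (strip_open δ) (strip_convex δ) E.diff'' 1 (real_strip E.pos t)).mono hsub
      · exact (rad_diff_c (strip_open δ) (strip_convex δ) E.diff' 0 (real_strip E.pos t)).mono hsub
  have hHan : AnalyticAt ℝ (fun s : ℝ => (H s).im) s₀ := by
    have := (hH.analyticAt (isOpen_ball.mem_nhds (mem_ball_self hr))).restrictScalars (𝕜 := ℝ)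
    have h5 : AnalyticAt ℝ (fun s : ℝ => (s:ℂ)) s₀ := ofRealCLM.analyticAt _
    exact (imCLM.analyticAt _).comp (AnalyticAt.comp (f := fun s : ℝ => (s:ℂ)) this h5)
  have key : ∀ᶠ s in 𝓝 s₀, μ s = 2 * g s - Real.pi⁻¹ * (H s).im := by
    have ev1 : ∀ᶠ s : ℝ in 𝓝 s₀, (s:ℂ) ∈ ball (s₀:ℂ) r := continuous_ofReal.continuousAt.eventually_mem (isOpen_ball.mem_nhds (mem_ball_self hr))
    filter_upwards [ev1, Ioo_mem_nhds (show s₀ - T/2 < s₀ by linarith) (show s₀ < s₀ + T/2 by linarith)] with s hs hs2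
    rw [← h3 s]
    suffices h : ∫ τ in (-(T/2))..(T/2), (RR W s (s + τ : ℝ)).im * μ (s+τ) = (H s).im by rw [h]; ring
    let P : ℝ → ℝ := fun t => (deriv w t / (w t - w s)).im * μ t
    have hP : Function.Periodic P T := fun t => by simp only [P, C.per, C.P' t, h2]
    have hae : ∀ᵐ t : ℝ, t ≠ s := by simp [ae_iff, measure_singleton]
    have e1 : (H s).im = ∫ t in a..b, (RR W s t).im * μ t := by
      have := imCLM.intervalIntegral_comp_comm (μ := volume) (a := a) (b := b) (f := fun t : ℝ => RR W s t * μ t) (by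
        apply ContinuousOn.intervalIntegrable
        rw [uIcc_of_le hab]
        refine ContinuousOn.mul (E.RR_cont.comp (f := fun t : ℝ => (((s:ℂ), ((t:ℝ):ℂ)) : ℂ × ℂ)) (by fun_prop) fun t ht => hball s hs t ht) ?_
        exact (continuous_ofReal.comp h1).continuousOn)
      simp only [imCLM_apply] at this
      rw [← this]
      simp [mul_comm]
    have e2 : ∫ t in a..b, (RR W s t).im * μ t = ∫ t in a..b, P t := by
      refine intervalIntegral.integral_congr_ae ?_
      filter_upwards [hae] with t ht hm
      rw [uIoc_of_le hab] at hm
      simp only [P, a, b] at *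
      rw [C.RR_im E (by linarith [hm.1, hs2.2]) (by linarith [hm.2, hs2.1]) ht]
    have e3 : ∫ τ in (-(T/2))..(T/2), (RR W s (s + τ : ℝ)).im * μ (s+τ) = ∫ t in (s - T/2)..(s - T/2 + T), P t := by
      rw [intervalIntegral.integral_comp_add_left (fun t : ℝ => (RR W s t).im * μ t)]
      have e4 : s + -(T/2) = s - T/2 := by ring
      have e5 : s + T/2 = s - T/2 + T := by ring
      rw [e4, e5]
      refine intervalIntegral.integral_congr_ae ?_
      filter_upwards [hae] with t ht hm
      rw [uIoc_of_le (by linarith)] at hm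
      simp only [P]
      rw [C.RR_im E (by linarith [hm.1]) (by linarith [hm.2]) ht]
    rw [e1, e2, e3]
    exact hP.intervalIntegral_add_eq _ _
  refine AnalyticAt.congr ?_ (key.mono fun s hs => hs.symm)
  exact (analyticAt_const.mul (hg s₀ (mem_univ _))).sub (analyticAt_const.mul hHan)
end Cv
lemma Ex.mono {T δ δ' : ℝ} {f : ℝ → ℂ} {F : ℂ → ℂ} (E : Ex T f δ F) (h0 : 0 < δ') (h : δ' ≤ δ) : Ex T f δ' F := by
  have hs : strip δ' ⊆ strip δ := fun z hz => lt_of_lt_of_le hz h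
  exact ⟨h0, E.diff.mono hs, E.eq, fun z hz => E.per z (hs hz)⟩

lemma strip_mk {δ : ℝ} (x : ℝ) {y : ℝ} (hy : |y| < δ) : (x:ℂ) + y * I ∈ strip δ := by simpa [strip] using hy

namespace Cv
variable {T δ : ℝ} {w : ℝ → ℂ} {W : ℂ → ℂ}

def BB (w : ℝ → ℂ) (W : ℂ → ℂ) (s τ y : ℝ) : ℂ := conj (deriv w s) * qq W s ((s + τ : ℝ) + y * I)

lemma BB_zero (s τ : ℝ) : BB w W s τ 0 = conj (deriv w s) * qq W s (s + τ : ℝ) := by simp [BB]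

lemma shiftA (C : Cv T w) (E : Ex T w δ W) {K : Set ℝ} (hK : IsCompact K) {A : Set ℂ} (hA : IsOpen A) (h : ∀ s, ∀ τ ∈ K, BB w W s τ 0 ∈ A) :
    ∀ᶠ y : ℝ in 𝓝 0, ∀ s, ∀ τ ∈ K, BB w W s τ y ∈ A := by
  have h1 : ∀ᶠ y : ℝ in 𝓝 0, ∀ q ∈ Icc 0 T ×ˢ K, BB w W q.1 q.2 y ∈ A := by
    refine (isCompact_Icc.prod hK).eventually_forall_of_forall_eventually fun q hq => ?_
    have hs1 : ((q.1 + q.2 : ℝ):ℂ) + (0:ℝ) * I ∈ strip δ := strip_mk _ (by simpa using E.pos)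
    have c1 : ContinuousAt (fun z : ℝ × (ℝ × ℝ) => BB w W z.2.1 z.2.2 z.1) ((0:ℝ), q) := by
      have := C.cont'
      refine ContinuousAt.mul (by fun_prop) ?_
      have c2 := E.qq_cont.continuousAt (x := ((q.1:ℂ), ((q.1 + q.2 : ℝ):ℂ) + (0:ℝ) * I)) (prod_mem_nhds ((strip_open δ).mem_nhds (real_strip E.pos _)) ((strip_open δ).mem_nhds hs1))
      exact ContinuousAt.comp (x := ((0:ℝ), q)) (f := fun z : ℝ × (ℝ × ℝ) => ((z.2.1:ℂ), ((z.2.1 + z.2.2 : ℝ):ℂ) + (z.1:ℝ) * I)) c2 (by fun_prop)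
    exact c1.eventually_mem (hA.mem_nhds (h q.1 q.2 hq.2))
  have h2 : ∀ᶠ y : ℝ in 𝓝 0, |y| < δ := by
    have := ball_mem_nhds (0:ℝ) E.pos
    filter_upwards [this] with y hy
    simpa using hy
  filter_upwards [h1, h2] with y hy hyδ s τ hτ
  have hp : Function.Periodic (fun s => BB w W s τ y) T := fun s => by
    have a1 := Ex.rad_per E.per' 0 (real_strip E.pos s) (strip_mk (s + τ) hyδ)
    have e1 : ((s + T : ℝ):ℂ) = s + T := by push_cast; ring
    have e2 : ((s + T + τ : ℝ):ℂ) + y * I = ((s + τ : ℝ):ℂ) + y * I + T := by push_cast; ring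
    simp only [BB, qq]
    rw [C.P', e1, e2, a1]
  obtain ⟨r, hr, n, rfl⟩ := Ico_rep C.hT 0 s
  have : BB w W (r + n * T) τ y = BB w W r τ y := hp.int_mul n r
  rw [this]
  exact hy (r, τ) ⟨⟨hr.1, by linarith [hr.2]⟩, hτ⟩

lemma exists_shift (C : Cv T w) (E : Ex T w δ W) : ∃ d, 0 < d ∧ d < δ ∧ ∀ y ∈ Icc (-d) 0, ∀ s, (∀ τ ∈ Icc (-(T/2)) (T/2), BB w W s τ y ∈ slitPlane) ∧
    0 < (BB w W s (T/2) y).im ∧ (BB w W s (-(T/2)) y).im < 0 ∧ 0 < (BB w W s 0 y).re := by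
  have hT := C.hT
  have h1 := C.shiftA E (isCompact_Icc (a := -(T/2)) (b := T/2)) isOpen_slitPlane fun s τ hτ => by
    rw [BB_zero]; exact (C.BB_sign E (by linarith [hτ.1]) (by linarith [hτ.2])).2.2.1
  have h2 := C.shiftA E (isCompact_singleton (x := T/2)) (isOpen_lt continuous_const continuous_im (f := fun _ => 0)) fun s τ hτ => by
    rw [BB_zero, hτ]; exact (C.BB_sign E (by linarith) (by linarith)).1 (by linarith)
  have h3 := C.shiftA E (isCompact_singleton (x := -(T/2))) (isOpen_lt continuous_im continuous_const (g := fun _ => 0)) fun s τ hτ => by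
    rw [BB_zero, hτ]; exact (C.BB_sign E (by linarith) (by linarith)).2.1 (by linarith)
  have h4 := C.shiftA E (isCompact_singleton (x := (0:ℝ))) (isOpen_lt continuous_const continuous_re (f := fun _ => 0)) fun s τ hτ => by
    rw [BB_zero, hτ, add_zero, Ex.qq_self, E.deq, mul_comm, mul_conj]
    exact normSq_pos.2 (C.ne s)
  obtain ⟨r, hr, h⟩ := Metric.eventually_nhds_iff_ball.1 ((h1.and h2).and (h3.and h4))
  refine ⟨min (r/2) (δ/2), lt_min (by linarith) (by linarith [E.pos]), lt_of_le_of_lt (min_le_right _ _) (by linarith [E.pos]), fun y hy s => ?_⟩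
  have := min_le_left (r/2) (δ/2)
  have hy' : y ∈ ball (0:ℝ) r := by
    rw [mem_ball_zero_iff, Real.norm_eq_abs, abs_lt]
    exact ⟨by linarith [hy.1], by linarith [hy.2]⟩
  obtain ⟨⟨a1, a2⟩, a3, a4⟩ := h y hy'
  exact ⟨a1 s, a2 s _ rfl, a3 s _ rfl, a4 s _ rfl⟩

lemma wind (C : Cv T w) (E : Ex T w δ W) {d : ℝ} (hd0 : 0 < d) (hdδ : d < δ) (h : ∀ y ∈ Icc (-d) 0, ∀ s, (∀ τ ∈ Icc (-(T/2)) (T/2), BB w W s τ y ∈ slitPlane) ∧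
    0 < (BB w W s (T/2) y).im ∧ (BB w W s (-(T/2)) y).im < 0 ∧ 0 < (BB w W s 0 y).re) (s : ℝ) :
    ContinuousOn (fun τ : ℝ => deriv W ((s + τ : ℝ) + (-d : ℝ) * I) / (W ((s + τ : ℝ) + (-d : ℝ) * I) - W s)) (uIcc (-(T/2)) (T/2)) ∧
    ∫ τ in (-(T/2))..(T/2), deriv W ((s + τ : ℝ) + (-d : ℝ) * I) / (W ((s + τ : ℝ) + (-d : ℝ) * I) - W s) = 2 * Real.pi * I := by
  have hT := C.hT
  have hab : -(T/2) ≤ T/2 := by linarith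
  obtain ⟨b1, b2, b3, b4⟩ := h (-d) ⟨le_rfl, by linarith⟩ s
  have hst : ∀ τ : ℝ, ((s + τ : ℝ):ℂ) + (-d : ℝ) * I ∈ strip δ := fun τ => strip_mk _ (by rw [abs_neg, abs_of_pos hd0]; exact hdδ)
  have hs0 := real_strip E.pos s
  have hzs : ∀ τ : ℝ, ((s + τ : ℝ):ℂ) + (-d : ℝ) * I - s = τ - d * I := fun τ => by push_cast; ring
  have hz0 : ∀ τ : ℝ, (τ:ℂ) - d * I ≠ 0 := fun τ h0 => by
    have := congrArg im h0
    simp at this; exact hd0.ne' this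
  have hq0 : ∀ τ ∈ Icc (-(T/2)) (T/2), qq W s ((s + τ : ℝ) + (-d : ℝ) * I) ≠ 0 := fun τ hτ => right_ne_zero_of_mul (slitPlane_ne_zero (b1 τ hτ))
  have hWne : ∀ τ ∈ Icc (-(T/2)) (T/2), W ((s + τ : ℝ) + (-d : ℝ) * I) - W s ≠ 0 := fun τ hτ => by
    rw [← E.qq_ftc hs0 (hst τ), hzs]
    exact mul_ne_zero (hz0 τ) (hq0 τ hτ)
  have hcont : ContinuousOn (fun τ : ℝ => deriv W ((s + τ : ℝ) + (-d : ℝ) * I) / (W ((s + τ : ℝ) + (-d : ℝ) * I) - W s)) (uIcc (-(T/2)) (T/2)) := by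
    rw [uIcc_of_le hab]
    have c1 : ContinuousOn (fun τ : ℝ => W ((s + τ : ℝ) + (-d : ℝ) * I)) (Icc (-(T/2)) (T/2)) := E.diff.continuousOn.comp (by fun_prop) fun τ _ => hst τ
    have c2 : ContinuousOn (fun τ : ℝ => deriv W ((s + τ : ℝ) + (-d : ℝ) * I)) (Icc (-(T/2)) (T/2)) := E.diff'.continuousOn.comp (by fun_prop) fun τ _ => hst τ
    exact c2.div (c1.sub continuousOn_const) hWne
  refine ⟨hcont, ?_⟩
  have hF := intervalIntegral.integral_eq_sub_of_hasDerivAt (a := -(T/2)) (b := T/2)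
    (f := fun τ : ℝ => Complex.log (BB w W s τ (-d)) + Complex.log (d + τ * I))
    (f' := fun τ : ℝ => deriv W ((s + τ : ℝ) + (-d : ℝ) * I) / (W ((s + τ : ℝ) + (-d : ℝ) * I) - W s)) (fun τ hτ => by
      rw [uIcc_of_le hab] at hτ
      have h1 := (E.qq_deriv hs0 (hst τ)).1
      have h2 : HasDerivAt (fun τ : ℝ => ((s + τ : ℝ):ℂ) + (-d : ℝ) * I) 1 τ := by
        have := (((hasDerivAt_id τ).const_add s).ofReal_comp).add_const ((-d : ℝ) * I)
        simpa using this
      have h3 := ((h1.comp τ h2).const_mul (conj (deriv w s))).clog_real (b1 τ hτ)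
      rw [mul_one, mul_div_mul_left _ _ ((map_ne_zero _).2 (C.ne s))] at h3
      have h4 : HasDerivAt (fun τ : ℝ => (d:ℂ) + τ * I) (1 * I) τ := ((hasDerivAt_id τ).ofReal_comp.mul_const I).const_add (d:ℂ)
      have h5 := h4.clog_real (.inl (by simpa using hd0))
      have h6 := h3.add h5
      have e1 := E.RR_eq hs0 (hst τ) (fun h0 => hz0 τ (by rw [← hzs, h0, sub_self])) (hq0 τ hτ)
      have h7 : 1 / ((τ:ℂ) - d * I) = 1 * I / ((d:ℂ) + τ * I) := by
        have : (d:ℂ) + τ * I = (τ - d * I) * I := by linear_combination (d:ℂ) * I_sq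
        rw [this, mul_div_mul_right _ _ I_ne_zero]
      rw [e1, hzs, add_comm, h7]
      exact h6) hcont.intervalIntegrable
  rw [hF]
  have e1 := E.qq_ftc hs0 (hst (T/2))
  have e2 := E.qq_ftc hs0 (hst (-(T/2)))
  have e3 : W ((s + T/2 : ℝ) + (-d : ℝ) * I) = W ((s + -(T/2) : ℝ) + (-d : ℝ) * I) := by
    rw [← E.per _ (hst (-(T/2)))]; congr 1; push_cast; ring
  rw [e3, ← e2, hzs, hzs] at e1
  have e4 : BB w W s (T/2) (-d) * (d + ((T/2:ℝ):ℂ) * I) = BB w W s (-(T/2)) (-d) * (d + ((-(T/2):ℝ):ℂ) * I) := by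
    simp only [BB]
    linear_combination (conj (deriv w s) * I) * e1 + (conj (deriv w s) * d * (qq W s ((s + T/2 : ℝ) + (-d : ℝ) * I) - qq W s ((s + -(T/2) : ℝ) + (-d : ℝ) * I))) * I_sq
  have n1 : BB w W s (T/2) (-d) ≠ 0 := fun h => by simp [h] at b2
  have n2 : BB w W s (-(T/2)) (-d) ≠ 0 := fun h => by simp [h] at b3
  have n3 : ∀ τ : ℝ, (d:ℂ) + τ * I ≠ 0 := fun τ h => by
    have := congrArg re h; simp at this; exact hd0.ne' this
  set D := Complex.log (BB w W s (T/2) (-d)) + Complex.log (d + ((T/2:ℝ):ℂ) * I) - (Complex.log (BB w W s (-(T/2)) (-d)) + Complex.log (d + ((-(T/2):ℝ):ℂ) * I)) with hD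
  have hexp : exp D = 1 := by
    rw [hD, exp_sub, exp_add, exp_add, exp_log n1, exp_log n2, exp_log (n3 _), exp_log (n3 _), e4, div_self (mul_ne_zero n2 (n3 _))]
  obtain ⟨n, hn⟩ := exp_eq_one_iff.1 hexp
  have hDim : D.im = n * (2 * Real.pi) := by rw [hn]; simp
  have a1 : 0 < arg (BB w W s (T/2) (-d)) := (arg_nonneg_iff.2 b2.le).lt_of_ne fun h => by
    have := (arg_eq_zero_iff.1 h.symm).2; linarith
  have a1' := arg_le_pi (BB w W s (T/2) (-d))
  have a2 : arg (BB w W s (-(T/2)) (-d)) < 0 := arg_neg_iff.2 b3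
  have a2' := neg_pi_lt_arg (BB w W s (-(T/2)) (-d))
  have a3 : 0 ≤ arg ((d:ℂ) + ((T/2:ℝ):ℂ) * I) := arg_nonneg_iff.2 (by simp; linarith)
  have a3' := abs_lt.1 (abs_arg_lt_pi_div_two_iff.2 (.inl (by simpa using hd0) : 0 < ((d:ℂ) + ((T/2:ℝ):ℂ) * I).re ∨ _))
  have a4 : arg ((d:ℂ) + ((-(T/2):ℝ):ℂ) * I) ≤ 0 := (arg_neg_iff.2 (by simp; linarith)).le
  have a4' := abs_lt.1 (abs_arg_lt_pi_div_two_iff.2 (.inl (by simpa using hd0) : 0 < ((d:ℂ) + ((-(T/2):ℝ):ℂ) * I).re ∨ _))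
  have hDim2 : D.im = arg (BB w W s (T/2) (-d)) + arg ((d:ℂ) + ((T/2:ℝ):ℂ) * I) - (arg (BB w W s (-(T/2)) (-d)) + arg ((d:ℂ) + ((-(T/2):ℝ):ℂ) * I)) := by
    rw [hD, sub_im, add_im, add_im, log_im, log_im, log_im, log_im]
  have hpi := Real.pi_pos
  have l1 : (0:ℝ) < n := by
    by_contra hc
    push Not at hc
    nlinarith
  have l2 : (n:ℝ) < 2 := by
    by_contra hc
    push Not at hc
    nlinarith
  have : n = 1 := by
    have l1 : 0 < n := by exact_mod_cast l1
    have l2 : n < 2 := by exact_mod_cast l2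
    omega
  rw [hn, this]; simp
end Cv
namespace Cv
variable {T : ℝ} {w : ℝ → ℂ}

theorem P3 (C : Cv T w) {g : ℝ → ℝ} (hg : AnalyticOnNhd ℝ g univ) (hgp : ∀ s, g (s + T) = g s) :
    ∃ (U : Set ℂ) (Ψ : ℂ → ℂ), IsOpen U ∧ closure (Om w) ⊆ U ∧ DifferentiableOn ℂ Ψ U ∧ ∀ s, (Ψ (w s)).re = g s := by
  have hT := C.hT
  have hab : -(T/2) ≤ T/2 := by linarith
  obtain ⟨δ₁, W, E₁⟩ := exists_Ex C.an hT C.per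
  obtain ⟨μ, hμ, hμp, hμe⟩ := C.solve_an E₁ hg hgp
  have hμ' : AnalyticOnNhd ℝ (fun s => (μ s : ℂ)) univ := fun s hs => (ofRealCLM.analyticAt _).comp (hμ s hs)
  have hμc : Continuous μ := continuous_iff_continuousAt.2 fun s => (hμ s (mem_univ s)).continuousAt
  obtain ⟨δ₂, M, EM₂⟩ := exists_Ex hμ' hT (fun s => by simp only [hμp])
  have hδ : 0 < min δ₁ δ₂ := lt_min E₁.pos EM₂.pos
  have E := E₁.mono hδ (min_le_left _ _)
  have EM := EM₂.mono hδ (min_le_right _ _)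
  set δ := min δ₁ δ₂
  obtain ⟨d, hd0, hdδ, hsh⟩ := C.exists_shift E
  have hst : ∀ x : ℝ, (x:ℂ) + (-d : ℝ) * I ∈ strip δ := fun τ => strip_mk _ (by rw [abs_neg, abs_of_pos hd0]; exact hdδ)
  have cW : Continuous fun t : ℝ => W ((t:ℂ) + (-d : ℝ) * I) := E.diff.continuousOn.comp_continuous (by fun_prop) hst
  have cW' : Continuous fun t : ℝ => deriv W ((t:ℂ) + (-d : ℝ) * I) := E.diff'.continuousOn.comp_continuous (by fun_prop) hst
  have cM : Continuous fun t : ℝ => M ((t:ℂ) + (-d : ℝ) * I) := EM.diff.continuousOn.comp_continuous (by fun_prop) hst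
  let Z : Set ℂ := (fun t : ℝ => W ((t:ℂ) + (-d : ℝ) * I)) '' Icc 0 T
  have hZ : IsClosed Z := (isCompact_Icc.image cW).isClosed
  let F : ℂ → ℝ → ℂ := fun p t => M ((t:ℂ) + (-d : ℝ) * I) * (deriv W ((t:ℂ) + (-d : ℝ) * I) / (W ((t:ℂ) + (-d : ℝ) * I) - p))
  refine ⟨Zᶜ, fun p => (2 * Real.pi * I)⁻¹ * ∫ t in (0:ℝ)..T, F p t, hZ.isOpen_compl, ?_, ?_, fun s => ?_⟩
  · rintro p hp ⟨t, ht, rfl⟩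
    have h1 := closure_nn hp t
    have h2 := (hsh (-d) ⟨le_rfl, by linarith⟩ t).2.2.2
    have h3 := E.qq_ftc (real_strip E.pos t) (hst t)
    rw [E.eq] at h3
    beta_reduce at h1
    rw [← h3] at h1
    have h4 : conj (deriv w t) * (((t:ℂ) + (-d : ℝ) * I - t) * qq W t ((t:ℂ) + (-d : ℝ) * I)) = ((-d : ℝ):ℂ) * (I * BB w W t 0 (-d)) := by
      rw [BB, add_zero]; ring
    rw [h4, im_ofReal_mul, I_mul_im] at h1
    nlinarith
  · refine DifferentiableOn.const_mul (differentiableOn_param hZ.isOpen_compl (F := F) ?_ fun t ht => ?_) _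
    · rw [uIcc_of_le hT.le]
      simp only [Function.uncurry_def, F]
      refine ContinuousOn.mul (cM.comp continuous_snd).continuousOn (ContinuousOn.div (cW'.comp continuous_snd).continuousOn ((cW.comp continuous_snd).sub continuous_fst).continuousOn ?_)
      intro q hq h0
      exact hq.1 ⟨q.2, hq.2, sub_eq_zero.1 h0⟩
    · rw [uIcc_of_le hT.le] at ht
      have hp : ∀ p ∈ Zᶜ, W ((t:ℂ) + (-d : ℝ) * I) - p ≠ 0 := fun p hp h0 => hp ⟨t, ht, sub_eq_zero.1 h0⟩
      exact DifferentiableOn.const_mul (DifferentiableOn.div (differentiableOn_const _) (by fun_prop) hp) _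
  · have hs0 := real_strip E.pos s
    have hFp : Function.Periodic (F (w s)) T := fun t => by
      have e : ((t + T : ℝ):ℂ) + (-d : ℝ) * I = (t:ℂ) + (-d : ℝ) * I + T := by push_cast; ring
      simp only [F]
      rw [e, E.per _ (hst t), E.per' _ (hst t), EM.per _ (hst t)]
    have i1 : ∫ t in (0:ℝ)..T, F (w s) t = ∫ τ in (-(T/2))..(T/2), F (w s) (s + τ) := by
      rw [intervalIntegral.integral_comp_add_left (F (w s))]
      have := hFp.intervalIntegral_add_eq 0 (s + -(T/2))
      rw [zero_add] at this
      rw [this]; congr 1; ring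
    obtain ⟨hwc, hw⟩ := C.wind E hd0 hdδ hsh s
    let f : ℂ → ℂ := fun z => qq M s z * (deriv W z / qq W s z)
    have hqne : ∀ τ ∈ Icc (-(T/2)) (T/2), ∀ y ∈ Icc (-d) 0, qq W s ((s + τ : ℝ) + y * I) ≠ 0 := fun τ hτ y hy =>
      right_ne_zero_of_mul (slitPlane_ne_zero ((hsh y hy s).1 τ hτ))
    have hyst : ∀ x : ℝ, ∀ y ∈ Icc (-d) 0, (x:ℂ) + y * I ∈ strip δ := fun x y hy => strip_mk _ (by rw [abs_lt]; constructor <;> linarith [hy.1, hy.2])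
    have hfeq : ∀ z ∈ strip δ, z ≠ s → qq W s z ≠ 0 → f z = (M z - M s) * (deriv W z / (W z - W s)) := fun z hz hne hq => by
      rw [← EM.qq_ftc hs0 hz, ← E.qq_ftc hs0 hz]
      have := sub_ne_zero.2 hne
      simp only [f]
      field_simp
    let z1 : ℂ := ((s + -(T/2) : ℝ):ℂ) + (-d : ℝ) * I
    let z2 : ℂ := ((s + T/2 : ℝ):ℂ) + (0 : ℝ) * I
    have hz1 : z1.re = s + -(T/2) ∧ z1.im = -d := by simp [z1]
    have hz2 : z2.re = s + T/2 ∧ z2.im = 0 := by simp [z2]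
    have hrect := integral_boundary_rect_eq_zero_of_differentiableOn f z1 z2 (by
      rw [hz1.1, hz1.2, hz2.1, hz2.2, uIcc_of_le (by linarith), uIcc_of_le (by linarith)]
      intro z hz
      have hz' : z = ((s + (z.re - s) : ℝ):ℂ) + z.im * I := by rw [add_sub_cancel, re_add_im]
      have hzs : z ∈ strip δ := by rw [hz']; exact hyst _ _ hz.2
      have hq : qq W s z ≠ 0 := by
        rw [hz']; exact hqne _ ⟨by linarith [hz.1.1], by linarith [hz.1.2]⟩ _ hz.2
      refine DifferentiableAt.differentiableWithinAt ?_
      exact (EM.qq_deriv hs0 hzs).1.differentiableAt.mul ((E.hd' hzs).differentiableAt.div (E.qq_deriv hs0 hzs).1.differentiableAt hq))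
    rw [hz1.1, hz1.2, hz2.1, hz2.2] at hrect
    have hsides : ∫ y in (-d)..(0:ℝ), f ((s + T/2 : ℝ) + y * I) = ∫ y in (-d)..(0:ℝ), f ((s + -(T/2) : ℝ) + y * I) := by
      refine intervalIntegral.integral_congr fun y hy => ?_
      rw [uIcc_of_le (by linarith)] at hy
      have e : ((s + T/2 : ℝ):ℂ) + y * I = ((s + -(T/2) : ℝ):ℂ) + y * I + T := by push_cast; ring
      have n1 : ((s + T/2 : ℝ):ℂ) + y * I ≠ s := fun h => by
        have := congrArg re h; simp at this; linarith
      have n2 : ((s + -(T/2) : ℝ):ℂ) + y * I ≠ s := fun h => by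
        have := congrArg re h; simp at this; linarith
      beta_reduce
      rw [hfeq _ (hyst _ _ hy) n1 (hqne _ ⟨hab, le_rfl⟩ _ hy), hfeq _ (hyst _ _ hy) n2 (hqne _ ⟨le_rfl, hab⟩ _ hy), e, E.per _ (hyst _ _ hy), E.per' _ (hyst _ _ hy), EM.per _ (hyst _ _ hy)]
    rw [hsides, add_sub_cancel_right, sub_eq_zero, ← intervalIntegral.integral_comp_add_left (fun x : ℝ => f (x + (-d : ℝ) * I)),
      ← intervalIntegral.integral_comp_add_left (fun x : ℝ => f (x + (0 : ℝ) * I))] at hrect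
    have i2 : ∫ τ in (-(T/2))..(T/2), F (w s) (s + τ) = M s * (2 * Real.pi * I) + ∫ τ in (-(T/2))..(T/2), f ((s + τ : ℝ) + (0:ℝ) * I) := by
      rw [← hrect, ← hw, ← intervalIntegral.integral_const_mul, ← intervalIntegral.integral_add]
      · refine intervalIntegral.integral_congr fun τ hτ => ?_
        rw [uIcc_of_le hab] at hτ
        beta_reduce
        rw [hfeq _ (hst _) (fun h => by have := congrArg im h; simp at this; linarith) (hqne _ hτ _ ⟨le_rfl, by linarith⟩)]
        simp only [F, E.eq]
        ring
      · exact (continuousOn_const.mul hwc).intervalIntegrable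
      · apply ContinuousOn.intervalIntegrable
        rw [uIcc_of_le hab]
        refine ContinuousOn.mul (EM.qq_cont.comp (f := fun τ : ℝ => ((s:ℂ), ((s + τ : ℝ):ℂ) + (-d : ℝ) * I)) (by fun_prop) fun τ _ => ⟨hs0, hst _⟩) ?_
        refine ContinuousOn.div (cW'.comp (by fun_prop)).continuousOn (E.qq_cont.comp (f := fun τ : ℝ => ((s:ℂ), ((s + τ : ℝ):ℂ) + (-d : ℝ) * I)) (by fun_prop) fun τ _ => ⟨hs0, hst _⟩) fun τ hτ => ?_
        exact hqne _ hτ _ ⟨le_rfl, by linarith⟩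
    have cf : ContinuousOn (fun τ : ℝ => f ((s + τ : ℝ) + (0:ℝ) * I)) (uIcc (-(T/2)) (T/2)) := by
      rw [uIcc_of_le hab]
      have h0 : (0:ℝ) ∈ Icc (-d) 0 := ⟨by linarith, le_rfl⟩
      refine ContinuousOn.mul (EM.qq_cont.comp (f := fun τ : ℝ => ((s:ℂ), ((s + τ : ℝ):ℂ) + (0 : ℝ) * I)) (by fun_prop) fun τ _ => ⟨hs0, hyst _ _ h0⟩) ?_
      refine ContinuousOn.div (E.diff'.continuousOn.comp (f := fun τ : ℝ => ((s + τ : ℝ):ℂ) + (0 : ℝ) * I) (by fun_prop) fun τ _ => hyst _ _ h0) (E.qq_cont.comp (f := fun τ : ℝ => ((s:ℂ), ((s + τ : ℝ):ℂ) + (0 : ℝ) * I)) (by fun_prop) fun τ _ => ⟨hs0, hyst _ _ h0⟩) fun τ hτ => ?_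
      exact hqne _ hτ _ h0
    have cR : ContinuousOn (fun τ : ℝ => (RR W s (s + τ : ℝ)).im) (uIcc (-(T/2)) (T/2)) := by
      rw [uIcc_of_le hab]
      exact continuous_im.comp_continuousOn ((C.ct E).comp (f := fun τ => (s, τ)) (by fun_prop) fun τ hτ => ⟨mem_univ _, by linarith [hτ.1], by linarith [hτ.2]⟩)
    have i3 : (∫ τ in (-(T/2))..(T/2), f ((s + τ : ℝ) + (0:ℝ) * I)).im = ∫ τ in (-(T/2))..(T/2), (RR W s (s + τ : ℝ)).im * (μ (s + τ) - μ s) := by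
      have := imCLM.intervalIntegral_comp_comm (μ := volume) cf.intervalIntegrable
      simp only [imCLM_apply] at this
      rw [← this]
      refine intervalIntegral.integral_congr fun τ hτ => ?_
      rw [uIcc_of_le hab] at hτ
      beta_reduce
      rw [ofReal_zero, zero_mul, add_zero]
      by_cases h0 : τ = 0
      · rw [h0, add_zero, sub_self, mul_zero]
        simp only [f]
        rw [Ex.qq_self, Ex.qq_self, E.deq, div_self (C.ne s), mul_one, EM.deq]
        have := ((hμ s (mem_univ s)).differentiableAt.hasDerivAt.ofReal_comp).deriv
        rw [this, ofReal_im]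
      · have hq := (C.BB_sign E (s := s) (τ := τ) (by linarith [hτ.1]) (by linarith [hτ.2])).2.2.2
        rw [hfeq _ (real_strip E.pos _) (by simpa using h0) hq, EM.eq, EM.eq, E.eq, E.eq, E.deq,
          C.RR_im E (by linarith [hτ.1]) (by linarith [hτ.2]) (by simpa using h0), ← ofReal_sub, im_ofReal_mul, mul_comm]
    have i4 : ∫ τ in (-(T/2))..(T/2), (RR W s (s + τ : ℝ)).im * (μ (s + τ) - μ s) = (∫ τ in (-(T/2))..(T/2), (RR W s (s + τ : ℝ)).im * μ (s + τ)) - Real.pi * μ s := by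
      simp only [mul_sub]
      rw [intervalIntegral.integral_sub, intervalIntegral.integral_mul_const]
      · have e : ∫ τ in (-(T/2))..(T/2), (RR W s (s + τ : ℝ)).im = (∫ τ in (-(T/2))..(T/2), RR W s (s + τ : ℝ)).im := by
          have := imCLM.intervalIntegral_comp_comm (μ := volume) (a := -(T/2)) (b := T/2) (f := fun τ : ℝ => RR W s (s + τ : ℝ)) (by
            apply ContinuousOn.intervalIntegrable
            rw [uIcc_of_le hab]
            exact (C.ct E).comp (f := fun τ => (s, τ)) (by fun_prop) fun τ hτ => ⟨mem_univ _, by linarith [hτ.1], by linarith [hτ.2]⟩)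
          simpa using this
        rw [e, C.RR_int E]; simp
      · exact (cR.mul (hμc.comp (by fun_prop)).continuousOn).intervalIntegrable
      · exact (cR.mul continuousOn_const).intervalIntegrable
    have key := hμe s
    beta_reduce
    rw [i1, i2, EM.eq]
    set X := ∫ τ in (-(T/2))..(T/2), f ((s + τ : ℝ) + (0:ℝ) * I)
    have hpi := Real.pi_ne_zero
    have e5 : (2 * (Real.pi:ℂ) * I)⁻¹ * ((μ s : ℂ) * (2 * Real.pi * I) + X) = μ s + ((2 * Real.pi)⁻¹ : ℝ) * (-I * X) := by
      have : (Real.pi:ℂ) ≠ 0 := by exact_mod_cast hpi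
      push_cast
      rw [mul_inv, inv_I]
      field_simp
      linear_combination (-(2 * (Real.pi:ℂ) * μ s)) * I_sq
    rw [e5, add_re, re_ofReal_mul, ofReal_re]
    have e6 : (-I * X).re = X.im := by simp
    rw [e6, i3, i4]
    field_simp at key ⊢
    linarith
end Cv
/-- Exponential of the regular part of the Green function with pole at `p`. -/
structure Gr (w : ℝ → ℂ) (p : ℂ) (U : Set ℂ) (E : ℂ → ℂ) : Prop where
  hp : p ∈ Om w
  op : IsOpen U
  sub : closure (Om w) ⊆ U
  df : DifferentiableOn ℂ E U
  ne : ∀ z, E z ≠ 0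
  bd : ∀ s, ‖(w s - p) * E (w s)‖ = 1

namespace Cv
variable {T : ℝ} {w : ℝ → ℂ}

lemma green (C : Cv T w) {p : ℂ} (hp : p ∈ Om w) : ∃ U E, Gr w p U E := by
  have hne : ∀ s, w s - p ≠ 0 := fun s h => not_mem (w := w) s (sub_eq_zero.1 h ▸ hp)
  have ha : ∀ s, AnalyticAt ℝ (fun s => w s - p) s := fun s => (C.an s (mem_univ s)).sub analyticAt_const
  obtain ⟨U, Ψ, hU, hs, hd, hb⟩ := C.P3 (g := fun s => Real.log ((w s - p).re ^ 2 + (w s - p).im ^ 2) / 2) (fun s _ => by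
    have h1 : AnalyticAt ℝ (fun s => (w s - p).re) s := (reCLM.analyticAt _).comp (ha s)
    have h2 : AnalyticAt ℝ (fun s => (w s - p).im) s := (imCLM.analyticAt _).comp (ha s)
    refine (((h1.pow 2).add (h2.pow 2)).log ?_).div analyticAt_const two_ne_zero
    have := normSq_pos.2 (hne s)
    rw [normSq_apply] at this
    change 0 < (w s - p).re ^ 2 + (w s - p).im ^ 2
    nlinarith) (fun s => by simp only [C.per])
  refine ⟨U, fun z => exp (-Ψ z), hp, hU, hs, hd.neg.cexp, fun z => exp_ne_zero _, fun s => ?_⟩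
  rw [norm_mul, norm_exp, neg_re, hb, Real.exp_neg, show (w s - p).re ^ 2 + (w s - p).im ^ 2 = ‖w s - p‖ ^ 2 by rw [← normSq_eq_norm_sq, normSq_apply]; ring, Real.log_pow]
  have := norm_pos_iff.2 (hne s)
  rw [show ((2:ℕ):ℝ) * Real.log ‖w s - p‖ / 2 = Real.log ‖w s - p‖ by push_cast; ring, Real.exp_log this]
  exact mul_inv_cancel₀ this.ne'

lemma mp (C : Cv T w) {U : Set ℂ} {F : ℂ → ℂ} (hs : closure (Om w) ⊆ U) (hF : DifferentiableOn ℂ F U)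
    (hb : ∀ s, ‖F (w s)‖ ≤ 1) {z : ℂ} (hz : z ∈ closure (Om w)) : ‖F z‖ ≤ 1 :=
  norm_le_of_forall_mem_frontier_norm_le C.bounded_Om (hF.mono hs).diffContOnCl
    (fun z hz => by rw [C.frontier_Om] at hz; obtain ⟨s, rfl⟩ := hz; exact hb s) hz

lemma mp_eq (C : Cv T w) {U : Set ℂ} {F : ℂ → ℂ} (hs : closure (Om w) ⊆ U) (hF : DifferentiableOn ℂ F U)
    (hb : ∀ s, ‖F (w s)‖ ≤ 1) {z : ℂ} (hz : z ∈ Om w) (h1 : 1 ≤ ‖F z‖) {y : ℂ} (hy : y ∈ Om w) : F y = F z :=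
  eqOn_of_isPreconnected_of_isMaxOn_norm convex_Om.isPreconnected C.open_Om (hF.mono (subset_closure.trans hs)) hz
    (fun _ hx => (C.mp hs hF hb (subset_closure hx)).trans h1) hy

variable {p q : ℂ} {U V : Set ℂ} {E F : ℂ → ℂ}

lemma psi_df (G : Gr w p U E) : DifferentiableOn ℂ (fun z => (z - p) * E z) U := by
  have := G.df; fun_prop

lemma psi_le (C : Cv T w) (G : Gr w p U E) {z : ℂ} (hz : z ∈ closure (Om w)) : ‖(z - p) * E z‖ ≤ 1 :=
  C.mp G.sub (psi_df G) (fun s => (G.bd s).le) hz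

lemma psi_lt (C : Cv T w) (G : Gr w p U E) {z : ℂ} (hz : z ∈ Om w) : ‖(z - p) * E z‖ < 1 := by
  by_contra h
  have h1 := C.mp_eq G.sub (psi_df G) (fun s => (G.bd s).le) hz (not_lt.1 h) G.hp
  simp only [sub_self, zero_mul] at h1
  rw [← h1] at h; simp at h

lemma schw (C : Cv T w) (G : Gr w q U E) (H : Gr w p V F) : ∃ (D : ℂ → ℂ) (O : Set ℂ), closure (Om w) ⊆ O ∧ DifferentiableOn ℂ D O ∧ (∀ s, ‖D (w s)‖ ≤ 1) ∧
    ∀ z, D z = dslope (fun z => (z - q) * E z) p z / ((1 - conj ((p - q) * E p) * ((z - q) * E z)) * F z) := by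
  set ψ := fun z => (z - q) * E z with hψ
  have hψd : DifferentiableOn ℂ ψ U := psi_df G
  have ha : ‖ψ p‖ < 1 := C.psi_lt G H.hp
  refine ⟨fun z => dslope ψ p z / ((1 - conj (ψ p) * ψ z) * F z), (U ∩ V) ∩ {z | 1 - conj (ψ p) * ψ z ≠ 0}, ?_, ?_, ?_, fun z => rfl⟩
  · refine fun z hz => ⟨⟨G.sub hz, H.sub hz⟩, fun h => ?_⟩
    have h1 := C.psi_le G hz
    have h2 : ‖conj (ψ p) * ψ z‖ < 1 := by
      rw [norm_mul, RCLike.norm_conj]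
      have : ‖ψ z‖ ≤ 1 := h1
      nlinarith [norm_nonneg (ψ z), norm_nonneg (ψ p)]
    rw [← sub_eq_zero.1 h] at h2; simp at h2
  · have h1 : DifferentiableOn ℂ (dslope ψ p) U := (differentiableOn_dslope (G.op.mem_nhds (G.sub (subset_closure H.hp)))).2 hψd
    refine (h1.mono fun z hz => hz.1.1).div (((hψd.mono fun z hz => hz.1.1).const_mul _).const_sub 1 |>.mul (H.df.mono fun z hz => hz.1.2)) fun z hz => mul_ne_zero hz.2 (H.ne z)
  · intro s
    have hne : w s ≠ p := fun h => not_mem (w := w) s (h ▸ H.hp)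
    have h1 : ‖ψ (w s)‖ = 1 := G.bd s
    have h2 : ‖ψ (w s) - ψ p‖ = ‖1 - conj (ψ p) * ψ (w s)‖ := by
      have e : ψ (w s) * conj (ψ (w s)) = 1 := by rw [mul_conj, normSq_eq_norm_sq, h1]; simp
      have : 1 - conj (ψ p) * ψ (w s) = ψ (w s) * conj (ψ (w s) - ψ p) := by rw [map_sub]; linear_combination -e
      rw [this, norm_mul, h1, one_mul, RCLike.norm_conj]
    beta_reduce
    rw [dslope_of_ne _ hne, slope_def_field, norm_div, norm_div, h2, norm_mul]
    have h3 := H.bd s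
    rw [norm_mul] at h3
    rw [div_div, mul_left_comm ‖w s - p‖, h3, mul_one]
    exact div_self_le_one _

lemma schw_le (C : Cv T w) (G : Gr w q U E) (H : Gr w p V F) (hpq : p ≠ q) : ‖(p - q) * E p‖ ≤ ‖(q - p) * F q‖ := by
  obtain ⟨D, O, h1, h2, h3, h4⟩ := C.schw G H
  have h5 := C.mp h1 h2 h3 (subset_closure G.hp)
  rw [h4, dslope_of_ne _ hpq.symm, slope_def_field] at h5
  simp only [sub_self, zero_mul, mul_zero, sub_zero, one_mul, zero_sub] at h5
  rw [div_div, norm_div, norm_neg] at h5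
  refine (div_le_one ?_).1 h5
  exact norm_pos_iff.2 (mul_ne_zero (sub_ne_zero.2 hpq.symm) (H.ne _))

lemma dsl (C : Cv T w) (G : Gr w q U E) (hp : p ∈ Om w) {z : ℂ} (hz : z ∈ Om w) : dslope (fun z => (z - q) * E z) p z ≠ 0 := by
  by_cases hpq : p = q
  · subst hpq
    by_cases h : z = p
    · subst h
      have h1 : HasDerivAt (fun y => (y - z) * E y) (1 * E z + (z - z) * deriv E z) z :=
        ((hasDerivAt_id z).sub_const z).mul ((G.df.differentiableAt (G.op.mem_nhds (G.sub (subset_closure hz)))).hasDerivAt)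
      rw [dslope_same, h1.deriv]; simpa using G.ne z
    · rw [dslope_of_ne _ h, slope_def_field]
      simpa [sub_eq_zero, h] using G.ne z
  · obtain ⟨V, F, H⟩ := C.green hp
    obtain ⟨D, O, h1, h2, h3, h4⟩ := C.schw G H
    have h5 : ‖D q‖ = 1 := by
      rw [h4, dslope_of_ne _ (Ne.symm hpq), slope_def_field]
      simp only [sub_self, zero_mul, mul_zero, sub_zero, one_mul, zero_sub]
      rw [div_div, norm_div, norm_neg, le_antisymm (C.schw_le G H hpq) (C.schw_le H G (Ne.symm hpq)), div_self]
      exact norm_ne_zero_iff.2 (mul_ne_zero (sub_ne_zero.2 (Ne.symm hpq)) (H.ne _))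
    have h6 := C.mp_eq h1 h2 h3 G.hp h5.ge hz
    intro h
    rw [h4 z, h, zero_div] at h6
    rw [← h6] at h5; simp at h5
end Cv
/-- Interior facts about the Riemann map. -/
structure Rm (w : ℝ → ℂ) (U : Set ℂ) (ψ : ℂ → ℂ) : Prop where
  op : IsOpen U
  sub : closure (Om w) ⊆ U
  df : DifferentiableOn ℂ ψ U
  bd : ∀ s, ‖ψ (w s)‖ = 1
  lt : ∀ z ∈ Om w, ‖ψ z‖ < 1
  inj : InjOn ψ (Om w)
  dne : ∀ z ∈ Om w, deriv ψ z ≠ 0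

namespace Cv
variable {T : ℝ} {w : ℝ → ℂ} {U : Set ℂ} {ψ : ℂ → ℂ}

lemma exists_Rm (C : Cv T w) : ∃ U ψ, Rm w U ψ := by
  obtain ⟨q, hq⟩ := C.nonempty_Om
  obtain ⟨U, E, G⟩ := C.green hq
  refine ⟨U, _, G.op, G.sub, psi_df G, G.bd, fun z hz => C.psi_lt G hz, fun x hx y hy h => ?_, fun z hz => ?_⟩
  · by_contra hxy
    have := C.dsl G hx hy
    rw [dslope_of_ne _ (Ne.symm hxy), slope_def_field] at this
    simp [h] at this
  · have := C.dsl G hz hz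
    rwa [dslope_same] at this

lemma ran (R : Rm w U ψ) {z : ℂ} (hz : z ∈ U) : AnalyticAt ℂ ψ z := R.df.analyticAt (R.op.mem_nhds hz)

lemma nb (C : Cv T w) (R : Rm w U ψ) {s : ℝ} {g : ℂ → ℂ} {v : ℂ} {k : ℕ} (hg : ContinuousAt g (w s)) (he : ∀ᶠ z in 𝓝 (w s), ψ z = ψ (w s) + (z - w s) ^ k * g z)
    (hv : 0 < (conj (deriv w s) * v).im) : (conj (ψ (w s)) * (v ^ k * g (w s))).re ≤ 0 := by
  by_contra! h
  have t0 : Tendsto (fun r : ℝ => ((r:ℝ), v)) (𝓝[>] 0) (𝓝 ((0:ℝ), v)) :=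
    (Continuous.tendsto' (by fun_prop) _ _ rfl).mono_left nhdsWithin_le_nhds
  have t1 : Tendsto (fun r : ℝ => w s + r * v) (𝓝[>] 0) (𝓝 (w s)) :=
    (Continuous.tendsto' (by fun_prop) _ _ (by simp)).mono_left nhdsWithin_le_nhds
  have t2 : Tendsto (fun r : ℝ => (conj (ψ (w s)) * (v ^ k * g (w s + r * v))).re) (𝓝[>] 0) (𝓝 (conj (ψ (w s)) * (v ^ k * g (w s))).re) :=
    (continuous_re.tendsto _).comp (((hg.tendsto.comp t1).const_mul _).const_mul _)
  have h1 := t0.eventually (C.TC hv)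
  obtain ⟨r, h1, h2, h3, h4⟩ := (h1.and ((t1.eventually he).and ((t2.eventually (lt_mem_nhds h)).and self_mem_nhdsWithin))).exists
  have h4 : 0 < r := h4
  have h5 := R.lt _ (h1 h4)
  simp only at h5
  rw [h2, show w s + r * v - w s = r * v by ring] at h5
  have h6 := normSq_add (ψ (w s)) ((r * v) ^ k * g (w s + r * v))
  rw [normSq_eq_norm_sq, normSq_eq_norm_sq (ψ (w s)), R.bd s] at h6
  have h7 : (ψ (w s) * conj ((r * v) ^ k * g (w s + r * v))).re = r ^ k * (conj (ψ (w s)) * (v ^ k * g (w s + r * v))).re := by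
    rw [← conj_re, ← re_ofReal_mul]; congr 1
    simp; ring
  rw [h7] at h6
  have h8 : 0 < r ^ k * (conj (ψ (w s)) * (v ^ k * g (w s + r * v))).re := mul_pos (pow_pos h4 k) h3
  have h9 := normSq_nonneg ((r * v) ^ k * g (w s + r * v))
  nlinarith [norm_nonneg (ψ (w s) + (r * v) ^ k * g (w s + r * v))]

lemma dneb (C : Cv T w) (R : Rm w U ψ) (s : ℝ) : deriv ψ (w s) ≠ 0 := by
  intro h0
  have ha := ran R (R.sub (C.range_closure s))
  have hf : AnalyticAt ℂ (fun z => ψ z - ψ (w s)) (w s) := ha.sub analyticAt_const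
  obtain ⟨k, g, hg, hg0, he⟩ := hf.exists_eventuallyEq_pow_smul_nonzero_iff.2 fun h => by
    obtain ⟨x, hx1, hx2⟩ := mem_closure_iff_frequently.1 (C.range_closure s) |>.and_eventually h |>.exists
    have := R.lt x hx1
    rw [sub_eq_zero.1 hx2, R.bd] at this; linarith
  have he' : ∀ᶠ z in 𝓝 (w s), ψ z = ψ (w s) + (z - w s) ^ k * g z := he.mono fun z hz => by
    rw [smul_eq_mul] at hz; rw [← hz]; ring
  have hk : 2 ≤ k := by
    by_contra! hk
    interval_cases k
    · have := he.self_of_nhds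
      simp at this; exact hg0 this.symm
    · have h1 : HasDerivAt (fun z => ψ (w s) + (z - w s) ^ 1 * g z) (1 * g (w s) + (w s - w s) ^ 1 * deriv g (w s)) (w s) :=
        ((((hasDerivAt_id (w s)).sub_const (w s)).congr_of_eventuallyEq (by simp)).mul hg.differentiableAt.hasDerivAt).const_add _
      have h2 := (h1.congr_of_eventuallyEq he').deriv
      rw [h0] at h2; simp at h2; exact hg0 h2.symm
  have hk0 : (0:ℝ) < k := by positivity
  have key : ∀ β : ℝ, 0 < β → β < 2 * Real.pi → (conj (ψ (w s)) * (deriv w s ^ k * g (w s)) * exp (β * I)).re ≤ 0 := by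
    intro β b1 b2
    have hv : 0 < (conj (deriv w s) * (deriv w s * exp ((β / k : ℝ) * I))).im := by
      rw [← mul_assoc, mul_comm (conj _), mul_conj, im_ofReal_mul, exp_ofReal_mul_I_im]
      refine mul_pos (normSq_pos.2 (C.ne s)) (Real.sin_pos_of_pos_of_lt_pi (by positivity) ?_)
      rw [div_lt_iff₀ hk0]
      have : (2:ℝ) ≤ k := by exact_mod_cast hk
      nlinarith [Real.pi_pos]
    have := C.nb R hg.continuousAt he' hv
    rw [mul_pow, ← exp_nat_mul] at this
    convert this using 2
    have : ((k:ℂ) * ((β / k : ℝ) * I)) = β * I := by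
      have : (k:ℂ) ≠ 0 := by exact_mod_cast hk0.ne'
      push_cast; field_simp
    rw [this]; ring
  set A := conj (ψ (w s)) * (deriv w s ^ k * g (w s))
  have hA : A ≠ 0 := by
    refine mul_ne_zero ?_ (mul_ne_zero (pow_ne_zero _ (C.ne s)) hg0)
    rw [Ne, map_eq_zero, ← norm_eq_zero, R.bd]; exact one_ne_zero
  have pp := Real.pi_pos
  have k1 := key (Real.pi / 3) (by positivity) (by linarith)
  have k2 := key Real.pi pp (by linarith)
  have k3 := key (2 * Real.pi - Real.pi / 3) (by linarith) (by linarith)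
  rw [mul_re, exp_ofReal_mul_I_re, exp_ofReal_mul_I_im] at k1 k2 k3
  simp only [Real.cos_two_pi_sub, Real.sin_two_pi_sub, Real.cos_pi_div_three, Real.sin_pi_div_three, Real.cos_pi, Real.sin_pi] at k1 k2 k3
  have h3 := Real.sqrt_pos.2 (show (0:ℝ) < 3 by norm_num)
  have e1 : A.re = 0 := by linarith
  rw [e1] at k1 k3
  have e2 : A.im = 0 := by nlinarith
  exact hA (Complex.ext e1 e2)

lemma thp (C : Cv T w) (R : Rm w U ψ) (s : ℝ) : (conj (ψ (w s)) * (deriv ψ (w s) * deriv w s)).re = 0 ∧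
    0 < (conj (ψ (w s)) * (deriv ψ (w s) * deriv w s)).im := by
  have ha := ran R (R.sub (C.range_closure s))
  have h1 : HasDerivAt (fun s => ψ (w s)) (deriv ψ (w s) * deriv w s) s := ha.differentiableAt.hasDerivAt.comp s (C.hd s)
  have hre : (conj (ψ (w s)) * (deriv ψ (w s) * deriv w s)).re = 0 := by
    have h2 := h1.norm_sq
    have h3 : HasDerivAt (fun s => ‖ψ (w s)‖ ^ 2) 0 s := by simp only [R.bd]; exact hasDerivAt_const _ _
    have := h2.unique h3
    simp only [Complex.inner] at this
    linarith [this, congrArg re (mul_comm (conj (ψ (w s))) (deriv ψ (w s) * deriv w s))]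
  refine ⟨hre, lt_of_le_of_ne ?_ ?_⟩
  · have h2 := C.nb R (s := s) (g := dslope ψ (w s)) (v := deriv w s * I) (k := 1) (continuousAt_dslope_same.2 ha.differentiableAt)
      (Eventually.of_forall fun z => by
        have := sub_smul_dslope ψ (w s) z
        rw [smul_eq_mul] at this; rw [pow_one, this]; ring) (by
        rw [← mul_assoc, mul_comm (conj _), mul_conj, im_ofReal_mul, I_im, mul_one]; exact normSq_pos.2 (C.ne s))
    rw [dslope_same, show conj (ψ (w s)) * ((deriv w s * I) ^ 1 * deriv ψ (w s)) = conj (ψ (w s)) * (deriv ψ (w s) * deriv w s) * I by ring, mul_I_re] at h2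
    linarith
  · intro h
    have := Complex.ext (z := conj (ψ (w s)) * (deriv ψ (w s) * deriv w s)) (w := 0) hre h.symm
    refine mul_ne_zero ?_ (mul_ne_zero (C.dneb R s) (C.ne s)) this
    rw [Ne, map_eq_zero, ← norm_eq_zero, R.bd]; exact one_ne_zero

lemma inward (C : Cv T w) (R : Rm w U ψ) (s : ℝ) : ∃ σ : ℝ → ℂ, Tendsto σ (𝓝[>] 0) (𝓝 (w s)) ∧ ∀ᶠ r in 𝓝[>] 0, σ r ∈ Om w ∧ ψ (σ r) = (1 - r : ℝ) * ψ (w s) := by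
  have ha := ran R (R.sub (C.range_closure s))
  have hs : HasStrictDerivAt ψ (deriv ψ (w s)) (w s) := ha.hasStrictDerivAt
  set σ0 := hs.localInverse ψ _ _ (C.dneb R s)
  have h1 : HasStrictDerivAt σ0 (deriv ψ (w s))⁻¹ (ψ (w s)) := hs.to_localInverse (C.dneb R s)
  have h2 : ∀ᶠ y in 𝓝 (ψ (w s)), ψ (σ0 y) = y := hs.eventually_right_inverse (C.dneb R s)
  have h3 : σ0 (ψ (w s)) = w s := HasStrictFDerivAt.localInverse_apply_image _
  have h4 : HasDerivAt (fun r : ℝ => ((1 - r : ℝ) : ℂ) * ψ (w s)) (((-1 : ℝ) : ℂ) * ψ (w s)) 0 :=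
    (((hasDerivAt_id (0:ℝ)).const_sub 1).ofReal_comp).mul_const _
  have h5 : HasDerivAt (fun r : ℝ => σ0 ((1 - r : ℝ) * ψ (w s))) ((deriv ψ (w s))⁻¹ * (((-1 : ℝ) : ℂ) * ψ (w s))) 0 :=
    HasDerivAt.comp (h₂ := σ0) 0 (by simpa using h1.hasDerivAt) h4
  have t0 : Tendsto (fun r : ℝ => ((1 - r : ℝ) : ℂ) * ψ (w s)) (𝓝[>] 0) (𝓝 (ψ (w s))) := by
    have := h4.continuousAt.tendsto
    simp only [sub_zero, ofReal_one, one_mul] at this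
    exact this.mono_left nhdsWithin_le_nhds
  have t1 : Tendsto (fun r : ℝ => σ0 ((1 - r : ℝ) * ψ (w s))) (𝓝[>] 0) (𝓝 (w s)) := by
    have := h1.hasDerivAt.continuousAt.tendsto.comp t0
    rwa [h3] at this
  refine ⟨_, t1, ?_⟩
  have hv : 0 < (conj (deriv w s) * ((deriv ψ (w s))⁻¹ * (((-1 : ℝ) : ℂ) * ψ (w s)))).im := by
    obtain ⟨e1, e2⟩ := C.thp R s
    have hn := C.dneb R s
    set θ := (conj (ψ (w s)) * (deriv ψ (w s) * deriv w s)).im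
    have e3 : conj (ψ (w s)) * (deriv ψ (w s) * deriv w s) = θ * I := by apply Complex.ext <;> simp [e1, θ]
    have e4 : ψ (w s) * conj (ψ (w s)) = 1 := by rw [mul_conj, normSq_eq_norm_sq, R.bd s]; simp
    have e5 : conj (deriv w s) * ((deriv ψ (w s))⁻¹ * (((-1 : ℝ) : ℂ) * ψ (w s))) = ((normSq (deriv w s) / θ : ℝ) : ℂ) * I := by
      have e6 : (θ:ℂ) ≠ 0 := by exact_mod_cast e2.ne'
      push_cast
      rw [← mul_conj]
      field_simp
      linear_combination (-conj (deriv w s) * I * ψ (w s)) * e3 + (conj (deriv w s) * I * deriv ψ (w s) * deriv w s) * e4 + (-conj (deriv w s) * ψ (w s) * θ) * I_sq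
    rw [e5, im_ofReal_mul, I_im, mul_one]
    exact div_pos (normSq_pos.2 (C.ne s)) e2
  have t2 := h5.tendsto_slope_zero_right
  have t3 := ((tendsto_id.mono_right nhdsWithin_le_nhds).prodMk_nhds t2).eventually (C.TC hv)
  filter_upwards [t3, t0.eventually h2, self_mem_nhdsWithin] with r r1 r2 r3
  refine ⟨?_, r2⟩
  have r3 : 0 < r := r3
  have := r1 r3
  simp only [id, zero_add, sub_zero, ofReal_one, one_mul, h3, real_smul] at this
  rwa [← mul_assoc, ofReal_inv, mul_inv_cancel₀ (by exact_mod_cast r3.ne'), one_mul, add_sub_cancel] at this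

lemma binj (C : Cv T w) (R : Rm w U ψ) {s s' : ℝ} (h : ψ (w s) = ψ (w s')) : w s = w s' := by
  obtain ⟨σ, a1, a2⟩ := C.inward R s
  obtain ⟨τ, b1, b2⟩ := C.inward R s'
  refine tendsto_nhds_unique_of_eventuallyEq a1 b1 ?_
  filter_upwards [a2, b2] with r r1 r2
  exact R.inj r1.1 r2.1 (by rw [r1.2, r2.2, h])

lemma cinj (C : Cv T w) (R : Rm w U ψ) : InjOn ψ (closure (Om w)) := by
  intro x hx y hy h
  rcases C.closure_cases hx with h1 | ⟨s, rfl⟩ <;> rcases C.closure_cases hy with h2 | ⟨s', rfl⟩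
  · exact R.inj h1 h2 h
  · have := R.lt _ h1; rw [h, R.bd] at this; linarith
  · have := R.lt _ h2; rw [← h, R.bd] at this; linarith
  · exact C.binj R h

lemma opn {V : Set ℂ} (hV : IsOpen V) (h : ∀ z ∈ V, AnalyticAt ℂ ψ z ∧ deriv ψ z ≠ 0) : IsOpen (ψ '' V) := by
  rw [isOpen_iff_mem_nhds]
  rintro _ ⟨z, hz, rfl⟩
  rw [← (h z hz).1.hasStrictDerivAt.map_nhds_eq (h z hz).2]
  exact image_mem_map (hV.mem_nhds hz)

lemma surj (C : Cv T w) (R : Rm w U ψ) : closedBall 0 1 ⊆ ψ '' closure (Om w) := by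
  have hc : IsCompact (ψ '' closure (Om w)) := C.compact_cl.image_of_continuousOn (R.df.continuousOn.mono R.sub)
  have h1 : ball 0 1 ⊆ ψ '' Om w := by
    refine IsPreconnected.subset_left_of_subset_union (v := (ψ '' closure (Om w))ᶜ) (opn C.open_Om fun z hz => ⟨ran R (R.sub (subset_closure hz)), R.dne z hz⟩) hc.isClosed.isOpen_compl ?_ ?_ ?_ (convex_ball 0 1).isPreconnected
    · exact disjoint_compl_right.mono_left (image_mono subset_closure)
    · intro ζ hζ
      by_cases h : ζ ∈ ψ '' closure (Om w)
      · obtain ⟨z, hz, rfl⟩ := h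
        rcases C.closure_cases hz with h | ⟨s, rfl⟩
        · exact Or.inl ⟨z, h, rfl⟩
        · rw [mem_ball_zero_iff, R.bd] at hζ; linarith
      · exact Or.inr h
    · obtain ⟨q, hq⟩ := C.nonempty_Om
      exact ⟨ψ q, mem_ball_zero_iff.2 (R.lt q hq), q, hq, rfl⟩
  rw [← closure_ball (0:ℂ) one_ne_zero]
  exact closure_minimal (h1.trans (image_mono subset_closure)) hc.isClosed

/-- Conformal map of the convex domain, extended across the boundary. -/
structure Cf (w : ℝ → ℂ) (V : Set ℂ) (ψ φ : ℂ → ℂ) (ρ : ℝ) : Prop where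
  hρ : 1 < ρ
  op : IsOpen V
  sub : closure (Om w) ⊆ V
  df : DifferentiableOn ℂ ψ V
  dne : ∀ z ∈ V, deriv ψ z ≠ 0
  df' : DifferentiableOn ℂ φ (ball 0 ρ)
  r : ∀ ζ ∈ ball (0:ℂ) ρ, φ ζ ∈ V ∧ ψ (φ ζ) = ζ
  l : ∀ z ∈ V, ψ z ∈ ball 0 ρ ∧ φ (ψ z) = z
  lt : ∀ z ∈ Om w, ‖ψ z‖ < 1
  bd : ∀ s, ‖ψ (w s)‖ = 1
  im : ∀ s, 0 < (conj (ψ (w s)) * (deriv ψ (w s) * deriv w s)).im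
  cl : ∀ ζ ∈ closedBall (0:ℂ) 1, φ ζ ∈ closure (Om w)

theorem P4 (C : Cv T w) : ∃ V ψ φ ρ, Cf w V ψ φ ρ := by
  obtain ⟨U, ψ, R⟩ := C.exists_Rm
  have hdn : ∀ z ∈ closure (Om w), deriv ψ z ≠ 0 := fun z hz => by
    rcases C.closure_cases hz with h | ⟨s, rfl⟩
    exacts [R.dne z h, C.dneb R s]
  obtain ⟨t, ht, hti⟩ := (C.cinj R).exists_mem_nhdsSet C.compact_cl (fun z hz => (ran R (R.sub hz)).continuousAt) (fun z hz =>
    ⟨_, (ran R (R.sub hz)).hasStrictDerivAt.hasStrictFDerivAt_equiv (hdn z hz) |>.toOpenPartialHomeomorph _ |>.open_source.mem_nhds (HasStrictFDerivAt.mem_toOpenPartialHomeomorph_source _), (HasStrictFDerivAt.toOpenPartialHomeomorph ψ _).injOn⟩)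
  obtain ⟨V1, o1, s1, s2⟩ := mem_nhdsSet_iff_exists.1 ht
  set V0 := (V1 ∩ U) ∩ {z | deriv ψ z ≠ 0} with hV0
  have oV0 : IsOpen V0 := ((R.df.analyticOnNhd R.op).deriv.continuousOn.mono inter_subset_right).isOpen_inter_preimage (o1.inter R.op) isOpen_compl_singleton
  have hV0s : closure (Om w) ⊆ V0 := fun z hz => ⟨⟨s1 hz, R.sub hz⟩, hdn z hz⟩
  have hi : InjOn ψ V0 := hti.mono fun z hz => s2 hz.1.1
  have han : ∀ z ∈ V0, AnalyticAt ℂ ψ z ∧ deriv ψ z ≠ 0 := fun z hz => ⟨ran R hz.1.2, hz.2⟩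
  obtain ⟨δ, hδ, hδs⟩ := (isCompact_closedBall (0:ℂ) 1).exists_thickening_subset_open (opn oV0 han) ((C.surj R).trans (image_mono hV0s))
  rw [thickening_closedBall hδ zero_le_one] at hδs
  set φ := Function.invFunOn ψ V0
  have hl : ∀ z ∈ V0, φ (ψ z) = z := fun z hz => hi.leftInvOn_invFunOn hz
  have hr : ∀ ζ ∈ ball (0:ℂ) (δ + 1), φ ζ ∈ V0 ∧ ψ (φ ζ) = ζ := fun ζ hζ => ⟨Function.invFunOn_mem (hδs hζ), Function.invFunOn_eq (hδs hζ)⟩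
  have hle : ∀ z ∈ closure (Om w), ‖ψ z‖ ≤ 1 := fun z hz => by
    rcases C.closure_cases hz with h | ⟨s, rfl⟩
    exacts [(R.lt z h).le, (R.bd s).le]
  refine ⟨V0 ∩ ψ ⁻¹' (ball 0 (δ + 1)), ψ, φ, δ + 1, by linarith, ?_, ?_, R.df.mono fun z hz => hz.1.1.2, fun z hz => hz.1.2, ?_, ?_, fun z hz => ⟨hz.2, hl z hz.1⟩, R.lt, R.bd, fun s => (C.thp R s).2, ?_⟩
  · exact (R.df.continuousOn.mono fun z hz => hz.1.2).isOpen_inter_preimage oV0 isOpen_ball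
  · exact fun z hz => ⟨hV0s hz, mem_ball_zero_iff.2 (by linarith [hle z hz])⟩
  · intro ζ hζ
    obtain ⟨h1, h2⟩ := hr ζ hζ
    obtain ⟨h3, h4⟩ := han _ h1
    have hc : ContinuousAt φ ζ := by
      have e := h3.hasStrictDerivAt.map_nhds_eq h4
      rw [h2] at e
      rw [ContinuousAt, ← e, tendsto_map'_iff]
      refine tendsto_id.congr' ?_
      filter_upwards [oV0.mem_nhds h1] with z hz using (hl z hz).symm
    exact (HasDerivAt.of_local_left_inverse hc h3.differentiableAt.hasDerivAt h4
      (by filter_upwards [isOpen_ball.mem_nhds hζ] with y hy using (hr y hy).2)).differentiableAt.differentiableWithinAt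
  · exact fun ζ hζ => ⟨⟨(hr ζ hζ).1, by rw [mem_preimage, (hr ζ hζ).2]; exact hζ⟩, (hr ζ hζ).2⟩
  · intro ζ hζ
    obtain ⟨z, hz, rfl⟩ := C.surj R hζ
    rw [hl z (hV0s hz)]; exact hz
end Cv
lemma lift_arg {T : ℝ} (hT : 0 < T) {Z : ℝ → ℂ} {θ : ℝ → ℝ} (hc : Continuous θ) (hp : ∀ s, 0 < θ s) (hθ : ∀ s, θ (s + T) = θ s)
    (hZ : ∀ s, HasDerivAt Z (θ s * I * Z s) s) (h1 : ∀ s, ‖Z s‖ = 1) (hper : ∀ s, Z (s + T) = Z s) (hinj : InjOn Z (Ico 0 T)) :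
    ∃ Θ : ℝ → ℝ, (∀ s, HasDerivAt Θ (θ s) s) ∧ (∀ s, Z s = exp (Θ s * I)) ∧ ∀ s, Θ (s + T) = Θ s + 2 * Real.pi := by
  set Θ : ℝ → ℝ := fun s => arg (Z 0) + ∫ x in (0:ℝ)..s, θ x with hΘ
  have hd : ∀ s, HasDerivAt Θ (θ s) s := fun s => (hc.integral_hasStrictDerivAt 0 s).hasDerivAt.const_add _
  have he : ∀ s, Z s = exp (Θ s * I) := by
    have d1 : ∀ s, HasDerivAt (fun s => Z s * exp (-(Θ s * I))) 0 s := fun s => by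
      have := (hZ s).mul (((hd s).ofReal_comp.mul_const I).neg.cexp)
      refine this.congr_deriv ?_
      simp only [Pi.neg_apply]; ring
    intro s
    have := is_const_of_deriv_eq_zero (fun s => (d1 s).differentiableAt) (fun s => (d1 s).deriv) s 0
    have h0 : Z 0 * exp (-(Θ 0 * I)) = 1 := by
      have e : Z 0 = exp (Θ 0 * I) := by
        have := norm_mul_exp_arg_mul_I (Z 0)
        rw [h1, ofReal_one, one_mul] at this
        simp [hΘ, this]
      rw [e, ← exp_add]; simp
    rw [h0, exp_neg] at this
    exact (div_eq_one_iff_eq (exp_ne_zero _)).1 this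
  refine ⟨Θ, hd, he, ?_⟩
  have hmono : StrictMono Θ := strictMono_of_deriv_pos fun s => by rw [(hd s).deriv]; exact hp s
  have hct : Continuous Θ := continuous_iff_continuousAt.2 fun s => (hd s).continuousAt
  have d2 : ∀ s, HasDerivAt (fun s => Θ (s + T) - Θ s) 0 s := fun s => by
    refine (((hd (s + T)).comp_add_const s T).sub (hd s)).congr_deriv ?_
    rw [hθ, sub_self]
  have hcst : ∀ s, Θ (s + T) - Θ s = Θ (0 + T) - Θ 0 := fun s => is_const_of_deriv_eq_zero (fun s => (d2 s).differentiableAt) (fun s => (d2 s).deriv) s 0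
  obtain ⟨n, hn⟩ := Complex.exp_eq_exp_iff_exists_int.1 ((he (0 + T)).symm.trans ((hper 0).trans (he 0)))
  have hn : Θ (0 + T) = Θ 0 + n * (2 * Real.pi) := by
    have : ((Θ (0 + T) : ℝ) : ℂ) * I = ((Θ 0 + n * (2 * Real.pi) : ℝ) : ℂ) * I := by rw [hn]; push_cast; ring
    exact_mod_cast mul_right_cancel₀ I_ne_zero this
  have hlt := hmono (show (0:ℝ) < 0 + T by linarith)
  have n0 : 0 < n := by
    have : (0:ℝ) < n := by
      by_contra h
      nlinarith [Real.pi_pos]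
    exact_mod_cast this
  have n1 : n = 1 := by
    by_contra h
    have h2 : (2:ℝ) ≤ n := by
      have : 2 ≤ n := by omega
      exact_mod_cast this
    obtain ⟨s, hs, hs'⟩ := intermediate_value_Ioo (show (0:ℝ) ≤ 0 + T by linarith) hct.continuousOn (show Θ 0 + 2 * Real.pi ∈ Ioo (Θ 0) (Θ (0 + T)) from
      ⟨by linarith [Real.pi_pos], by rw [hn]; nlinarith [Real.pi_pos]⟩)
    have e : Z s = Z 0 := by rw [he, he, hs']; push_cast; rw [add_mul, exp_add, exp_two_pi_mul_I, mul_one]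
    have := hinj ⟨hs.1.le, by linarith [hs.2]⟩ ⟨le_rfl, hT⟩ e
    linarith [hs.1]
  intro s
  have := hcst s
  rw [hn, n1] at this; push_cast at this; linarith

lemma sgn {F : ℝ → ℝ} (hF : Continuous F) (h : ∀ s, (∀ᶠ x in 𝓝[≠] s, 0 < F x) ∨ ∀ᶠ x in 𝓝[≠] s, F x < 0) :
    (∀ x, 0 ≤ F x) ∨ ∀ x, F x ≤ 0 := by
  have op : ∀ Q : ℝ → Prop, IsOpen {s | ∀ᶠ x in 𝓝[≠] s, Q x} := fun Q => by
    rw [isOpen_iff_eventually]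
    intro s hs
    have h1 := eventually_nhdsWithin_iff.1 (show ∀ᶠ x in 𝓝[≠] s, Q x from hs)
    filter_upwards [eventually_eventually_nhds.2 h1] with y hy
    by_cases e : y = s
    · subst e; exact hs
    · show ∀ᶠ x in 𝓝[≠] y, Q x
      refine Eventually.filter_mono nhdsWithin_le_nhds ?_
      filter_upwards [hy, isOpen_compl_singleton.mem_nhds (show y ∈ ({s}ᶜ : Set ℝ) from e)] with x h1 h2 using h1 h2
  have cl : IsClopen {s | ∀ᶠ x in 𝓝[≠] s, 0 < F x} := by
    refine ⟨⟨?_⟩, op _⟩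
    convert op (fun x => F x < 0) using 1
    ext s
    refine ⟨fun hs => (h s).resolve_left hs, fun hs hs' => ?_⟩
    obtain ⟨x, h1, h2⟩ := ((show ∀ᶠ x in 𝓝[≠] s, F x < 0 from hs).and (show ∀ᶠ x in 𝓝[≠] s, 0 < F x from hs')).exists
    exact lt_asymm h1 h2
  rcases isClopen_iff.1 cl with e | e
  · right; intro x
    have : ∀ᶠ y in 𝓝[≠] x, F y < 0 := (h x).resolve_left fun hx => by
      have : x ∈ {s | ∀ᶠ x in 𝓝[≠] s, 0 < F x} := hx
      rw [e] at this; exact this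
    exact le_of_tendsto (hF.continuousAt.tendsto.mono_left nhdsWithin_le_nhds) (this.mono fun _ h => h.le)
  · left; intro x
    have : x ∈ {s | ∀ᶠ x in 𝓝[≠] s, 0 < F x} := e ▸ mem_univ x
    exact ge_of_tendsto (hF.continuousAt.tendsto.mono_left nhdsWithin_le_nhds) (Eventually.mono this fun _ h => h.le)

lemma loc_sgn {F G : ℝ → ℝ} {h : ℝ} {n : ℕ} (hG : ContinuousAt G h) (h0 : G h ≠ 0) (he : ∀ᶠ x in 𝓝 h, F x = ((x - h) ^ n) ^ 2 * G x) :
    (∀ᶠ x in 𝓝[≠] h, 0 < F x) ∨ ∀ᶠ x in 𝓝[≠] h, F x < 0 := by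
  rcases lt_or_gt_of_ne h0 with h1 | h1
  · right
    filter_upwards [nhdsWithin_le_nhds he, nhdsWithin_le_nhds (hG.eventually (gt_mem_nhds h1)), self_mem_nhdsWithin] with x e g x0
    have : x - h ≠ 0 := sub_ne_zero.2 x0
    rw [e]; exact mul_neg_of_pos_of_neg (by positivity) g
  · left
    filter_upwards [nhdsWithin_le_nhds he, nhdsWithin_le_nhds (hG.eventually (lt_mem_nhds h1)), self_mem_nhdsWithin] with x e g x0
    have : x - h ≠ 0 := sub_ne_zero.2 x0
    rw [e]; exact mul_pos (by positivity) g
/-- Zeros counted with multiplicity over a period: at most four. -/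
def Cnt (T : ℝ) (u : ℝ → ℝ) : Prop := ∀ S : Finset ℝ, (∀ s ∈ S, s ∈ Ico 0 T) → ∀ m : ℝ → ℕ, (∀ s ∈ S, (m s : ℕ∞) ≤ analyticOrderAt u s) → ∑ s ∈ S, m s ≤ 4

lemma Cnt.ne_top {T : ℝ} {u : ℝ → ℝ} (h : Cnt T u) {s : ℝ} (hs : s ∈ Ico 0 T) : analyticOrderAt u s ≠ ⊤ := fun e => by
  have := h {s} (by simpa using hs) (fun _ => 5) (by simp [e])
  simp at this

lemma Cnt.fin {T : ℝ} {u : ℝ → ℝ} (hu : AnalyticOnNhd ℝ u univ) (h : Cnt T u) : {s | s ∈ Ico 0 T ∧ u s = 0}.Finite := by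
  by_contra hi
  obtain ⟨S, hS, hc⟩ := Set.Infinite.exists_subset_card_eq hi 5
  have := h S (fun s hs => (hS hs).1) (fun _ => 1) fun s hs => by
    have := (hu s (mem_univ s)).analyticOrderAt_ne_zero.2 (hS hs).2
    simpa using Order.one_le_iff_ne_zero.2 this
  simp [hc] at this

lemma SH {T : ℝ} (hT : 0 < T) {Z : ℝ → ℂ} {θ : ℝ → ℝ} (hc : Continuous θ) (hp : ∀ s, 0 < θ s) (hθ : ∀ s, θ (s + T) = θ s)
    (hZ : ∀ s, HasDerivAt Z (θ s * I * Z s) s) (h1 : ∀ s, ‖Z s‖ = 1) (hper : ∀ s, Z (s + T) = Z s) (hinj : InjOn Z (Ico 0 T))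
    {u : ℝ → ℝ} (hu : AnalyticOnNhd ℝ u univ) (hup : ∀ s, u (s + T) = u s) (hcnt : Cnt T u) {ρ : ℝ} (hρ : 1 < ρ) {χ : ℂ → ℂ}
    (hχ : DifferentiableOn ℂ χ (ball 0 ρ)) {z0 : ℂ} (hz0 : ‖z0‖ ≤ 1) (hbd : ‖z0‖ = 1 → ∃ s ∈ Ico 0 T, Z s = z0)
    (huz : ∀ s, u s = ((Z s - z0) ^ 3 * χ (Z s)).re) : False := by
  obtain ⟨Θ, hΘ, hZe, hΘp⟩ := lift_arg hT hc hp hθ hZ h1 hper hinj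
  have hΘc : Continuous Θ := continuous_iff_continuousAt.2 fun s => (hΘ s).continuousAt
  have hZc : Continuous Z := continuous_iff_continuousAt.2 fun s => (hZ s).continuousAt
  have huc : Continuous u := continuous_iff_continuousAt.2 fun s => (hu s (mem_univ s)).continuousAt
  have hZ0 : ∀ s, Z s ≠ 0 := fun s h => by have := h1 s; rw [h] at this; simp at this
  have hZb : ∀ s, Z s ∈ ball (0:ℂ) ρ := fun s => by rw [mem_ball_zero_iff, h1]; exact hρ
  set n : ℝ → ℕ := fun s => analyticOrderNatAt u s
  set S := (hcnt.fin hu).toFinset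
  have hS : ∀ s, s ∈ S ↔ s ∈ Ico 0 T ∧ u s = 0 := fun s => by simp [S]
  have hn : ∀ s ∈ Ico 0 T, (n s : ℕ∞) = analyticOrderAt u s := fun s hs => Nat.cast_analyticOrderNatAt (hcnt.ne_top hs)
  set N := ∑ s ∈ S, n s with hN
  have hN4 : N ≤ 4 := hcnt S (fun s hs => ((hS s).1 hs).1) n fun s hs => (hn s ((hS s).1 hs).1).le
  have hfac : ∀ s ∈ Ico 0 T, ∃ v : ℝ → ℝ, AnalyticAt ℝ v s ∧ v s ≠ 0 ∧ ∀ᶠ x in 𝓝 s, u x = (x - s) ^ n s * v x := fun s hs => by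
    simpa using (hu s (mem_univ s)).analyticOrderAt_eq_natCast.1 (hn s hs).symm
  -- trigonometric polynomial
  set k : ℝ → ℝ → ℝ := fun a x => Real.sin ((Θ x - Θ a) / 2) with hk
  have hkc : ∀ a, Continuous (k a) := fun a => by fun_prop
  have hkp : ∀ a x, k a (x + T) = -k a x := fun a x => by
    simp only [hk]
    rw [hΘp, show (Θ x + 2 * Real.pi - Θ a) / 2 = (Θ x - Θ a) / 2 + Real.pi by ring, Real.sin_add_pi]
  have hkZ : ∀ a x, (2 * I * exp (Θ a / 2 * I)) * (exp (Θ x / 2 * I) * k a x) = Z x - Z a := fun a x => by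
    have e : ∀ y, Z y = exp (Θ y / 2 * I) ^ 2 := fun y => by rw [hZe, ← exp_nat_mul]; congr 1; push_cast; ring
    simp only [hk]
    rw [e x, e a, ofReal_sin, Complex.sin, show -(((Θ x - Θ a) / 2 : ℝ) : ℂ) * I = Θ a / 2 * I - Θ x / 2 * I by push_cast; ring,
      show (((Θ x - Θ a) / 2 : ℝ) : ℂ) * I = Θ x / 2 * I - Θ a / 2 * I by push_cast; ring, exp_sub, exp_sub]
    have e1 := exp_ne_zero (Θ a / 2 * I)
    have e2 := exp_ne_zero (Θ x / 2 * I)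
    generalize exp (Θ a / 2 * I) = A at *
    generalize exp (Θ x / 2 * I) = B at *
    field_simp
    linear_combination (A ^ 2 - B ^ 2) * I_sq
  have hk0 : ∀ a ∈ Ico 0 T, ∀ x ∈ Ico 0 T, a ≠ x → k a x ≠ 0 := fun a ha x hx hax h => by
    have := hkZ a x
    rw [h] at this
    simp only [ofReal_zero, mul_zero] at this
    exact hax (hinj ha hx (sub_eq_zero.1 this.symm).symm)
  have hkd : ∀ a, HasDerivAt (k a) (θ a / 2) a := fun a => by
    have := (((hΘ a).sub_const (Θ a)).div_const 2).sin
    simpa using this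
  set g : ℝ → ℝ := fun x => ∏ a ∈ S, k a x ^ n a with hg
  have hgc : Continuous g := continuous_finsetProd _ fun a _ => (hkc a).pow _
  have hgp : ∀ x, g (x + T) = (-1) ^ N * g x := fun x => by
    simp only [hg, hkp]
    rw [hN, ← Finset.prod_pow_eq_pow_sum, ← Finset.prod_mul_distrib]
    exact Finset.prod_congr rfl fun a _ => by rw [neg_pow]
  set F : ℝ → ℝ := fun x => u x * g x with hF
  have hFp : ∀ x, F (x + T) = (-1) ^ N * F x := fun x => by simp only [hF, hup, hgp]; ring
  have hloc0 : ∀ h ∈ Ico 0 T, (∀ᶠ x in 𝓝[≠] h, 0 < F x) ∨ ∀ᶠ x in 𝓝[≠] h, F x < 0 := by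
    intro h hh
    obtain ⟨v, v1, v2, v3⟩ := hfac h hh
    by_cases hhS : h ∈ S
    · refine loc_sgn (G := fun x => v x * (dslope (k h) h x ^ n h * ∏ a ∈ S.erase h, k a x ^ n a)) ?_ ?_ ?_ (n := n h)
      · exact v1.continuousAt.mul (((continuousAt_dslope_same.2 (hkd h).differentiableAt).pow _).mul (continuous_finsetProd _ fun a _ => (hkc a).pow _).continuousAt)
      · refine mul_ne_zero v2 (mul_ne_zero (pow_ne_zero _ ?_) (Finset.prod_ne_zero_iff.2 fun a ha => pow_ne_zero _ (hk0 a ((hS a).1 (Finset.mem_of_mem_erase ha)).1 h hh (Finset.ne_of_mem_erase ha))))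
        rw [dslope_same, (hkd h).deriv]
        exact (half_pos (hp h)).ne'
      · filter_upwards [v3] with x hx
        have e := sub_smul_dslope (k h) h x
        rw [smul_eq_mul, show k h h = 0 by simp [hk], sub_zero] at e
        simp only [hF, hg]
        rw [hx, ← Finset.mul_prod_erase S _ hhS, ← e, mul_pow]; ring
    · have hu0 : u h ≠ 0 := fun e => hhS ((hS h).2 ⟨hh, e⟩)
      refine loc_sgn (G := F) (n := 0) (huc.mul hgc).continuousAt (mul_ne_zero hu0 (Finset.prod_ne_zero_iff.2 fun a ha => pow_ne_zero _ (hk0 a ((hS a).1 ha).1 h hh fun e => hhS (e ▸ ha)))) (Eventually.of_forall fun x => by simp)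
  have hFpn : ∀ m : ℕ, ∀ x, F (x + m * T) = ((-1) ^ N) ^ m * F x := fun m => by
    induction m with
    | zero => intro x; simp
    | succ m ih => intro x; rw [pow_succ, mul_assoc, ← hFp, show x + ((m + 1 : ℕ) : ℝ) * T = (x + T) + m * T by push_cast; ring, ih]
  have hFz : ∀ m : ℤ, ∃ ε : ℝ, (ε = 1 ∨ ε = -1) ∧ ∀ x, F (x + m * T) = ε * F x := fun m => by
    have hpm : ∀ j : ℕ, (((-1:ℝ) ^ N) ^ j = 1 ∨ ((-1:ℝ) ^ N) ^ j = -1) := fun j => by rw [← pow_mul]; exact neg_one_pow_eq_or ℝ _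
    obtain ⟨j, rfl | rfl⟩ := m.eq_nat_or_neg
    · exact ⟨_, hpm j, fun x => by simpa using hFpn j x⟩
    · refine ⟨_, hpm j, fun x => ?_⟩
      have := hFpn j (x + ((-(j:ℤ) : ℤ) : ℝ) * T)
      rw [show x + ((-(j:ℤ) : ℤ) : ℝ) * T + j * T = x by push_cast; ring] at this
      rw [this, ← mul_assoc]
      rcases hpm j with h | h <;> rw [h] <;> ring
  have hloc : ∀ s, (∀ᶠ x in 𝓝[≠] s, 0 < F x) ∨ ∀ᶠ x in 𝓝[≠] s, F x < 0 := by
    intro s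
    obtain ⟨h, hh, m, hm⟩ := Ico_rep hT 0 s
    rw [zero_add] at hh
    obtain ⟨ε, he, hε⟩ := hFz m
    have tr : Tendsto (fun x => x - m * T) (𝓝[≠] s) (𝓝[≠] h) := by
      refine tendsto_nhdsWithin_of_tendsto_nhds_of_eventually_within _ ((Continuous.tendsto' (by fun_prop) _ _ (by rw [hm]; ring)).mono_left nhdsWithin_le_nhds) ?_
      filter_upwards [self_mem_nhdsWithin] with x hx e
      exact hx (by rw [mem_singleton_iff] at e ⊢; linarith)
    have hx : ∀ x, F x = ε * F (x - m * T) := fun x => by rw [← hε]; congr 1; ring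
    rcases hloc0 h hh with q | q <;> rcases he with rfl | rfl
    · left; filter_upwards [tr.eventually q] with x h; rw [hx]; linarith
    · right; filter_upwards [tr.eventually q] with x h; rw [hx]; linarith
    · right; filter_upwards [tr.eventually q] with x h; rw [hx]; linarith
    · left; filter_upwards [tr.eventually q] with x h; rw [hx]; linarith
  have hFc : Continuous F := huc.mul hgc
  have hF0 : ∃ c ∈ Icc 0 T, F c ≠ 0 := by
    have : ∀ᶠ x in 𝓝[≠] (T/2), F x ≠ 0 := by
      rcases hloc (T/2) with h | h
      · exact h.mono fun _ h => h.ne'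
      · exact h.mono fun _ h => h.ne
    obtain ⟨c, c1, c2⟩ := (this.and (nhdsWithin_le_nhds (Icc_mem_nhds (show 0 < T/2 by linarith) (show T/2 < T by linarith)))).exists
    exact ⟨c, c2, c1⟩
  obtain ⟨ε, hε, hεF⟩ : ∃ ε : ℝ, (ε ≠ 0) ∧ ∀ x, 0 ≤ ε * F x := by
    rcases sgn hFc hloc with h | h
    · exact ⟨1, one_ne_zero, fun x => by linarith [h x]⟩
    · exact ⟨-1, by norm_num, fun x => by linarith [h x]⟩
  have hNe : Even N := by
    by_contra h
    rw [Nat.not_even_iff_odd] at h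
    obtain ⟨c, -, hc⟩ := hF0
    have a := hεF c
    have b := hεF (c + T)
    rw [hFp, h.neg_one_pow] at b
    exact mul_ne_zero hε hc (by linarith)
  obtain ⟨M, hM⟩ := hNe
  have hM2 : M ≤ 2 := by omega
  -- the polynomial
  obtain ⟨Q, ρ', hρ', hQ, hPQ⟩ : ∃ (Q : ℂ → ℂ) (ρ' : ℝ), 1 < ρ' ∧ DifferentiableOn ℂ Q (ball 0 ρ') ∧ ∀ s, ∏ a ∈ S, (Z s - Z a) ^ n a = (1 - conj z0 * Z s) ^ 3 * Q (Z s) := by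
    rcases hz0.lt_or_eq with hlt | heq
    · obtain ⟨δ, hδ, hδ'⟩ := (isCompact_closedBall (0:ℂ) 1).exists_thickening_subset_open (t := {z | 1 - conj z0 * z ≠ 0}) (isOpen_ne_fun (by fun_prop) (by fun_prop)) (fun z hz h => by
        have : ‖conj z0 * z‖ < 1 := by
          rw [norm_mul, RCLike.norm_conj]
          have := mem_closedBall_zero_iff.1 hz
          nlinarith [norm_nonneg z, norm_nonneg z0]
        rw [← sub_eq_zero.1 h] at this; simp at this)
      rw [thickening_closedBall hδ zero_le_one] at hδ'
      refine ⟨fun z => (∏ a ∈ S, (z - Z a) ^ n a) / (1 - conj z0 * z) ^ 3, δ + 1, by linarith, ?_, fun s => ?_⟩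
      · exact DifferentiableOn.div (by fun_prop) (by fun_prop) fun z hz => pow_ne_zero _ (hδ' hz)
      · rw [mul_div_cancel₀]
        exact pow_ne_zero _ (hδ' (by rw [mem_ball_zero_iff, h1]; linarith))
    · obtain ⟨a, ha, rfl⟩ := hbd heq
      obtain ⟨v, v1, v2, v3⟩ := hfac a ha
      have h3 : 3 ≤ n a := by
        by_contra! h3
        have t1 : ∀ᶠ x in 𝓝[≠] a, v x = (x - a) ^ (3 - n a) * (dslope Z a x ^ 3 * χ (Z x)).re := by
          filter_upwards [nhdsWithin_le_nhds v3, self_mem_nhdsWithin] with x hx hxa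
          have hxa' : x - a ≠ 0 := sub_ne_zero.2 hxa
          rw [huz] at hx
          have e := sub_smul_dslope Z a x
          rw [real_smul] at e
          rw [← e, mul_pow, mul_assoc, ← ofReal_pow, re_ofReal_mul] at hx
          refine mul_left_cancel₀ (pow_ne_zero (n a) hxa') ?_
          rw [← hx, ← mul_assoc, ← pow_add, show n a + (3 - n a) = 3 by omega]
        have t2 : Tendsto (fun x => (x - a) ^ (3 - n a) * (dslope Z a x ^ 3 * χ (Z x)).re) (𝓝[≠] a) (𝓝 ((a - a) ^ (3 - n a) * (dslope Z a a ^ 3 * χ (Z a)).re)) := by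
          refine Tendsto.mono_left (ContinuousAt.tendsto ?_) nhdsWithin_le_nhds
          refine ContinuousAt.mul (by fun_prop) (continuous_re.continuousAt.comp (((continuousAt_dslope_same.2 (hZ a).differentiableAt).pow 3).mul ?_))
          exact ContinuousAt.comp (x := a) (f := Z) (hχ.differentiableAt (isOpen_ball.mem_nhds (hZb a))).continuousAt hZc.continuousAt
        have := tendsto_nhds_unique_of_eventuallyEq (v1.continuousAt.tendsto.mono_left nhdsWithin_le_nhds) t2 t1
        rw [sub_self, zero_pow (by omega), zero_mul] at this
        exact v2 this
      have haS : a ∈ S := (hS a).2 ⟨ha, by rw [huz]; simp⟩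
      refine ⟨fun z => (-Z a) ^ 3 * ((z - Z a) ^ (n a - 3) * ∏ b ∈ S.erase a, (z - Z b) ^ n b), 2, by norm_num, by fun_prop, fun s => ?_⟩
      have e4 : Z a * conj (Z a) = 1 := by rw [mul_conj, normSq_eq_norm_sq, h1]; simp
      rw [← Finset.mul_prod_erase S _ haS, ← mul_assoc, ← mul_pow, ← mul_assoc, show (1 - conj (Z a) * Z s) * -Z a = Z s - Z a by linear_combination Z s * e4,
        ← pow_add, show 3 + (n a - 3) = n a by omega]
  set H : ℂ → ℂ := fun z => χ z * Q z * z ^ (2 - M) with hH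
  have hHd : DifferentiableOn ℂ H (ball 0 (min ρ ρ')) :=
    ((hχ.mono (ball_subset_ball (min_le_left _ _))).mul (hQ.mono (ball_subset_ball (min_le_right _ _)))).mul (by fun_prop)
  have hZb' : ∀ s, Z s ∈ ball (0:ℂ) (min ρ ρ') := fun s => by rw [mem_ball_zero_iff, h1]; exact lt_min hρ hρ'
  have hHc : Continuous fun s => H (Z s) := continuous_iff_continuousAt.2 fun s =>
    ContinuousAt.comp (x := s) (f := Z) (hHd.differentiableAt (isOpen_ball.mem_nhds (hZb' s))).continuousAt hZc.continuousAt
  have hint : ∫ s in (0:ℝ)..T, H (Z s) * (θ s * I * Z s) = 0 := by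
    obtain ⟨G, hG⟩ := hHd.isExactOn_ball
    rw [intervalIntegral.integral_eq_sub_of_hasDerivAt (f := fun s => G (Z s)) (fun s _ => (hG _ (hZb' s)).comp s (hZ s)) (by
      exact (hHc.mul (by fun_prop)).intervalIntegrable _ _)]
    simpa [sub_eq_zero] using congrArg G (hper 0)
  set c1 : ℂ := ∏ a ∈ S, ((2 * I * exp (Θ a / 2 * I))⁻¹) ^ n a with hc1
  have hgP : ∀ s, (g s : ℂ) = c1 * ((1 - conj z0 * Z s) ^ 3 * Q (Z s)) / Z s ^ M := fun s => by
    have e2 : ∀ a, ((k a s : ℝ) : ℂ) = (2 * I * exp (Θ a / 2 * I))⁻¹ * (Z s - Z a) * (exp (Θ s / 2 * I))⁻¹ := fun a => by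
      rw [← hkZ a s]
      have q1 := exp_ne_zero (Θ a / 2 * I)
      have q2 := exp_ne_zero (Θ s / 2 * I)
      have q3 := I_ne_zero
      generalize exp (Θ a / 2 * I) = A at *
      generalize exp (Θ s / 2 * I) = B at *
      field_simp
    have e3 : Z s ^ M = exp (Θ s / 2 * I) ^ N := by
      rw [hZe, hM, ← two_mul, pow_mul, ← exp_nat_mul (Θ s / 2 * I)]; congr 2; push_cast; ring
    rw [← hPQ, e3, hN, hc1, ← Finset.prod_pow_eq_pow_sum, ← Finset.prod_mul_distrib, ← Finset.prod_div_distrib, hg]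
    push_cast
    refine Finset.prod_congr rfl fun a _ => ?_
    rw [e2, mul_pow, mul_pow, inv_pow (exp _)]; rfl
  set r : ℝ → ℝ := fun s => ε * (c1 * (Z s * H (Z s))).re with hr
  have hrc : Continuous r := continuous_const.mul (continuous_re.comp (continuous_const.mul (hZc.mul hHc)))
  have hrF : ∀ s, ε * F s = (normSq (Z s - z0)) ^ 3 * r s := fun s => by
    have e4 : Z s * conj (Z s) = 1 := by rw [mul_conj, normSq_eq_norm_sq, h1]; simp
    have e5 : ((u s : ℝ) : ℝ) * g s = (((Z s - z0) ^ 3 * χ (Z s)) * (g s : ℂ)).re := by rw [huz, re_mul_ofReal]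
    have e6 : ((Z s - z0) ^ 3 * χ (Z s)) * (g s : ℂ) = ((normSq (Z s - z0) ^ 3 : ℝ) : ℂ) * (c1 * (Z s * H (Z s))) := by
      have e7 : 1 - conj z0 * Z s = Z s * conj (Z s - z0) := by rw [map_sub]; linear_combination -e4
      have e8 : Z s ^ (2 - M) * Z s ^ M = Z s ^ 2 := by rw [← pow_add]; congr 1; omega
      rw [hgP, e7]; push_cast; rw [← mul_conj]
      simp only [hH]
      rw [mul_div_assoc', div_eq_iff (pow_ne_zero _ (hZ0 s))]
      linear_combination (-(Z s - z0) ^ 3 * conj (Z s - z0) ^ 3 * c1 * Z s * χ (Z s) * Q (Z s)) * e8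
    simp only [hF, hr]
    rw [e5, e6, re_ofReal_mul]; ring
  have hr0 : ∀ s, 0 ≤ r s := fun s => by
    by_contra! h
    have h2 : ∀ᶠ x in 𝓝[≠] s, F x = 0 := by
      filter_upwards [nhdsWithin_le_nhds (hrc.continuousAt.eventually (gt_mem_nhds h))] with x hx
      have a := hεF x
      have b := hrF x
      have d : 0 ≤ normSq (Z x - z0) ^ 3 := pow_nonneg (normSq_nonneg _) 3
      have : ε * F x = 0 := by nlinarith
      exact (mul_eq_zero.1 this).resolve_left hε
    rcases hloc s with h3 | h3 <;> obtain ⟨x, x1, x2⟩ := (h2.and h3).exists <;> rw [x1] at x2 <;> exact lt_irrefl _ x2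
  have hpos : 0 < ∫ s in (0:ℝ)..T, r s * θ s := by
    refine intervalIntegral.integral_pos hT (hrc.mul hc).continuousOn (fun s _ => mul_nonneg (hr0 s) (hp s).le) ?_
    obtain ⟨c, hc, hcF⟩ := hF0
    refine ⟨c, hc, mul_pos (lt_of_le_of_ne (hr0 c) fun h => ?_) (hp c)⟩
    have := hrF c
    rw [← h, mul_zero] at this
    exact mul_ne_zero hε hcF this
  have : ∫ s in (0:ℝ)..T, r s * θ s = 0 := by
    have e1 : ∀ s, r s * θ s = reCLM (ε * c1 * -I * (H (Z s) * (θ s * I * Z s))) := fun s => by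
      simp only [hr, reCLM_apply]
      rw [show (ε:ℂ) * c1 * -I * (H (Z s) * (θ s * I * Z s)) = ((ε * θ s : ℝ) : ℂ) * (c1 * (Z s * H (Z s))) by
        push_cast; linear_combination (-(ε:ℂ) * c1 * H (Z s) * θ s * Z s) * I_sq, re_ofReal_mul]; ring
    simp only [e1]
    rw [reCLM.intervalIntegral_comp_comm (μ := volume) (f := fun s => (ε:ℂ) * c1 * -I * (H (Z s) * (θ s * I * Z s))) ((continuous_const.mul (hHc.mul (by fun_prop))).intervalIntegrable _ _), intervalIntegral.integral_const_mul, hint]; simp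
  linarith
lemma taylor3 {Ψ : ℂ → ℂ} {U : Set ℂ} (hU : IsOpen U) (h : DifferentiableOn ℂ Ψ U) {p : ℂ} (hp : p ∈ U) (h0 : deriv (deriv Ψ) p = 0) :
    ∃ k : ℂ → ℂ, DifferentiableOn ℂ k U ∧ ∀ w, Ψ w = Ψ p + deriv Ψ p * (w - p) + (w - p) ^ 3 * k w := by
  have hn := hU.mem_nhds hp
  have d1 := (differentiableOn_dslope hn).2 h
  have d2 := (differentiableOn_dslope hn).2 d1
  have e1 : ∀ w, Ψ w = (w - p) * dslope Ψ p w + Ψ p := fun w => by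
    have := sub_smul_dslope Ψ p w; rw [smul_eq_mul] at this; rw [this]; ring
  have e2 : deriv Ψ =ᶠ[𝓝 p] fun w => 1 * dslope Ψ p w + (w - p) * deriv (dslope Ψ p) w := by
    filter_upwards [hn] with w hw
    have := ((((hasDerivAt_id w).sub_const p).mul (d1.differentiableAt (hU.mem_nhds hw)).hasDerivAt).add_const (Ψ p)).congr_of_eventuallyEq (f₁ := Ψ) (Eventually.of_forall fun w => e1 w)
    exact this.deriv
  have e3 : deriv (dslope Ψ p) p = 0 := by
    have a := (d1.differentiableAt hn).hasDerivAt
    have b := ((d1.deriv hU).differentiableAt hn).hasDerivAt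
    have := ((a.const_mul 1).add (((hasDerivAt_id p).sub_const p).mul b)).congr_of_eventuallyEq (f₁ := deriv Ψ) e2
    have := this.deriv
    simp only [id, sub_self, zero_mul, add_zero, one_mul, h0] at this
    linear_combination -this / 2
  refine ⟨dslope (dslope (dslope Ψ p) p) p, (differentiableOn_dslope hn).2 d2, fun w => ?_⟩
  have f2 := sub_smul_dslope (dslope Ψ p) p w
  have f3 := sub_smul_dslope (dslope (dslope Ψ p) p) p w
  rw [smul_eq_mul, dslope_same] at f2 f3
  rw [e3, sub_zero] at f3
  have := e1 w
  linear_combination this - (w - p) * f2 - (w - p) ^ 2 * f3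

namespace Cv
variable {T : ℝ} {w : ℝ → ℂ} {V U : Set ℂ} {ψ φ Ψ : ℂ → ℂ} {ρ : ℝ}

lemma injOn (C : Cv T w) : InjOn w (Ico 0 T) := by
  intro a ha b hb this
  obtain ⟨n, hn⟩ := C.inj this.symm
  have hT := C.hT
  have : (n:ℝ) * T = b - a := by linarith
  have n1 : (n:ℝ) < 1 := by by_contra h; push Not at h; nlinarith [ha.1, hb.2]
  have n2 : (-1:ℝ) < n := by by_contra h; push Not at h; nlinarith [ha.2, hb.1]
  have : n = 0 := by
    have : n < 1 := by exact_mod_cast n1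
    have : -1 < n := by exact_mod_cast n2
    omega
  rw [this] at hn; simp at hn; exact hn.symm

lemma Cf.shrink (K : Cf w V ψ φ ρ) {N : Set ℂ} (hN : IsOpen N) (h : closure (Om w) ⊆ N) :
    ∃ ρ', 1 < ρ' ∧ ρ' ≤ ρ ∧ MapsTo φ (ball 0 ρ') N := by
  have o : IsOpen (ball 0 ρ ∩ φ ⁻¹' N) := K.df'.continuousOn.isOpen_inter_preimage isOpen_ball hN
  obtain ⟨δ, hδ, hs⟩ := (isCompact_closedBall (0:ℂ) 1).exists_thickening_subset_open o (fun ζ hζ => ⟨closedBall_subset_ball K.hρ hζ, h (K.cl ζ hζ)⟩)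
  rw [thickening_closedBall hδ zero_le_one] at hs
  refine ⟨min (δ + 1) ρ, lt_min (by linarith) K.hρ, min_le_right _ _, fun z hz => (hs (ball_subset_ball (min_le_left _ _) hz)).2⟩

lemma Cf.hd (C : Cv T w) (K : Cf w V ψ φ ρ) (s : ℝ) : HasDerivAt (fun s => ψ (w s)) (deriv ψ (w s) * deriv w s) s := by
  have hw : w s ∈ V := K.sub (C.range_closure s)
  exact (K.df.differentiableAt (K.op.mem_nhds hw)).hasDerivAt.comp s (C.hd s)

lemma Cf.Zd (C : Cv T w) (K : Cf w V ψ φ ρ) (s : ℝ) :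
    deriv ψ (w s) * deriv w s = ((conj (ψ (w s)) * (deriv ψ (w s) * deriv w s)).im : ℝ) * I * ψ (w s) := by
  have h0 := Cf.hd C K s
  have h2 : (conj (ψ (w s)) * (deriv ψ (w s) * deriv w s)).re = 0 := by
    have := h0.norm_sq
    rw [show (fun s => ‖ψ (w s)‖ ^ 2) = fun _ => (1:ℝ) from funext fun s => by rw [K.bd, one_pow] ] at this
    have := this.unique (hasDerivAt_const s (1:ℝ))
    rw [Complex.inner] at this
    rw [mul_comm]; linarith
  have h3 : ψ (w s) * conj (ψ (w s)) = 1 := by rw [mul_conj, normSq_eq_norm_sq, K.bd]; norm_num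
  set A := conj (ψ (w s)) * (deriv ψ (w s) * deriv w s) with hA
  have h4 : A = A.im * I := by conv_lhs => rw [← re_add_im A, h2]
                               simp
  rw [← h4, hA]; linear_combination (-(deriv ψ (w s) * deriv w s)) * h3

theorem P5 (C : Cv T w) (K : Cf w V ψ φ ρ) (hU : IsOpen U) (hs : closure (Om w) ⊆ U) (hΨ : DifferentiableOn ℂ Ψ U)
    {z : ℝ → ℝ} (hz : AnalyticOnNhd ℝ z univ) (hzp : ∀ s, z (s + T) = z s) (hre : ∀ s, (Ψ (w s)).re = z s)
    (H : ∀ (c : ℂ) (d : ℝ), Cnt T (fun s => z s - (c * w s).re - d)) : ∀ p ∈ closure (Om w), deriv (deriv Ψ) p ≠ 0 := by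
  intro p hp h0
  obtain ⟨k, hk, hke⟩ := taylor3 hU hΨ (hs hp) h0
  obtain ⟨ρ', h1, h2, h3⟩ := Cf.shrink K hU hs
  have hpb := (K.l p (K.sub hp))
  have d1 : DifferentiableOn ℂ (dslope φ (ψ p)) (ball 0 ρ') := ((differentiableOn_dslope (isOpen_ball.mem_nhds hpb.1)).2 K.df').mono (ball_subset_ball h2)
  have hle : ‖ψ p‖ ≤ 1 := by
    rcases C.closure_cases hp with h | ⟨s, rfl⟩
    exacts [(K.lt p h).le, (K.bd s).le]
  have hwc := C.cont
  have hVw : ∀ s, w s ∈ V := fun s => K.sub (C.range_closure s)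
  have hcψ : Continuous fun s => ψ (w s) := continuous_iff_continuousAt.2 fun s => (Cf.hd C K s).continuousAt
  have hcd : Continuous fun s => deriv ψ (w s) := (K.df.deriv K.op).continuousOn.comp_continuous hwc hVw
  have hcw := C.cont'
  refine SH C.hT (Z := fun s => ψ (w s)) (θ := fun s => (conj (ψ (w s)) * (deriv ψ (w s) * deriv w s)).im) ?_ K.im ?_ ?_ K.bd (fun s => by rw [C.per])
    ?_ (u := fun s => z s - (deriv Ψ p * w s).re - (Ψ p - deriv Ψ p * p).re) ?_ ?_ (H _ _) h1
    (χ := fun ζ => k (φ ζ) * dslope φ (ψ p) ζ ^ 3) ((hk.comp (K.df'.mono (ball_subset_ball h2)) h3).mul (d1.pow 3)) hle ?_ ?_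
  · exact continuous_im.comp ((continuous_conj.comp hcψ).mul (hcd.mul hcw))
  · intro s; simp only [C.per, per_deriv C.per]
  · intro s; rw [← Cf.Zd C K s]; exact Cf.hd C K s
  · exact fun a ha b hb e => C.injOn ha hb (by rw [← (K.l _ (hVw a)).2, ← (K.l _ (hVw b)).2]; exact congrArg φ e)
  · intro s _
    have := C.an s trivial
    exact ((hz s trivial).sub ((reCLM.analyticAt _).comp (analyticAt_const.mul this))).sub analyticAt_const
  · intro s; simp only [C.per, hzp]
  · intro h
    rcases C.closure_cases hp with h' | ⟨s, rfl⟩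
    · have := K.lt p h'; linarith
    · obtain ⟨h, hh, n, hn⟩ := Ico_rep C.hT 0 s
      refine ⟨h, by simpa using hh, ?_⟩
      rw [hn, C.P.int_mul n h]
  · intro s
    beta_reduce
    rw [← hre, hke (w s)]
    have e := sub_smul_dslope φ (ψ p) (ψ (w s))
    rw [smul_eq_mul, hpb.2, (K.l _ (hVw s)).2] at e
    rw [(K.l _ (hVw s)).2, ← sub_re, ← sub_re]
    congr 1
    rw [show (ψ (w s) - ψ p) ^ 3 * (k (w s) * dslope φ (ψ p) (ψ (w s)) ^ 3) = k (w s) * ((ψ (w s) - ψ p) * dslope φ (ψ p) (ψ (w s))) ^ 3 by ring, e]; ring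
end Cv
def CntN (N : ℕ) (T : ℝ) (u : ℝ → ℝ) : Prop := ∀ S : Finset ℝ, (∀ s ∈ S, s ∈ Ico 0 T) → ∀ m : ℝ → ℕ, (∀ s ∈ S, (m s : ℕ∞) ≤ analyticOrderAt u s) → ∑ s ∈ S, m s ≤ N

lemma cntN_of {N : ℕ} {γ : ℝ → ℝ × ℝ × ℝ} {T a b c d : ℝ} (h : planeCount γ T a b c d ≤ N)
    (han : AnalyticOnNhd ℝ (fun u => a * (γ u).1 + b * (γ u).2.1 + c * (γ u).2.2 + d) univ) :
    CntN N T (fun u => a * (γ u).1 + b * (γ u).2.1 + c * (γ u).2.2 + d) := by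
  intro S hS m hm
  set φ := fun u => a * (γ u).1 + b * (γ u).2.1 + c * (γ u).2.2 + d with hφ
  have hk : ∀ s ∈ S, ∀ i < m s, iteratedDeriv i φ s = 0 := fun s hs => (natCast_le_analyticOrderAt_iff_iteratedDeriv_eq_zero (han s trivial)).1 (hm s hs)
  set p : ℝ → Prop := fun s => s ∈ Ico 0 T ∧ a * (γ s).1 + b * (γ s).2.1 + c * (γ s).2.2 + d = 0 with hp
  set g : {s // p s} → ℕ∞ := fun s => intersectionMult φ s with hg
  classical
  set S' := S.filter fun s => m s ≠ 0
  have hS' : ∀ s ∈ S', p s := fun s hs => by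
    obtain ⟨h1, h2⟩ := Finset.mem_filter.1 hs
    have := hk s h1 0 (Nat.pos_of_ne_zero h2)
    rw [iteratedDeriv_zero] at this
    exact ⟨hS s h1, this⟩
  have hsum : HasSum g (⨆ s, ∑ a ∈ s, g a) := tendsto_atTop_iSup fun s t h => Finset.sum_le_sum_of_subset h
  have h1 : ∑ s ∈ S'.subtype p, g s ≤ N := (hsum.summable.sum_le_tsum _ fun _ _ => zero_le).trans h
  have h2 : ((∑ s ∈ S, m s : ℕ) : ℕ∞) ≤ ∑ s ∈ S'.subtype p, g s := by
    have e : ∑ s ∈ S, m s = ∑ s ∈ S'.subtype p, m s := by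
      rw [Finset.sum_subtype_eq_sum_filter (f := m), Finset.filter_true_of_mem hS', Finset.sum_filter_ne_zero]
    rw [e, Nat.cast_sum]
    refine Finset.sum_le_sum fun s hs => le_sSup fun i _ hi => hk s ?_ i (by exact_mod_cast hi)
    exact (Finset.mem_filter.1 (Finset.mem_subtype.1 hs)).1
  exact_mod_cast h2.trans h1

variable {T : ℝ} {u : ℝ → ℝ} {N : ℕ}

lemma itp (h : ∀ s, u (s + T) = u s) (i : ℕ) : Function.Periodic (iteratedDeriv i u) T := fun s => by
  rw [← congrFun (iteratedDeriv_comp_add_const i u T) s]; simp only [h]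

lemma CntN.neg (hT : 0 < T) (hu : AnalyticOnNhd ℝ u univ) (hp : ∀ s, u (s + T) = u s) (h : CntN N T u) : CntN N T (fun s => u (-s)) := by
  intro S hS m hm
  set σ : ℝ → ℝ := fun s => if s = 0 then 0 else T - s with hσ
  have hσσ : ∀ s, s < T → σ (σ s) = s := fun s h => by
    by_cases h0 : s = 0
    · simp [hσ, h0]
    · simp only [hσ, h0, if_false]; rw [if_neg (by linarith)]; ring
  have hun : AnalyticOnNhd ℝ (fun s => u (-s)) univ := fun s _ => (hu (-s) trivial).fun_comp analyticAt_id.neg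
  have hl : ∀ s ∈ Ico 0 T, σ s ∈ Ico 0 T := fun s h => by
    by_cases h0 : s = 0
    · simp [hσ, h0, hT]
    · simp only [hσ, h0, if_false]
      have := lt_of_le_of_ne h.1 (Ne.symm h0)
      exact ⟨by linarith [h.2], by linarith⟩
  have := h (S.image σ) (fun s hs => by obtain ⟨r, hr, rfl⟩ := Finset.mem_image.1 hs; exact hl r (hS r hr)) (fun s => m (σ s)) ?_
  · rwa [Finset.sum_image (fun x hx y hy e => by rw [← hσσ x (hS x hx).2, ← hσσ y (hS y hy).2, e]), Finset.sum_congr rfl (fun s hs => by rw [hσσ s (hS s hs).2])] at this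
  · intro s hs
    obtain ⟨r, hr, rfl⟩ := Finset.mem_image.1 hs
    rw [hσσ r (hS r hr).2, natCast_le_analyticOrderAt_iff_iteratedDeriv_eq_zero (hu _ trivial)]
    intro i hi
    have h1 := (natCast_le_analyticOrderAt_iff_iteratedDeriv_eq_zero (hun r trivial)).1 (hm r hr) i hi
    rw [iteratedDeriv_comp_neg, smul_eq_zero] at h1
    have h2 := h1.resolve_left (pow_ne_zero _ (by norm_num))
    by_cases h0 : r = 0
    · simpa [hσ, h0] using h2
    · simp only [hσ, h0, if_false]
      rw [← h2, ← itp hp i (-r)]; ring_nf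

lemma CntN.two (hT : 0 < T) (hu : AnalyticOnNhd ℝ u univ) (hp : ∀ s, u (s + T) = u s) (h : CntN N T u) {s h' : ℝ} (h0 : 0 < h') (h1 : h' < T) (m n : ℕ)
    (hm : ∀ i < m, iteratedDeriv i u s = 0) (hn : ∀ i < n, iteratedDeriv i u (s + h') = 0) : m + n ≤ N := by
  obtain ⟨r, hr, k, hk⟩ := Ico_rep hT 0 s
  obtain ⟨r', hr', k', hk'⟩ := Ico_rep hT 0 (s + h')
  rw [zero_add] at hr hr'
  have hne : r ≠ r' := fun e => by
    have e1 : h' = (k' - k : ℤ) * T := by push_cast; rw [← e] at hk'; linarith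
    have a : (0:ℝ) < (k' - k : ℤ) := by by_contra hh; push Not at hh; nlinarith
    have b : ((k' - k : ℤ) : ℝ) < 1 := by by_contra hh; push Not at hh; nlinarith
    have a' : 0 < k' - k := by exact_mod_cast a
    have b' : k' - k < 1 := by exact_mod_cast b
    omega
  classical
  have := h {r, r'} (by simp [hr.1, hr.2, hr'.1, hr'.2]) (fun x => if x = r then m else n) ?_
  · rwa [Finset.sum_pair hne, if_pos rfl, if_neg hne.symm] at this
  · intro x hx
    rw [natCast_le_analyticOrderAt_iff_iteratedDeriv_eq_zero (hu _ trivial)]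
    rcases Finset.mem_insert.1 hx with rfl | hx
    · rw [if_pos rfl]; intro i hi; rw [← hm i hi, hk, (itp hp i).int_mul k]
    · rw [Finset.mem_singleton.1 hx, if_neg hne.symm]; intro i hi; rw [← hn i hi, hk', (itp hp i).int_mul k']

section
variable {w : ℝ → ℂ}

lemma im_hd {f : ℝ → ℂ} {f' : ℂ} {s : ℝ} (h : HasDerivAt f f' s) (c : ℂ) (d : ℝ) : HasDerivAt (fun s => (c * f s).im - d) (c * f').im s :=
  (HasFDerivAt.comp_hasDerivAt (l := imCLM) s imCLM.hasFDerivAt (h.const_mul c)).sub_const d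

lemma im_an (ha : AnalyticOnNhd ℝ w univ) (c : ℂ) (d : ℝ) : AnalyticOnNhd ℝ (fun s => (c * w s).im - d) univ :=
  fun s _ => ((imCLM.analyticAt _).comp (analyticAt_const.mul (ha s trivial))).sub analyticAt_const

lemma im_it (ha : AnalyticOnNhd ℝ w univ) (c : ℂ) (d : ℝ) :
    iteratedDeriv 1 (fun s => (c * w s).im - d) = (fun s => (c * deriv w s).im) ∧ iteratedDeriv 2 (fun s => (c * w s).im - d) = fun s => (c * deriv (deriv w) s).im := by
  have h1 : iteratedDeriv 1 (fun s => (c * w s).im - d) = (fun s => (c * deriv w s).im) := by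
    rw [iteratedDeriv_one]; ext s; exact (im_hd (ha s trivial).differentiableAt.hasDerivAt c d).deriv
  refine ⟨h1, ?_⟩
  rw [iteratedDeriv_succ, h1]; ext s
  simpa using (im_hd (ha s trivial).deriv.differentiableAt.hasDerivAt c 0).deriv

lemma H2a (hT : 0 < T) (ha : AnalyticOnNhd ℝ w univ) (hp : ∀ s, w (s + T) = w s) (H : ∀ (c : ℂ) (d : ℝ), c ≠ 0 → CntN 2 T (fun s => (c * w s).im - d))
    {c : ℂ} (hc : c ≠ 0) {s : ℝ} (h1 : (c * deriv w s).im = 0) : (∀ h, 0 < h → h < T → (c * (w (s + h) - w s)).im ≠ 0) ∧ (c * deriv (deriv w) s).im ≠ 0 := by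
  obtain ⟨e1, e2⟩ := im_it ha c (c * w s).im
  have key := fun {h} => (H c (c * w s).im hc).two (s := s) (h' := h) hT (im_an ha _ _) (fun s => by simp only [hp])
  constructor
  · intro h h0 hT e
    have := key h0 hT 2 1 (fun i hi => by interval_cases i; exacts [by simp, by rw [e1]; exact h1]) (fun i hi => by
      interval_cases i; simpa [mul_sub] using e)
    omega
  · intro e
    have := key (half_pos hT) (half_lt_self hT) 3 0 (fun i hi => by interval_cases i; exacts [by simp, by rw [e1]; exact h1, by rw [e2]; exact e]) (by simp)
    omega

lemma H2b (hT : 0 < T) (ha : AnalyticOnNhd ℝ w univ) (hp : ∀ s, w (s + T) = w s) (H : ∀ (c : ℂ) (d : ℝ), c ≠ 0 → CntN 2 T (fun s => (c * w s).im - d))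
    (s : ℝ) : deriv w s ≠ 0 := by
  intro h
  by_cases h0 : w (s + T / 2) - w s = 0
  · exact (H2a hT ha hp H one_ne_zero (s := s) (by simp [h])).1 _ (half_pos hT) (half_lt_self hT) (by simp [h0])
  · refine (H2a hT ha hp H (c := conj (w (s + T / 2) - w s)) ((map_ne_zero _).2 h0) (s := s) (by simp [h])).1 _ (half_pos hT) (half_lt_self hT) ?_
    rw [mul_comm, mul_conj, ofReal_im]

lemma H2c (hT : 0 < T) (ha : AnalyticOnNhd ℝ w univ) (hp : ∀ s, w (s + T) = w s) (H : ∀ (c : ℂ) (d : ℝ), c ≠ 0 → CntN 2 T (fun s => (c * w s).im - d))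
    (s : ℝ) : (∀ h, 0 < h → h < T → (conj (deriv w s) * (w (s + h) - w s)).im ≠ 0) ∧ (conj (deriv w s) * deriv (deriv w) s).im ≠ 0 :=
  H2a hT ha hp H (by simpa using H2b hT ha hp H s) (by rw [mul_comm, mul_conj, ofReal_im])

lemma mkCv (hT : 0 < T) (ha : AnalyticOnNhd ℝ w univ) (hp : ∀ s, w (s + T) = w s) (H : ∀ (c : ℂ) (d : ℝ), c ≠ 0 → CntN 2 T (fun s => (c * w s).im - d))
    (hJ : ∀ s h, 0 < h → h < T → 0 < (conj (deriv w s) * (w (s + h) - w s)).im) : Cv T w := by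
  refine ⟨hT, ha, hp, hJ, fun s => ?_⟩
  by_contra hc
  have hc := lt_of_le_of_ne (not_lt.1 hc) (H2c hT ha hp H s).2
  set c := conj (deriv w s)
  obtain ⟨e1, e2⟩ := im_it ha c (c * w s).im
  have hm : IsLocalMax (fun x => (c * w x).im - (c * w s).im) s := by
    refine isLocalMax_of_deriv_deriv_neg ?_ ?_ ((im_an ha _ _) s trivial).continuousAt
    · rw [← iteratedDeriv_one (f := fun x => (c * w x).im - (c * w s).im), ← iteratedDeriv_succ, e2]; exact hc
    · rw [← iteratedDeriv_one, e1]; show (conj (deriv w s) * deriv w s).im = 0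
      rw [mul_comm, mul_conj, ofReal_im]
  have h1 : Tendsto (fun h => s + h) (𝓝[>] (0:ℝ)) (𝓝 s) := by
    have : Tendsto (fun h => s + h) (𝓝 (0:ℝ)) (𝓝 (s + 0)) := tendsto_const_nhds.add tendsto_id
    rw [add_zero] at this
    exact this.mono_left nhdsWithin_le_nhds
  obtain ⟨h, h2, h3⟩ := ((h1.eventually hm).and (Ioo_mem_nhdsGT hT)).exists
  have := hJ s h h3.1 h3.2
  rw [mul_sub, sub_im] at this
  linarith

lemma Jsign (hT : 0 < T) (ha : AnalyticOnNhd ℝ w univ) (hp : ∀ s, w (s + T) = w s) (H : ∀ (c : ℂ) (d : ℝ), c ≠ 0 → CntN 2 T (fun s => (c * w s).im - d)) :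
    (∀ s h, 0 < h → h < T → 0 < (conj (deriv w s) * (w (s + h) - w s)).im) ∨ ∀ s h, 0 < h → h < T → (conj (deriv w s) * (w (s + h) - w s)).im < 0 := by
  by_contra! hc
  obtain ⟨⟨s, h, h0, h1, h2⟩, s', h', h0', h1', h2'⟩ := hc
  have c1 : Continuous w := continuous_iff_continuousAt.2 fun s => (ha s trivial).continuousAt
  have c2 : Continuous (deriv w) := continuous_iff_continuousAt.2 fun s => (ha s trivial).deriv.continuousAt
  obtain ⟨x, hx, e⟩ := ((convex_univ (𝕜 := ℝ) (E := ℝ)).prod (convex_Ioo 0 T)).isPreconnected.intermediate_value₂ (a := (s, h)) (b := (s', h')) ⟨trivial, h0, h1⟩ ⟨trivial, h0', h1'⟩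
    (f := fun q : ℝ × ℝ => (conj (deriv w q.1) * (w (q.1 + q.2) - w q.1)).im) (g := fun _ => (0:ℝ))
    (by refine Continuous.continuousOn ?_; have := continuous_conj; fun_prop) continuousOn_const h2 h2'
  exact (H2c hT ha hp H x.1).1 x.2 hx.2.1 hx.2.2 e
end

theorem P0 {γ : ℝ → ℝ × ℝ × ℝ} (hT : 0 < T)
    (hana : AnalyticOnNhd ℝ γ univ) (hper : ∀ s, γ (s + T) = γ s)
    (h4 : ∀ a b c d : ℝ, ¬(a = 0 ∧ b = 0 ∧ c = 0) → planeCount γ T a b c d ≤ 4)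
    (h2 : ∀ a b d : ℝ, ¬(a = 0 ∧ b = 0) → planeCount γ T a b 0 d ≤ 2) :
    ∃ (w : ℝ → ℂ) (z : ℝ → ℝ), Cv T w ∧ AnalyticOnNhd ℝ z univ ∧ (∀ s, z (s + T) = z s) ∧ (∀ (c : ℂ) (d : ℝ), Cnt T (fun s => z s - (c * w s).re - d)) ∧
      range γ = range fun s => ((w s).re, (w s).im, z s) := by
  have x1 : AnalyticOnNhd ℝ (fun s => (γ s).1) univ := fun s _ => (ContinuousLinearMap.fst ℝ ℝ (ℝ × ℝ)).analyticAt _ |>.comp (hana s trivial)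
  have x0 : AnalyticOnNhd ℝ (fun s => (γ s).2) univ := fun s _ => (ContinuousLinearMap.snd ℝ ℝ (ℝ × ℝ)).analyticAt _ |>.comp (hana s trivial)
  have x2 : AnalyticOnNhd ℝ (fun s => (γ s).2.1) univ := fun s _ => (ContinuousLinearMap.fst ℝ ℝ ℝ).analyticAt _ |>.comp (x0 s trivial)
  have x3 : AnalyticOnNhd ℝ (fun s => (γ s).2.2) univ := fun s _ => (ContinuousLinearMap.snd ℝ ℝ ℝ).analyticAt _ |>.comp (x0 s trivial)
  have hl : ∀ a b c d : ℝ, AnalyticOnNhd ℝ (fun u => a * (γ u).1 + b * (γ u).2.1 + c * (γ u).2.2 + d) univ := fun a b c d s _ =>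
    (((analyticAt_const.mul (x1 s trivial)).add (analyticAt_const.mul (x2 s trivial))).add (analyticAt_const.mul (x3 s trivial))).add analyticAt_const
  set w : ℝ → ℂ := fun s => (γ s).1 + (γ s).2.1 * I with hw
  have wre : ∀ s, (w s).re = (γ s).1 := fun s => by simp [hw]
  have wim : ∀ s, (w s).im = (γ s).2.1 := fun s => by simp [hw]
  have ha : AnalyticOnNhd ℝ w univ := fun s _ => ((ofRealCLM.analyticAt _).comp (x1 s trivial)).add (((ofRealCLM.analyticAt _).comp (x2 s trivial)).mul analyticAt_const)
  have hwp : ∀ s, w (s + T) = w s := fun s => by simp only [hw, hper]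
  have H : ∀ (c : ℂ) (d : ℝ), c ≠ 0 → CntN 2 T (fun s => (c * w s).im - d) := fun c d hc => by
    have := cntN_of (h2 c.im c.re (-d) fun h => hc (Complex.ext h.2 h.1)) (hl _ _ _ _)
    convert this using 2 with s
    rw [mul_im, wre, wim]; ring
  have H4 : ∀ (c : ℂ) (d : ℝ), Cnt T (fun s => (γ s).2.2 - (c * w s).re - d) := fun c d => by
    have := cntN_of (N := 4) (h4 (-c.re) c.im 1 (-d) fun h => one_ne_zero h.2.2) (hl _ _ _ _)
    change CntN 4 T _
    convert this using 2 with s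
    rw [mul_re, wre, wim]; ring
  rcases Jsign hT ha hwp H with hJ | hJ
  · exact ⟨w, fun s => (γ s).2.2, mkCv hT ha hwp H hJ, x3, fun s => by simp only [hper], H4, by simp only [wre, wim]⟩
  · have hn : ∀ s, w (-(s + T)) = w (-s) := fun s => by rw [← hwp (-(s + T))]; ring_nf
    refine ⟨fun s => w (-s), fun s => (γ (-s)).2.2, mkCv hT (fun s _ => (ha (-s) trivial).fun_comp analyticAt_id.neg) hn (fun c d hc => ?_) ?_, fun s _ => (x3 (-s) trivial).fun_comp analyticAt_id.neg, fun s => ?_, fun c d => ?_, ?_⟩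
    · exact (H c d hc).neg hT (im_an ha _ _) (fun s => by simp only [hwp])
    · intro s h h0 h1
      have := hJ (-s) (T - h) (by linarith) (by linarith)
      rw [deriv_comp_neg, map_neg, neg_mul, neg_im, show w (-(s + h)) = w (-s + (T - h)) by rw [← hwp (-(s + h))]; ring_nf]
      linarith
    · show (γ (-(s + T))).2.2 = _
      rw [← hper (-(s + T))]; ring_nf
    · exact CntN.neg (N := 4) hT (u := fun s => (γ s).2.2 - (c * w s).re - d) (fun s _ => ((x3 s trivial).sub ((reCLM.analyticAt _).comp (analyticAt_const.mul (ha s trivial)))).sub analyticAt_const) (fun s => by simp only [hwp, hper]) (H4 c d)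
    · simp only [wre, wim]
      exact (neg_surjective.range_comp γ).symm
lemma pd1 {F : ℂ × ℂ → ℂ} {ξ η : ℂ} (h : DifferentiableAt ℂ F (ξ, η)) : HasDerivAt (fun z => F (z, η)) (fderiv ℂ F (ξ, η) (1, 0)) ξ :=
  HasFDerivAt.comp_hasDerivAt (f := fun z : ℂ => (z, η)) ξ h.hasFDerivAt ((hasDerivAt_id ξ).prodMk (hasDerivAt_const ξ η))
lemma pd2 {F : ℂ × ℂ → ℂ} {ξ η : ℂ} (h : DifferentiableAt ℂ F (ξ, η)) : HasDerivAt (fun z => F (ξ, z)) (fderiv ℂ F (ξ, η) (0, 1)) η :=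
  HasFDerivAt.comp_hasDerivAt (f := fun z : ℂ => (ξ, z)) η h.hasFDerivAt ((hasDerivAt_const η ξ).prodMk (hasDerivAt_id η))
lemma pdc {F : ℂ × ℂ → ℂ} {ζ : ℝ → ℂ} {v : ℂ} {s : ℝ} (h : DifferentiableAt ℂ F (ζ s, conj (ζ s))) (hζ : HasDerivAt ζ v s) :
    HasDerivAt (fun s => F (ζ s, conj (ζ s))) (fderiv ℂ F (ζ s, conj (ζ s)) (1, 0) * v + fderiv ℂ F (ζ s, conj (ζ s)) (0, 1) * conj v) s := by
  have h1 : HasDerivAt (fun s => conj (ζ s)) (conj v) s := HasFDerivAt.comp_hasDerivAt (l := (conjCLE : ℂ →L[ℝ] ℂ)) s conjCLE.hasFDerivAt hζ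
  have h2 := HasFDerivAt.comp_hasDerivAt (f := fun s => (ζ s, conj (ζ s))) s (h.hasFDerivAt.restrictScalars ℝ) (hζ.prodMk h1)
  have h3 : HasDerivAt (fun s => F (ζ s, conj (ζ s))) (fderiv ℂ F (ζ s, conj (ζ s)) (v, conj v)) s := h2
  rw [show (v, conj v) = v • ((1:ℂ), (0:ℂ)) + conj v • ((0:ℂ), (1:ℂ)) by simp, map_add, map_smul, map_smul, smul_eq_mul, smul_eq_mul, mul_comm v, mul_comm (conj v)] at h3
  exact h3

section
variable {U U1 U11 U12 : ℂ × ℂ → ℂ} {R : ℝ}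

lemma cball {ξ : ℂ} (h : ξ ∈ ball (0:ℂ) R) : conj ξ ∈ ball (0:ℂ) R := by simpa using h

lemma Dg1 (hU : AnalyticOnNhd ℂ U (ball 0 R ×ˢ ball 0 R))
  (hD : ∀ ξ ∈ ball (0:ℂ) R, ∀ η ∈ ball (0:ℂ) R, HasDerivAt (fun z => U (z, η)) (U1 (ξ, η)) ξ)
  (hre : ∀ ξ ∈ ball (0:ℂ) R, (U (ξ, conj ξ)).im = 0) {ζ : ℝ → ℂ} {v : ℂ} {s : ℝ} (hs : ζ s ∈ ball 0 R) (hζ : HasDerivAt ζ v s) :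
    HasDerivAt (fun s => (U (ζ s, conj (ζ s))).re) (2 * (U1 (ζ s, conj (ζ s)) * v).re) s := by
  have hd : DifferentiableAt ℂ U (ζ s, conj (ζ s)) := (hU _ ⟨hs, cball hs⟩).differentiableAt
  have e1 := (pd1 hd).unique (hD _ hs _ (cball hs))
  have key : ∀ e : ℂ, (U1 (ζ s, conj (ζ s)) * e + fderiv ℂ U (ζ s, conj (ζ s)) (0, 1) * conj e).im = 0 := fun e => by
    have h1 : HasDerivAt (fun x : ℝ => ζ s + x * e) e (0:ℝ) := by simpa using ((ofRealCLM.hasDerivAt (x := (0:ℝ))).mul_const e).const_add (ζ s)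
    have h2 := pdc (F := U) (ζ := fun x : ℝ => ζ s + x * e) (s := 0) (by simpa using hd) h1
    simp only [ofReal_zero, zero_mul, add_zero] at h2
    have h3 := HasFDerivAt.comp_hasDerivAt (l := imCLM) (0:ℝ) imCLM.hasFDerivAt h2
    have h4 : (fun x : ℝ => (U (ζ s + x * e, conj (ζ s + x * e))).im) =ᶠ[𝓝 0] fun _ => 0 := by
      have := (h1.continuousAt).preimage_mem_nhds ((isOpen_ball (x := (0:ℂ)) (ε := R)).mem_nhds (x := ζ s + (0:ℝ) * e) (by simpa using hs))
      filter_upwards [this] with x hx using hre _ hx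
    have := h3.unique ((hasDerivAt_const (0:ℝ) (0:ℝ)).congr_of_eventuallyEq h4)
    rw [e1] at this; exact this
  have hB : fderiv ℂ U (ζ s, conj (ζ s)) (0, 1) = conj (U1 (ζ s, conj (ζ s))) := by
    have a := key 1
    have b := key I
    simp at a b
    apply Complex.ext <;> simp <;> linarith
  have e2 : 2 * (U1 (ζ s, conj (ζ s)) * v).re = reCLM (U1 (ζ s, conj (ζ s)) * v + conj (U1 (ζ s, conj (ζ s)) * v)) := by
    rw [reCLM_apply, add_re, conj_re]; ring
  rw [e2, map_mul, ← hB, ← e1]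
  exact HasFDerivAt.comp_hasDerivAt (l := reCLM) s reCLM.hasFDerivAt (pdc hd hζ)

lemma Dg2 (hU : AnalyticOnNhd ℂ U (ball 0 R ×ˢ ball 0 R))
  (hD : ∀ ξ ∈ ball (0:ℂ) R, ∀ η ∈ ball (0:ℂ) R, HasDerivAt (fun z => U (z, η)) (U1 (ξ, η)) ξ ∧ HasDerivAt (fun z => U1 (z, η)) (U11 (ξ, η)) ξ ∧ HasDerivAt (fun z => U1 (ξ, z)) (U12 (ξ, η)) η)
  {ζ : ℝ → ℂ} {v : ℂ} {s : ℝ} (hs : ζ s ∈ ball 0 R) (hζ : HasDerivAt ζ v s) :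
    HasDerivAt (fun s => U1 (ζ s, conj (ζ s))) (U11 (ζ s, conj (ζ s)) * v + U12 (ζ s, conj (ζ s)) * conj v) s := by
  have hm : (ζ s, conj (ζ s)) ∈ ball (0:ℂ) R ×ˢ ball (0:ℂ) R := ⟨hs, cball hs⟩
  have hd : DifferentiableAt ℂ U1 (ζ s, conj (ζ s)) := by
    have h1 : DifferentiableAt ℂ (fun q => fderiv ℂ U q (1, 0)) (ζ s, conj (ζ s)) := (hU _ hm).fderiv.differentiableAt.clm_apply (differentiableAt_const _)
    refine h1.congr_of_eventuallyEq ?_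
    filter_upwards [(isOpen_ball.prod isOpen_ball).mem_nhds hm] with q hq
    exact (hD _ hq.1 _ hq.2).1.unique (pd1 (hU _ hq).differentiableAt)
  have := pdc hd hζ
  rwa [(pd1 hd).unique (hD _ hs _ (cball hs)).2.1, (pd2 hd).unique (hD _ hs _ (cball hs)).2.2] at this
end

/-- Algebra of the isotropic CRPC equation. -/
lemma crpc_alg (t : ℝ) (A : ℂ) (B : ℝ) (hB : B = t / √(t ^ 2 + 4) * ‖A‖) :
    2 * (A + B).re + 2 * (I * (A * I + B * conj I)).re = t * √((2 * (A * I + B * conj I).re) ^ 2 - 2 * (A + B).re * (2 * (I * (A * I + B * conj I)).re)) := by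
  have hq : 0 < √(t ^ 2 + 4) := Real.sqrt_pos.2 (by positivity)
  have hq2 : √(t ^ 2 + 4) ^ 2 = t ^ 2 + 4 := Real.sq_sqrt (by positivity)
  set q := √(t ^ 2 + 4)
  have hn : ‖A‖ ^ 2 = A.re ^ 2 + A.im ^ 2 := by rw [← normSq_eq_norm_sq, normSq_apply]; ring
  have e : (2 * (A * I + B * conj I).re) ^ 2 - 2 * (A + B).re * (2 * (I * (A * I + B * conj I)).re) = (4 * ‖A‖ / q) ^ 2 := by
    have : (4 * ‖A‖ / q) ^ 2 = 4 * (‖A‖ ^ 2 - B ^ 2) := by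
      rw [hB]; field_simp; linear_combination (-‖A‖ ^ 2) * hq2
    rw [this, hn]; simp; ring
  rw [e, Real.sqrt_sq (by positivity)]
  have : 2 * (A + B).re + 2 * (I * (A * I + B * conj I)).re = 4 * B := by simp; ring
  rw [this, hB]; field_simp
lemma line_hd (p e : ℂ) (s : ℝ) : HasDerivAt (fun x : ℝ => p + x * e) e s := by
  simpa using ((ofRealCLM.hasDerivAt (x := s)).mul_const e).const_add p

/-- Second derivatives of a function with complex gradient `G`. -/
lemma pds {f0 : ℂ → ℝ} {G A : ℂ → ℂ} {B : ℂ → ℝ} {D : Set ℂ} (hD : IsOpen D)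
    (h1 : ∀ (p e : ℂ) (s : ℝ), p + s * e ∈ D → HasDerivAt (fun x : ℝ => f0 (p + x * e)) (2 * (G (p + s * e) * e).re) s)
    (h2 : ∀ (p e : ℂ) (s : ℝ), p + s * e ∈ D → HasDerivAt (fun x : ℝ => G (p + x * e)) (A (p + s * e) * e + B (p + s * e) * conj e) s)
    {x y : ℝ} (hp : (x + y * I : ℂ) ∈ D) :
    fxx (fun p => f0 (p.1 + p.2 * I)) (x, y) = 2 * (A (x + y * I) + B (x + y * I)).re ∧
    fxy (fun p => f0 (p.1 + p.2 * I)) (x, y) = 2 * (A (x + y * I) * I + B (x + y * I) * conj I).re ∧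
    fyy (fun p => f0 (p.1 + p.2 * I)) (x, y) = 2 * (I * (A (x + y * I) * I + B (x + y * I) * conj I)).re := by
  have px : ∀ x y : ℝ, (x + y * I : ℂ) ∈ D → pdx (fun p => f0 (p.1 + p.2 * I)) (x, y) = 2 * (G (x + y * I)).re := fun x y h => by
    have := (h1 (y * I) 1 x (by convert h using 1; ring)).deriv
    simp only [mul_one, add_comm ((y:ℂ) * I)] at this
    exact this
  have py : ∀ x y : ℝ, (x + y * I : ℂ) ∈ D → pdy (fun p => f0 (p.1 + p.2 * I)) (x, y) = 2 * (I * G (x + y * I)).re := fun x y h => by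
    have := (h1 x I y h).deriv
    rw [mul_comm (G _)] at this
    exact this
  have hR : ∀ {g : ℝ → ℂ} {g' : ℂ} {s : ℝ} (c : ℂ), HasDerivAt g g' s → HasDerivAt (fun s => 2 * (c * g s).re) (2 * (c * g').re) s := fun c h =>
    (HasFDerivAt.comp_hasDerivAt (l := reCLM) _ reCLM.hasFDerivAt (h.const_mul c)).const_mul 2
  have ex : ∀ᶠ s : ℝ in 𝓝 x, (s + y * I : ℂ) ∈ D := (show ContinuousAt (fun s : ℝ => (s + y * I : ℂ)) x by fun_prop).preimage_mem_nhds (hD.mem_nhds hp)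
  have ey : ∀ᶠ s : ℝ in 𝓝 y, (x + s * I : ℂ) ∈ D := (show ContinuousAt (fun s : ℝ => (x + s * I : ℂ)) y by fun_prop).preimage_mem_nhds (hD.mem_nhds hp)
  refine ⟨?_, ?_, ?_⟩
  · have e : (fun s => pdx (fun p => f0 (p.1 + p.2 * I)) (s, y)) =ᶠ[𝓝 x] fun s => 2 * (1 * G (y * I + s * 1)).re := by
      filter_upwards [ex] with s hs; rw [px s y hs, one_mul, mul_one, add_comm]
    have := (hR 1 (h2 (y * I) 1 x (by convert hp using 1; ring))).deriv
    rw [← e.deriv_eq] at this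
    simp [add_comm ((y:ℂ) * I)] at this ⊢
    exact this
  · have e : (fun s => pdx (fun p => f0 (p.1 + p.2 * I)) (x, s)) =ᶠ[𝓝 y] fun s => 2 * (1 * G (x + s * I)).re := by
      filter_upwards [ey] with s hs; rw [px x s hs, one_mul]
    have := (hR 1 (h2 x I y hp)).deriv
    rw [← e.deriv_eq, one_mul] at this
    exact this
  · have e : (fun s => pdy (fun p => f0 (p.1 + p.2 * I)) (x, s)) =ᶠ[𝓝 y] fun s => 2 * (I * G (x + s * I)).re := by
      filter_upwards [ey] with s hs; rw [py x s hs]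
    have := (hR I (h2 x I y hp)).deriv
    rw [← e.deriv_eq] at this
    exact this

/-- The analytic core: solution over the convex domain, in complex notation. -/
theorem Cv.P6 {T : ℝ} {w : ℝ → ℂ} (C : Cv T w) {z : ℝ → ℝ} (hz : AnalyticOnNhd ℝ z univ) (hzp : ∀ s, z (s + T) = z s)
    (H : ∀ (c : ℂ) (d : ℝ), Cnt T (fun s => z s - (c * w s).re - d)) :
    ∃ ε > (0:ℝ), ∀ t : ℝ, |t| < ε → ∃ (D : Set ℂ) (f0 : ℂ → ℝ), IsOpen D ∧ closure (Om w) ⊆ D ∧ AnalyticOnNhd ℝ f0 D ∧ (∀ s, f0 (w s) = z s) ∧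
      ∀ x y : ℝ, (x + y * I : ℂ) ∈ D → IsotropicCRPCAt t (fun p => f0 (p.1 + p.2 * I)) (x, y) := by
  obtain ⟨U0, Ψ, o0, s0, d0, hre⟩ := C.P3 hz hzp
  obtain ⟨V, ψ, φ, ρ, K⟩ := C.P4
  have hne := C.P5 K o0 s0 d0 hz hzp hre H
  have dΨ := d0.deriv o0
  have ddΨ := dΨ.deriv o0
  have dψ := K.df.deriv K.op
  have ddψ := dψ.deriv K.op
  set N := V ∩ (U0 ∩ deriv (deriv Ψ) ⁻¹' {0}ᶜ) with hN
  have oN : IsOpen N := K.op.inter (ddΨ.continuousOn.isOpen_inter_preimage o0 isOpen_compl_singleton)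
  obtain ⟨ρ', r1, r2, r3⟩ := Cf.shrink K oN (fun p hp => ⟨K.sub hp, s0 hp, hne p hp⟩)
  have dφ := K.df'.mono (ball_subset_ball r2)
  have dn : ∀ ζ ∈ ball (0:ℂ) ρ', deriv ψ (φ ζ) ^ 2 ≠ 0 := fun ζ hζ => pow_ne_zero 2 (K.dne _ (r3 hζ).1)
  have dsq : DifferentiableOn ℂ (fun ζ => deriv ψ (φ ζ) ^ 2) (ball 0 ρ') := (dψ.comp dφ fun ζ hζ => (r3 hζ).1).pow 2
  obtain ⟨ε, hε, R, hR, hFP⟩ := FP r1 (a := fun ζ => 1 / 2 * deriv (deriv Ψ) (φ ζ) / deriv ψ (φ ζ) ^ 2) (b := fun ζ => deriv (deriv ψ) (φ ζ) / deriv ψ (φ ζ) ^ 2)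
    (((ddΨ.comp dφ fun ζ hζ => (r3 hζ).2.1).const_mul _).div dsq dn) ((ddψ.comp dφ fun ζ hζ => (r3 hζ).1).div dsq dn)
    (fun ζ hζ => div_ne_zero (mul_ne_zero (by norm_num) (r3 hζ).2.2) (dn ζ hζ))
  refine ⟨ε, hε, fun t ht => ?_⟩
  have hκ : |t / √(t ^ 2 + 4)| < ε := by
    have : 1 ≤ √(t ^ 2 + 4) := Real.one_le_sqrt.2 (by nlinarith)
    rw [abs_div, abs_of_nonneg (Real.sqrt_nonneg _)]
    exact (div_le_self (abs_nonneg t) this).trans_lt ht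
  obtain ⟨U, U1, U11, U12, hU, hD, hu⟩ := hFP _ hκ
  set D := V ∩ ψ ⁻¹' (ball 0 (min R ρ')) with hDd
  have oD : IsOpen D := K.df.continuousOn.isOpen_inter_preimage K.op isOpen_ball
  have D1 : ∀ p ∈ D, ψ p ∈ ball (0:ℂ) R := fun p hp => ball_subset_ball (min_le_left _ _) hp.2
  have D2 : ∀ p ∈ D, p ∈ N := fun p hp => by
    have := r3 (ball_subset_ball (min_le_right R ρ') hp.2)
    rwa [(K.l p hp.1).2] at this
  have hψ : ∀ p ∈ D, HasDerivAt ψ (deriv ψ p) p := fun p hp => (K.df.differentiableAt (K.op.mem_nhds hp.1)).hasDerivAt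
  have hψ' : ∀ p ∈ D, HasDerivAt (deriv ψ) (deriv (deriv ψ) p) p := fun p hp => (dψ.differentiableAt (K.op.mem_nhds hp.1)).hasDerivAt
  have hΨ : ∀ p ∈ D, HasDerivAt Ψ (deriv Ψ p) p := fun p hp => (d0.differentiableAt (o0.mem_nhds (D2 p hp).2.1)).hasDerivAt
  have hΨ' : ∀ p ∈ D, HasDerivAt (deriv Ψ) (deriv (deriv Ψ) p) p := fun p hp => (dΨ.differentiableAt (o0.mem_nhds (D2 p hp).2.1)).hasDerivAt
  set W := fun p => (ψ p, conj (ψ p)) with hW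
  set A := fun p => 1 / 2 * deriv (deriv Ψ) p + U11 (W p) * deriv ψ p ^ 2 + U1 (W p) * deriv (deriv ψ) p with hA
  set B := fun p => t / √(t ^ 2 + 4) * ‖A p‖ with hB
  have hBp : ∀ p ∈ D, (B p : ℂ) = U12 (W p) * (deriv ψ p * conj (deriv ψ p)) := fun p hp => by
    have h1 := (hu _ (D1 p hp)).2.2
    beta_reduce at h1
    rw [(K.l p hp.1).2] at h1
    have hn := K.dne p hp.1
    have e : A p = deriv ψ p ^ 2 * (1 / 2 * deriv (deriv Ψ) p / deriv ψ p ^ 2 + U11 (W p) + deriv (deriv ψ) p / deriv ψ p ^ 2 * U1 (W p)) := by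
      simp only [hA]; field_simp
    rw [hW]; beta_reduce
    rw [h1, mul_conj, normSq_eq_norm_sq, hB]; beta_reduce
    rw [e, norm_mul, norm_pow]; push_cast; ring
  refine ⟨D, fun p => (Ψ p).re + (U (W p)).re, oD, ?_, ?_, ?_, ?_⟩
  · intro p hp
    refine ⟨K.sub hp, mem_ball_zero_iff.2 (lt_of_le_of_lt ?_ (lt_min hR r1))⟩
    rcases C.closure_cases hp with h | ⟨s, rfl⟩
    exacts [(K.lt p h).le, (K.bd s).le]
  · intro p hp
    have h1 : AnalyticAt ℝ ψ p := ((K.df.analyticAt (K.op.mem_nhds hp.1))).restrictScalars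
    have h2 : AnalyticAt ℝ Ψ p := ((d0.analyticAt (o0.mem_nhds (D2 p hp).2.1))).restrictScalars
    have h3 : AnalyticAt ℝ U (W p) := (hU _ ⟨D1 p hp, cball (D1 p hp)⟩).restrictScalars
    exact ((reCLM.analyticAt _).comp h2).add ((reCLM.analyticAt _).comp (h3.comp (h1.prod (((conjCLE : ℂ →L[ℝ] ℂ).analyticAt _).comp h1))))
  · intro s
    beta_reduce
    rw [hre, (hu (ψ (w s)) (by rw [mem_ball_zero_iff, K.bd]; exact hR)).2.1 (K.bd s)]; simp
  · intro x y hp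
    have := pds (f0 := fun p => (Ψ p).re + (U (W p)).re) (G := fun p => 1 / 2 * deriv Ψ p + U1 (W p) * deriv ψ p) (A := A) (B := B) oD ?_ ?_ hp
    · obtain ⟨a, b, c⟩ := this
      rw [IsotropicCRPCAt, a, b, c]
      exact crpc_alg t _ _ rfl
    · intro p e s hs
      have l := line_hd p e s
      have k1 := HasFDerivAt.comp_hasDerivAt (l := reCLM) s reCLM.hasFDerivAt ((hΨ _ hs).comp s l)
      have k2 := Dg1 hU (fun ξ h η h' => (hD ξ h η h').1) (fun ξ h => (hu ξ h).1) (D1 _ hs) ((hψ _ hs).comp s l)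
      refine (k1.add k2).congr_deriv ?_
      simp only [reCLM_apply, Function.comp_apply, hW]
      rw [← mul_assoc, add_mul, add_re, mul_assoc (1/2 : ℂ), show (1/2:ℂ) = ((1/2:ℝ):ℂ) by push_cast; rfl, re_ofReal_mul]; ring
    · intro p e s hs
      have l := line_hd p e s
      have k1 := ((hΨ' _ hs).comp s l).const_mul (1/2 : ℂ)
      have k2 := (Dg2 hU hD (D1 _ hs) ((hψ _ hs).comp s l)).mul ((hψ' _ hs).comp s l)
      refine (k1.add k2).congr_deriv ?_
      rw [hBp _ hs, hA]
      simp only [Function.comp_apply, hW, map_mul]; ring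

theorem Cv.P7 {T : ℝ} {w : ℝ → ℂ} (C : Cv T w) {z : ℝ → ℝ} (hz : AnalyticOnNhd ℝ z univ) (hzp : ∀ s, z (s + T) = z s)
    (H : ∀ (c : ℂ) (d : ℝ), Cnt T (fun s => z s - (c * w s).re - d)) :
    ∃ ε > (0 : ℝ), ∀ t : ℝ, |t| < ε →
      ∃ (Ω : Set (ℝ × ℝ)) (f : ℝ × ℝ → ℝ), IsAnalyticJordanDomain Ω ∧ AnalyticOnClosed f (closure Ω) ∧ (∀ p ∈ Ω, IsotropicCRPCAt t f p) ∧
        (fun p : ℝ × ℝ => (p.1, p.2, f p)) '' frontier Ω = range fun s => ((w s).re, (w s).im, z s) := by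
  obtain ⟨ε, hε, h⟩ := C.P6 hz hzp H
  refine ⟨ε, hε, fun t ht => ?_⟩
  obtain ⟨D, f0, oD, sD, hf, hb, he⟩ := h t ht
  set e := equivRealProdCLM.symm with hedef
  have hes : ∀ p : ℝ × ℝ, e p = p.1 + p.2 * I := fun p => equivRealProd_symm_apply p
  have hew : ∀ q : ℂ, e (q.re, q.im) = q := fun q => by rw [hes]; exact re_add_im q
  have hfr : frontier (e ⁻¹' Om w) = range fun s => ((w s).re, (w s).im) := by
    rw [show frontier (e ⁻¹' Om w) = e ⁻¹' frontier (Om w) from (e.toHomeomorph.preimage_frontier _).symm, C.frontier_Om]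
    ext p
    constructor
    · rintro ⟨s, hs⟩; exact ⟨s, e.injective (by rw [hew, hs])⟩
    · rintro ⟨s, rfl⟩; exact ⟨s, (hew _).symm⟩
  have hcl : closure (e ⁻¹' Om w) = e ⁻¹' closure (Om w) := (e.toHomeomorph.preimage_closure _).symm
  have hce : ∀ q : ℂ, equivRealProdCLM q = (q.re, q.im) := fun q => rfl
  refine ⟨e ⁻¹' Om w, fun p => f0 (p.1 + p.2 * I), ⟨C.open_Om.preimage e.continuous, e.antilipschitz.isBounded_preimage C.bounded_Om, e.toHomeomorph.isConnected_preimage.2 (convex_Om.isConnected C.nonempty_Om), ?_⟩, ?_, ?_, ?_⟩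
  · refine ⟨fun s => equivRealProdCLM (w s), T, C.hT, fun s _ => (equivRealProdCLM.toContinuousLinearMap.analyticAt _).comp (C.an s trivial), fun s => by simp only [C.per], fun a ha b hb h => C.injOn ha hb (equivRealProdCLM.injective h), fun s => ?_, by simpa only [hce] using hfr⟩
    have : HasDerivAt (fun s => equivRealProdCLM (w s)) (equivRealProdCLM (deriv w s)) s := HasFDerivAt.comp_hasDerivAt (l := equivRealProdCLM.toContinuousLinearMap) s equivRealProdCLM.hasFDerivAt (C.hd s)
    rw [this.deriv]; exact fun h => C.ne s (equivRealProdCLM.map_eq_zero_iff.1 h)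
  · refine ⟨e ⁻¹' D, fun p => f0 (p.1 + p.2 * I), oD.preimage e.continuous, by rw [hcl]; exact preimage_mono sD, fun p hp => ?_, fun _ _ => rfl⟩
    simp only [← hes]
    exact (hf (e p) hp).comp (e.toContinuousLinearMap.analyticAt p)
  · rintro ⟨x, y⟩ hp
    exact he x y (sD (subset_closure (by rw [mem_preimage, hes] at hp; exact hp)))
  · rw [hfr, ← range_comp]
    congr 1; ext s : 1
    simp only [Function.comp_apply, re_add_im, hb]
end CRPC

/-- Partial solution of Plateau's problem for isotropic CRPC surfaces. -/
theorem stmt_3 (Γ : Set (ℝ × ℝ × ℝ)) (γ : ℝ → ℝ × ℝ × ℝ) (T : ℝ) (hT : 0 < T)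
    (hana : AnalyticOnNhd ℝ γ univ) (hper : ∀ s, γ (s + T) = γ s)
    (hinj : InjOn γ (Ico 0 T)) (hreg : ∀ s, deriv γ s ≠ 0) (hΓ : Γ = range γ)
    (h4 : ∀ a b c d : ℝ, ¬(a = 0 ∧ b = 0 ∧ c = 0) → planeCount γ T a b c d ≤ 4)
    (h2 : ∀ a b d : ℝ, ¬(a = 0 ∧ b = 0) → planeCount γ T a b 0 d ≤ 2) :
    ∃ ε > (0 : ℝ), ∀ t : ℝ, |t| < ε →
      ∃ (Ω : Set (ℝ × ℝ)) (f : ℝ × ℝ → ℝ),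
        IsAnalyticJordanDomain Ω ∧
        AnalyticOnClosed f (closure Ω) ∧
        (∀ p ∈ Ω, IsotropicCRPCAt t f p) ∧
        (fun p : ℝ × ℝ => (p.1, p.2, f p)) '' frontier Ω = Γ := by
  obtain ⟨w, z, C, hz, hzp, H, hr⟩ := CRPC.P0 hT hana hper h4 h2
  rw [hΓ, hr]
  exact C.P7 hz hzp H

end
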